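/- arXiv:2202.04921 — 6 statements merged into one kernel-verified Lean document; each statement's English description precedes it below -/
import Mathlib

section
/- 26 is the least positive integer n such that every subgraph G of the complete bipartite graph K_{5,n} contains K_{2,2} or the bipartite complement of G contains K_{4,4}; that is, BR_5(K_{2,2}, K_{4,4}) = 26. -/
/-- `G` (an edge set of a subgraph of `K_{m,n}`) contains `K_{s,t}`:
there are an `s`-subset `A` of the `X`-side and a `t`-subset `B` of the `Y`-side
with every pair in `A × B` an edge. -/
def ContainsK (m n s t : ℕ) (G : Finset (Fin m × Fin n)) : Prop :=
  ∃ A : Finset (Fin m), ∃ B : Finset (Fin n),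
    A.card = s ∧ B.card = t ∧ ∀ x ∈ A, ∀ y ∈ B, (x, y) ∈ G

/-- The bipartite complement of a subgraph of `K_{m,n}`. -/
def bipCompl (m n : ℕ) (G : Finset (Fin m × Fin n)) : Finset (Fin m × Fin n) :=
  Finset.univ \ G

/-- The neighborhood in `Y` of a vertex `x` of the `X`-side. -/
def nbhd (m n : ℕ) (G : Finset (Fin m × Fin n)) (x : Fin m) : Finset (Fin n) :=
  Finset.univ.filter (fun y => (x, y) ∈ G)

/-- The degree of a vertex `x` of the `X`-side. -/
def degX (m n : ℕ) (G : Finset (Fin m × Fin n)) (x : Fin m) : ℕ :=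
  (nbhd m n G x).card

/-- Neighbourhood masks of the 25 columns in the extremal example. -/
def colMask (y : ℕ) : ℕ :=
  [3, 5, 9, 17, 6, 10, 18, 12, 20, 24, 1, 2, 4, 8, 16, 1, 2, 4, 8, 16, 1, 2, 4, 8, 16].getD y 0

def exAdj (x : Fin 5) (y : Fin 25) : Bool := (colMask y.val).testBit x.val

set_option maxRecDepth 100000 in
theorem ex_pairs : ∀ A ∈ Finset.powersetCard 2 (Finset.univ : Finset (Fin 5)),
    ((Finset.univ : Finset (Fin 25)).filter (fun y => ∀ x ∈ A, exAdj x y = true)).card ≤ 1 := by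
  decide +kernel

set_option maxRecDepth 100000 in
theorem ex_quads : ∀ A ∈ Finset.powersetCard 4 (Finset.univ : Finset (Fin 5)),
    ((Finset.univ : Finset (Fin 25)).filter (fun y => ∀ x ∈ A, exAdj x y = false)).card ≤ 3 := by
  decide +kernel

theorem lower_part (n : ℕ) (hn : n ≤ 25) : ∃ G : Finset (Fin 5 × Fin n),
    ¬ (ContainsK 5 n 2 2 G ∨ ContainsK 5 n 4 4 (bipCompl 5 n G)) := by
  refine ⟨Finset.univ.filter (fun p => exAdj p.1 (Fin.castLE hn p.2) = true), ?_⟩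
  rintro (⟨A, B, hA, hB, h⟩ | ⟨A, B, hA, hB, h⟩)
  · have h1 := ex_pairs A (by simp [Finset.mem_powersetCard, hA])
    have h2 : (B.map (Fin.castLEEmb hn)).card ≤ 1 := by
      refine (Finset.card_le_card ?_).trans h1
      intro y hy
      obtain ⟨z, hz, rfl⟩ := Finset.mem_map.1 hy
      simp only [Finset.mem_filter, Finset.mem_univ, true_and]
      intro x hx
      simpa using h x hx z hz
    rw [Finset.card_map] at h2
    omega
  · have h1 := ex_quads A (by simp [Finset.mem_powersetCard, hA])
    have h2 : (B.map (Fin.castLEEmb hn)).card ≤ 3 := by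
      refine (Finset.card_le_card ?_).trans h1
      intro y hy
      obtain ⟨z, hz, rfl⟩ := Finset.mem_map.1 hy
      simp only [Finset.mem_filter, Finset.mem_univ, true_and]
      intro x hx
      simpa [bipCompl] using h x hx z hz
    rw [Finset.card_map] at h2
    omega

theorem upper_part (G : Finset (Fin 5 × Fin 26)) :
    ContainsK 5 26 2 2 G ∨ ContainsK 5 26 4 4 (bipCompl 5 26 G) := by
  by_contra hcon
  obtain ⟨h22, h44⟩ := not_or.1 hcon
  have key : ∀ y : Fin 26, ∃ p : Fin 5 × Fin 5,
      (p.1 < p.2 ∧ (p.1, y) ∈ G ∧ (p.2, y) ∈ G) ∨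
      (p.1 = p.2 ∧ ∀ x, x ≠ p.1 → (x, y) ∉ G) := by
    intro y
    by_cases h : ∃ a b : Fin 5, a < b ∧ (a, y) ∈ G ∧ (b, y) ∈ G
    · obtain ⟨a, b, h⟩ := h
      exact ⟨(a, b), Or.inl h⟩
    · by_cases h0 : ∃ a : Fin 5, (a, y) ∈ G
      · obtain ⟨a, ha⟩ := h0
        refine ⟨(a, a), Or.inr ⟨rfl, fun x hx hxy => h ?_⟩⟩
        rcases lt_or_gt_of_ne hx with hlt | hlt
        · exact ⟨x, a, hlt, hxy, ha⟩
        · exact ⟨a, x, hlt, ha, hxy⟩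
      · exact ⟨(0, 0), Or.inr ⟨rfl, fun x _ hxy => h0 ⟨x, hxy⟩⟩⟩
  choose f hf using key
  have hfib : ∀ p : Fin 5 × Fin 5, ((Finset.univ : Finset (Fin 26)).filter (fun y => f y = p)).card
      ≤ if p.1 < p.2 then 1 else if p.1 = p.2 then 3 else 0 := by
    rintro ⟨a, b⟩
    by_contra hlt
    rw [not_le] at hlt
    dsimp only at hlt
    split_ifs at hlt with h1 h2
    · obtain ⟨B, hBs, hB⟩ := Finset.exists_subset_card_eq (Nat.succ_le_of_lt hlt)
      refine h22 ⟨{a, b}, B, Finset.card_pair h1.ne, hB, ?_⟩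
      intro x hx y hy
      have hy' := (Finset.mem_filter.1 (hBs hy)).2
      have := hf y
      rw [hy'] at this
      rcases this with ⟨_, ha, hb⟩ | ⟨h, _⟩
      · rcases Finset.mem_insert.1 hx with rfl | hx
        · exact ha
        · rw [Finset.mem_singleton.1 hx]; exact hb
      · exact absurd h h1.ne
    · obtain ⟨B, hBs, hB⟩ := Finset.exists_subset_card_eq (Nat.succ_le_of_lt hlt)
      refine h44 ⟨Finset.univ.erase a, B, by simp, hB, ?_⟩
      intro x hx y hy
      have hy' := (Finset.mem_filter.1 (hBs hy)).2
      have := hf y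
      rw [hy'] at this
      rcases this with ⟨h, _⟩ | ⟨_, h⟩
      · exact absurd h h1
      · simpa [bipCompl] using h x (Finset.ne_of_mem_erase hx)
    · obtain ⟨y, hy⟩ := Finset.card_pos.1 hlt
      have hy' := (Finset.mem_filter.1 hy).2
      have := hf y
      rw [hy'] at this
      rcases this with ⟨h, _⟩ | ⟨h, _⟩
      · exact h1 h
      · exact h2 h
  have hsum := Finset.card_eq_sum_card_fiberwise (s := (Finset.univ : Finset (Fin 26)))
    (t := (Finset.univ : Finset (Fin 5 × Fin 5))) (f := f) (fun _ _ => by simp)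
  have hle := Finset.sum_le_sum (s := (Finset.univ : Finset (Fin 5 × Fin 5))) (fun p _ => hfib p)
  have h25 : (∑ p : Fin 5 × Fin 5, if p.1 < p.2 then 1 else if p.1 = p.2 then 3 else 0) = 25 := by
    decide +kernel
  rw [h25, ← hsum, Finset.card_univ, Fintype.card_fin] at hle
  omega

/-- BR_5(K_{2,2}, K_{4,4}) = 26. -/
theorem br_5_eq_26 :
    IsLeast {n : ℕ | 0 < n ∧ ∀ G : Finset (Fin 5 × Fin n),
      ContainsK 5 n 2 2 G ∨ ContainsK 5 n 4 4 (bipCompl 5 n G)} 26 := by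
  refine ⟨⟨by norm_num, upper_part⟩, ?_⟩
  rintro n ⟨_, hn⟩
  by_contra hlt
  obtain ⟨G, hG⟩ := lower_part n (by omega)
  exact hG (hn G)
end

section
/- 22 is the least positive integer n such that every subgraph G of the complete bipartite graph K_{7,n} contains K_{2,2} or the bipartite complement of G contains K_{4,4}; that is, BR_7(K_{2,2}, K_{4,4}) = 22. -/
/-- Every column `c` (a subset of the `X`-side) has weight at least 15, where each disjoint
4-set counts 1 and each contained pair counts 10. -/
theorem weight_ge (c : Finset (Fin 7)) :
    15 ≤ ((Finset.univ.powersetCard 4).filter (fun A => Disjoint A c)).card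
      + 10 * ((Finset.univ.powersetCard 2).filter (fun A => A ⊆ c)).card := by
  have h1 : (Finset.univ.powersetCard 4).filter (fun A => Disjoint A c)
      = cᶜ.powersetCard 4 := by
    ext A
    simp only [Finset.mem_filter, Finset.mem_powersetCard, Finset.subset_univ, true_and]
    rw [Finset.subset_compl_iff_disjoint_right]
    tauto
  have h2 : (Finset.univ.powersetCard 2).filter (fun A => A ⊆ c) = c.powersetCard 2 := by
    ext A
    simp only [Finset.mem_filter, Finset.mem_powersetCard, Finset.subset_univ, true_and]
    tauto
  rw [h1, h2, Finset.card_powersetCard, Finset.card_powersetCard, Finset.card_compl,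
    Fintype.card_fin]
  have h3 : c.card ≤ 7 := by simpa using Finset.card_le_univ c
  interval_cases c.card <;> decide

/-- Upper bound: for `n = 22` one of the two subgraphs is always present. -/
theorem upper_22 (G : Finset (Fin 7 × Fin 22)) :
    ContainsK 7 22 2 2 G ∨ ContainsK 7 22 4 4 (bipCompl 7 22 G) := by
  by_contra hcon
  rw [not_or] at hcon
  obtain ⟨h22, h44⟩ := hcon
  let col : Fin 22 → Finset (Fin 7) := fun y => Finset.univ.filter (fun x => (x, y) ∈ G)
  have hp : ∀ A ∈ (Finset.univ : Finset (Fin 7)).powersetCard 2,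
      (Finset.univ.filter (fun y => A ⊆ col y)).card ≤ 1 := by
    intro A hA
    by_contra hlt
    obtain ⟨B, hB, hc⟩ := Finset.exists_subset_card_eq
      (show 2 ≤ (Finset.univ.filter (fun y => A ⊆ col y)).card by omega)
    refine h22 ⟨A, B, (Finset.mem_powersetCard.1 hA).2, hc, fun x hx y hy => ?_⟩
    have := (Finset.mem_filter.1 (hB hy)).2 hx
    simpa [col] using this
  have hq : ∀ A ∈ (Finset.univ : Finset (Fin 7)).powersetCard 4,
      (Finset.univ.filter (fun y => Disjoint A (col y))).card ≤ 3 := by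
    intro A hA
    by_contra hlt
    obtain ⟨B, hB, hc⟩ := Finset.exists_subset_card_eq
      (show 4 ≤ (Finset.univ.filter (fun y => Disjoint A (col y))).card by omega)
    refine h44 ⟨A, B, (Finset.mem_powersetCard.1 hA).2, hc, fun x hx y hy => ?_⟩
    have := Finset.disjoint_left.1 (Finset.mem_filter.1 (hB hy)).2 hx
    simpa [col, bipCompl] using this
  have hp' := Finset.sum_le_card_nsmul _ _ _ hp
  have hq' := Finset.sum_le_card_nsmul _ _ _ hq
  have hw := Finset.sum_le_sum (s := (Finset.univ : Finset (Fin 22)))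
    (fun y _ => weight_ge (col y))
  have e1 := Finset.sum_card_bipartiteAbove_eq_sum_card_bipartiteBelow
    (s := (Finset.univ : Finset (Fin 7)).powersetCard 2) (t := (Finset.univ : Finset (Fin 22)))
    (fun A y => A ⊆ col y)
  have e2 := Finset.sum_card_bipartiteAbove_eq_sum_card_bipartiteBelow
    (s := (Finset.univ : Finset (Fin 7)).powersetCard 4) (t := (Finset.univ : Finset (Fin 22)))
    (fun A y => Disjoint A (col y))
  simp only [Finset.bipartiteAbove, Finset.bipartiteBelow] at e1 e2
  rw [Finset.sum_add_distrib, ← Finset.mul_sum, ← e1, ← e2] at hw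
  have c2 : Nat.choose 7 2 = 21 := by decide
  have c4 : Nat.choose 7 4 = 35 := by decide
  simp only [Finset.card_powersetCard, Finset.card_univ, Fintype.card_fin, c2, c4, smul_eq_mul,
    Finset.sum_const] at hp' hq' hw
  omega

/-- Lower bound: distinct pairs as columns avoid both subgraphs for `n ≤ 21`. -/
theorem lower_21 (n : ℕ) (hn : n ≤ 21) : ∃ G : Finset (Fin 7 × Fin n),
    ¬ ContainsK 7 n 2 2 G ∧ ¬ ContainsK 7 n 4 4 (bipCompl 7 n G) := by
  have c2 : Nat.choose 7 2 = 21 := by decide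
  obtain ⟨f⟩ : Nonempty (Fin n ↪ ((Finset.univ : Finset (Fin 7)).powersetCard 2)) := by
    apply Function.Embedding.nonempty_of_card_le
    simpa [c2] using hn
  have hf : ∀ y, (f y : Finset (Fin 7)).card = 2 := fun y =>
    (Finset.mem_powersetCard.1 (f y).2).2
  refine ⟨Finset.univ.filter (fun p => p.1 ∈ (f p.2 : Finset (Fin 7))), ?_, ?_⟩
  · rintro ⟨A, B, hA, hB, h⟩
    obtain ⟨y, hy, z, hz, hne⟩ := Finset.one_lt_card.1 (show 1 < B.card by omega)
    have key : ∀ y ∈ B, A = f y := fun y hy =>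
      Finset.eq_of_subset_of_card_le (fun x hx => by simpa using h x hx y hy)
        (by rw [hf, hA])
    exact hne (f.injective (Subtype.ext ((key y hy).symm.trans (key z hz))))
  · rintro ⟨A, B, hA, hB, h⟩
    have hle : B.card ≤ (Aᶜ.powersetCard 2).card := by
      apply Finset.card_le_card_of_injOn (fun y => (f y : Finset (Fin 7)))
      · intro y hy
        refine Finset.mem_coe.2 (Finset.mem_powersetCard.2 ⟨fun x hx => ?_, hf y⟩)
        rw [Finset.mem_compl]
        intro hxA
        have := h x hxA y hy
        simp [bipCompl] at this
        exact this hx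
      · intro y _ z _ hyz
        exact f.injective (Subtype.ext hyz)
    rw [Finset.card_powersetCard, Finset.card_compl, Fintype.card_fin, hA, hB] at hle
    exact absurd hle (by decide)

/-- BR_7(K_{2,2}, K_{4,4}) = 22. -/
theorem br_7_eq_22 :
    IsLeast {n : ℕ | 0 < n ∧ ∀ G : Finset (Fin 7 × Fin n),
      ContainsK 7 n 2 2 G ∨ ContainsK 7 n 4 4 (bipCompl 7 n G)} 22 := by
  refine ⟨⟨by norm_num, upper_22⟩, ?_⟩
  rintro n ⟨_, h⟩
  by_contra hlt
  obtain ⟨G, h1, h2⟩ := lower_21 n (by omega)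
  exact (h G).elim h1 h2
end

section
/- 16 is the least positive integer n such that every subgraph G of the complete bipartite graph K_{8,n} contains K_{2,2} or the bipartite complement of G contains K_{4,4}; that is, BR_8(K_{2,2}, K_{4,4}) = 16. -/
namespace BR8

open Finset

/-- A 15-column example, as a bit mask: vertex `x` is joined to column `j` iff bit `15 * x + j`
is set. The column neighbourhoods are 467, 37, 57, 56, 06, 15, 012, 045, 26, 136, 34, 24, 235,
14, 03. -/
def row (x : ℕ) : ℕ := 284935582155893892992854114975952 >>> (15 * x)

/-- Adjacency in the example. -/
def ex15 (x : Fin 8) (j : Fin 15) : Bool := (row x).testBit j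

/-- Number of set bits among the lowest `n`. -/
def cnt (m : ℕ) : ℕ → ℕ
  | 0 => 0
  | n + 1 => (m.testBit n).toNat + cnt m n

lemma card_eq_cnt (m n : ℕ) :
    (univ.filter (fun j : Fin n => m.testBit j = true)).card = cnt m n := by
  rw [card_filter, Fin.sum_univ_eq_sum_range (fun j => if m.testBit j = true then 1 else 0)]
  induction n with
  | zero => rfl
  | succ k ih =>
    rw [sum_range_succ, ih, cnt, add_comm]
    cases m.testBit k <;> rfl

/-- Bounded check. -/
def allLt (p : ℕ → Bool) : ℕ → Bool
  | 0 => true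
  | n + 1 => p n && allLt p n

lemma allLt_spec {p : ℕ → Bool} {n : ℕ} (h : allLt p n = true) (x : Fin n) : p x = true := by
  induction n with
  | zero => exact x.elim0
  | succ k ih =>
    rw [allLt, Bool.and_eq_true] at h
    rcases Nat.lt_succ_iff_lt_or_eq.1 x.2 with hx | hx
    · exact ih h.2 ⟨x, hx⟩
    · rw [hx]
      exact h.1

lemma check_pairs : allLt (fun x => allLt (fun y =>
    x == y || Nat.ble (cnt (row x &&& row y) 15) 1) 8) 8 = true := by
  decide +kernel

lemma check_quads : allLt (fun x => allLt (fun y => x == y || allLt (fun z =>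
    (x == z || y == z) || allLt (fun w => (x == w || y == w || z == w) ||
      Nat.ble 12 (cnt (row x ||| row y ||| row z ||| row w) 15)) 8) 8) 8) 8 = true := by
  decide +kernel

lemma ex15_pairs (x y : Fin 8) (hxy : x ≠ y) :
    (univ.filter (fun j => (ex15 x j && ex15 y j) = true)).card ≤ 1 := by
  have h := allLt_spec (allLt_spec check_pairs x) y
  simp only [Bool.or_eq_true, beq_iff_eq, Fin.val_inj, hxy, false_or, Nat.ble_eq] at h
  rw [← card_eq_cnt] at h
  refine le_trans (card_le_card ?_) h
  intro j
  simp [Nat.testBit_and, ex15]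

lemma ex15_quads (A : Finset (Fin 8)) (hA : A.card = 4) :
    (univ.filter (fun j => ∀ x ∈ A, ex15 x j = false)).card ≤ 3 := by
  obtain ⟨x, A', hx, rfl, hA'⟩ := card_eq_succ.1 hA
  obtain ⟨y, z, w, hyz, hyw, hzw, rfl⟩ := card_eq_three.1 hA'
  simp only [mem_insert, mem_singleton, not_or] at hx
  obtain ⟨hxy, hxz, hxw⟩ := hx
  have h := allLt_spec check_quads x
  have h := allLt_spec h y
  simp only [Bool.or_eq_true, beq_iff_eq, Fin.val_inj, hxy, false_or] at h
  have h := allLt_spec h z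
  simp only [Bool.or_eq_true, beq_iff_eq, Fin.val_inj, hxz, hyz, false_or] at h
  have h := allLt_spec h w
  simp only [Bool.or_eq_true, beq_iff_eq, Fin.val_inj, hxw, hyw, hzw, false_or,
    Nat.ble_eq] at h
  rw [← card_eq_cnt] at h
  have h3 := card_filter_add_card_filter_not (s := (univ : Finset (Fin 15)))
    (fun j => (row x ||| row y ||| row z ||| row w).testBit j = true)
  rw [card_univ, Fintype.card_fin] at h3
  have h4 : univ.filter (fun j => ∀ t ∈ insert x ({y, z, w} : Finset (Fin 8)), ex15 t j = false) =
      univ.filter (fun j : Fin 15 =>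
        ¬ (row x ||| row y ||| row z ||| row w).testBit j = true) := by
    ext j
    simp [Nat.testBit_or, ex15, and_assoc]
  rw [h4]
  omega

lemma lower {n : ℕ} (hn : n ≤ 15) : ∃ G : Finset (Fin 8 × Fin n),
    ¬ ContainsK 8 n 2 2 G ∧ ¬ ContainsK 8 n 4 4 (bipCompl 8 n G) := by
  refine ⟨univ.filter (fun p => ex15 p.1 (Fin.castLE hn p.2) = true), ?_, ?_⟩
  · rintro ⟨A, B, hA, hB, h⟩
    obtain ⟨x, y, hxy, rfl⟩ := card_eq_two.1 hA
    have h1 := ex15_pairs x y hxy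
    have h2 : B.map (Fin.castLEEmb hn) ⊆
        univ.filter (fun j => (ex15 x j && ex15 y j) = true) := by
      intro j hj
      obtain ⟨b, hb, rfl⟩ := mem_map.1 hj
      have hx := h x (by simp) b hb
      have hy := h y (by simp) b hb
      simp at hx hy ⊢
      exact ⟨hx, hy⟩
    have h3 := card_le_card h2
    rw [card_map] at h3
    omega
  · rintro ⟨A, B, hA, hB, h⟩
    have h1 := ex15_quads A hA
    have h2 : B.map (Fin.castLEEmb hn) ⊆
        univ.filter (fun j => ∀ x ∈ A, ex15 x j = false) := by
      intro j hj
      obtain ⟨b, hb, rfl⟩ := mem_map.1 hj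
      simp only [mem_filter, mem_univ, true_and]
      intro x hx
      have := h x hx b hb
      simpa [bipCompl] using this
    have h3 := card_le_card h2
    rw [card_map] at h3
    omega

section upper

variable {c : Fin 16 → Finset (Fin 8)}

/-- Number of two-element columns inside `W`. -/
def e (c : Fin 16 → Finset (Fin 8)) (W : Finset (Fin 8)) : ℕ :=
  (univ.filter (fun j => (c j).card = 2 ∧ c j ⊆ W)).card

/-- Number of columns of size `k`. -/
def num (c : Fin 16 → Finset (Fin 8)) (k : ℕ) : ℕ :=
  (univ.filter (fun j => (c j).card = k)).card

/-- Number of two-element columns inside `W` through `x`. -/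
def dg (c : Fin 16 → Finset (Fin 8)) (W : Finset (Fin 8)) (x : Fin 8) : ℕ :=
  (univ.filter (fun j => ((c j).card = 2 ∧ c j ⊆ W) ∧ x ∈ c j)).card

lemma e_erase (W : Finset (Fin 8)) (x : Fin 8) :
    e c W = dg c W x + e c (W.erase x) := by
  unfold e dg
  rw [← card_filter_add_card_filter_not (s := univ.filter _) (fun j => x ∈ c j),
    filter_filter, filter_filter]
  congr 2
  ext j
  simp only [mem_filter, mem_univ, true_and, subset_erase]
  tauto

lemma sum_dg (W : Finset (Fin 8)) : ∑ x ∈ W, dg c W x = 2 * e c W := by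
  unfold dg e
  simp_rw [← filter_filter (fun j => (c j).card = 2 ∧ c j ⊆ W)]
  simp_rw [card_filter (fun j => _ ∈ c j)]
  rw [sum_comm, card_eq_sum_ones, mul_sum]
  apply sum_congr rfl
  intro j hj
  simp only [mem_filter, mem_univ, true_and] at hj
  rw [← card_filter, filter_mem_eq_inter, inter_eq_right.2 hj.2, hj.1, mul_one]

lemma quad (h2 : ∀ S : Finset (Fin 8), S.card = 4 →
    (univ.filter (fun j => c j ⊆ S)).card ≤ 3)
    (J : Finset (Fin 16)) (hJ : 4 ≤ J.card) (U : Finset (Fin 8)) (hU : U.card ≤ 4)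
    (h : ∀ j ∈ J, c j ⊆ U) : False := by
  obtain ⟨S, hS, -, hS4⟩ := exists_subsuperset_card_eq (subset_univ U) hU
    (show 4 ≤ (univ : Finset (Fin 8)).card by simp)
  have h3 := h2 S hS4
  have h4 : J ⊆ univ.filter (fun j => c j ⊆ S) := by
    intro j hj
    simpa using (h j hj).trans hS
  have := card_le_card h4
  omega

lemma t_step (W : Finset (Fin 8)) (b : ℕ) (h : ∀ x ∈ W, e c (W.erase x) ≤ b) :
    W.card * e c W ≤ W.card * b + 2 * e c W := by
  have h1 : ∑ x ∈ W, e c W = ∑ x ∈ W, (dg c W x + e c (W.erase x)) :=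
    sum_congr rfl (fun x _ => e_erase W x)
  rw [sum_add_distrib, sum_dg, sum_const, smul_eq_mul] at h1
  have h3 := sum_le_card_nsmul W _ b h
  rw [smul_eq_mul] at h3
  omega

lemma t4 (h2 : ∀ S : Finset (Fin 8), S.card = 4 →
    (univ.filter (fun j => c j ⊆ S)).card ≤ 3)
    (W : Finset (Fin 8)) (hW : W.card = 4) : e c W ≤ 3 := by
  refine le_trans (card_le_card ?_) (h2 W hW)
  intro j
  simp

lemma t5 (h2 : ∀ S : Finset (Fin 8), S.card = 4 →
    (univ.filter (fun j => c j ⊆ S)).card ≤ 3)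
    (W : Finset (Fin 8)) (hW : W.card = 5) : e c W ≤ 5 := by
  have := t_step (c := c) W 3 (fun x hx => t4 h2 _ (by rw [card_erase_of_mem hx, hW]))
  rw [hW] at this
  omega

lemma t6 (h2 : ∀ S : Finset (Fin 8), S.card = 4 →
    (univ.filter (fun j => c j ⊆ S)).card ≤ 3)
    (W : Finset (Fin 8)) (hW : W.card = 6) : e c W ≤ 6 := by
  have h5 : ∀ x ∈ W, e c (W.erase x) ≤ 5 :=
    fun x hx => t5 h2 _ (by rw [card_erase_of_mem hx, hW])
  have h7 := t_step (c := c) W 5 h5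
  rw [hW] at h7
  by_contra hcon
  have he : e c W = 7 := by omega
  have hd : ∀ x ∈ W, 2 ≤ dg c W x := by
    intro x hx
    have := e_erase (c := c) W x
    have := h5 x hx
    omega
  set D := W.filter (fun x => dg c W x = 2) with hD
  have hs := sum_dg (c := c) W
  have hlow : ∑ x ∈ W, (3 - if dg c W x = 2 then 1 else 0) ≤ ∑ x ∈ W, dg c W x := by
    apply sum_le_sum
    intro x hx
    have := hd x hx
    split_ifs <;> omega
  have hlow2 : ∑ x ∈ W, (3 - if dg c W x = 2 then 1 else 0) + D.card = 18 := by
    rw [hD, card_filter, ← sum_add_distrib]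
    rw [sum_congr rfl (g := fun _ => 3), sum_const, hW, smul_eq_mul]
    intro x _
    split_ifs <;> rfl
  have hD4 : 4 ≤ D.card := by omega
  have hsum : ∑ x ∈ D, dg c W x = 2 * D.card := by
    rw [sum_congr rfl (g := fun _ => 2), sum_const, smul_eq_mul, mul_comm]
    intro x hx
    exact (mem_filter.1 hx).2
  have hle : ∑ x ∈ D, dg c W x ≤ e c W := by
    unfold dg e
    simp_rw [← filter_filter (fun j => (c j).card = 2 ∧ c j ⊆ W)]
    simp_rw [card_filter (fun j => _ ∈ c j)]
    rw [sum_comm, card_eq_sum_ones]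
    apply sum_le_sum
    intro j hj
    rw [← card_filter]
    rw [card_le_one]
    intro x hx y hy
    by_contra hxy
    simp only [hD, mem_filter, mem_univ, true_and] at hx hy hj
    have e1 := e_erase (c := c) W x
    have e2 := e_erase (c := c) (W.erase x) y
    have e3 : e c ((W.erase x).erase y) ≤ 3 := t4 h2 _ (by
      rw [card_erase_of_mem (mem_erase.2 ⟨Ne.symm hxy, hy.1.1⟩), card_erase_of_mem hx.1.1, hW])
    have e4 : dg c (W.erase x) y < dg c W y := by
      apply card_lt_card
      rw [ssubset_iff_of_subset]
      · refine ⟨j, by simp [hj, hy.2], ?_⟩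
        simp [subset_erase, hx.2]
      · intro i
        simp only [mem_filter, mem_univ, true_and, subset_erase]
        tauto
    omega
  omega

lemma t7 (h2 : ∀ S : Finset (Fin 8), S.card = 4 →
    (univ.filter (fun j => c j ⊆ S)).card ≤ 3)
    (W : Finset (Fin 8)) (hW : W.card = 7) : e c W ≤ 8 := by
  have := t_step (c := c) W 6 (fun x hx => t6 h2 _ (by rw [card_erase_of_mem hx, hW]))
  rw [hW] at this
  omega

lemma e_univ : e c univ = num c 2 := by
  simp [e, num]

lemma pair_sum : ∑ j, (c j).card.choose 2 =
    ∑ P ∈ powersetCard 2 (univ : Finset (Fin 8)), (univ.filter (fun j => P ⊆ c j)).card := by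
  simp_rw [card_filter]
  rw [sum_comm]
  apply sum_congr rfl
  intro j _
  rw [← card_filter, ← card_powersetCard]
  congr 1
  ext P
  simp [mem_powersetCard]
  tauto

lemma quad_card (B : Finset (Fin 8)) :
    ((powersetCard 4 (univ : Finset (Fin 8))).filter (fun S => B ⊆ S)).card
      = (8 - B.card).choose 4 := by
  have h : (powersetCard 4 Bᶜ).card = (8 - B.card).choose 4 := by
    rw [card_powersetCard, card_compl, Fintype.card_fin]
  rw [← h]
  apply card_nbij' (fun S => Sᶜ) (fun S => Sᶜ)
  · intro S hS
    simp only [mem_coe, mem_filter, mem_powersetCard, subset_univ, true_and] at hS ⊢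
    exact ⟨compl_subset_compl.2 hS.2, by rw [card_compl, hS.1]; rfl⟩
  · intro S hS
    simp only [mem_coe, mem_filter, mem_powersetCard, subset_univ, true_and] at hS ⊢
    exact ⟨by rw [card_compl, hS.2]; rfl, subset_compl_comm.1 hS.1⟩
  · intro S _
    simp
  · intro S _
    simp

lemma quad_sum : ∑ j, (8 - (c j).card).choose 4 =
    ∑ S ∈ powersetCard 4 (univ : Finset (Fin 8)), (univ.filter (fun j => c j ⊆ S)).card := by
  simp_rw [card_filter]
  rw [sum_comm]
  apply sum_congr rfl
  intro j _
  rw [← card_filter, quad_card]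

lemma sum_by_num (f : ℕ → ℕ) : ∑ j, f (c j).card = ∑ k ∈ range 9, num c k * f k := by
  have h : ∀ j ∈ (univ : Finset (Fin 16)), (c j).card ∈ range 9 := by
    intro j _
    have := card_le_univ (c j)
    simp at this
    simp
    omega
  rw [← sum_fiberwise_of_maps_to h]
  apply sum_congr rfl
  intro k _
  rw [sum_congr rfl (g := fun _ => f k), sum_const, smul_eq_mul]
  · rfl
  · intro j hj
    rw [(mem_filter.1 hj).2]

/-- If all pairs are covered exactly once and all columns have size 1, 2 or 3,
each row vertex is on an odd number of two-element columns. -/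
lemma odd_dg (hex : ∀ P ∈ powersetCard 2 (univ : Finset (Fin 8)),
      (univ.filter (fun j => P ⊆ c j)).card = 1)
    (hsz : ∀ j, (c j).card = 1 ∨ (c j).card = 2 ∨ (c j).card = 3) (x : Fin 8) :
    dg c univ x % 2 = 1 := by
  have h1 : ∑ y ∈ univ.erase x, (univ.filter (fun j => {x, y} ⊆ c j)).card = 7 := by
    rw [sum_congr rfl (g := fun _ => 1)]
    · simp
    · intro y hy
      apply hex
      simp only [mem_powersetCard, subset_univ, true_and]
      exact card_pair (Ne.symm (mem_erase.1 hy).1)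
  simp_rw [card_filter] at h1
  rw [sum_comm] at h1
  have h3 : dg c univ x = ∑ j, if ((c j).card = 2 ∧ x ∈ c j) then 1 else 0 := by
    simp [dg]
  have h4 : ∀ j, (∑ y ∈ univ.erase x, if {x, y} ⊆ c j then 1 else 0) =
      (if ((c j).card = 2 ∧ x ∈ c j) then 1 else 0) +
      2 * (if ((c j).card = 3 ∧ x ∈ c j) then 1 else 0) := by
    intro j
    rw [← card_filter]
    by_cases hx : x ∈ c j
    · have : (univ.erase x).filter (fun y => {x, y} ⊆ c j) = (c j).erase x := by
        ext y
        simp [insert_subset_iff, hx]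
      rw [this, card_erase_of_mem hx]
      rcases hsz j with h | h | h <;> simp [h, hx]
    · simp [insert_subset_iff, hx]
  rw [sum_congr rfl (fun j _ => h4 j), sum_add_distrib, ← h3, ← mul_sum] at h1
  omega

lemma case0 (h2 : ∀ S : Finset (Fin 8), S.card = 4 →
      (univ.filter (fun j => c j ⊆ S)).card ≤ 3)
    (hex : ∀ P ∈ powersetCard 2 (univ : Finset (Fin 8)),
      (univ.filter (fun j => P ⊆ c j)).card = 1)
    (hsz : ∀ j, (c j).card = 1 ∨ (c j).card = 2 ∨ (c j).card = 3)
    (hn : num c 2 = 10) : False := by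
  have hd : ∀ x ∈ (univ : Finset (Fin 8)), 3 ≤ dg c univ x := by
    intro x _
    have a1 := e_erase (c := c) univ x
    have a2 := t7 h2 (univ.erase x) (by simp)
    have a3 := odd_dg hex hsz x
    rw [e_univ] at a1
    omega
  have h3 := card_nsmul_le_sum univ _ 3 hd
  rw [sum_dg, e_univ, hn] at h3
  simp at h3

lemma case1 (h2 : ∀ S : Finset (Fin 8), S.card = 4 →
      (univ.filter (fun j => c j ⊆ S)).card ≤ 3)
    (h1 : num c 1 = 1) (hn : 9 ≤ num c 2) : False := by
  obtain ⟨s, hs⟩ := card_pos.1 (show 0 < num c 1 by omega)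
  simp only [mem_filter, mem_univ, true_and] at hs
  obtain ⟨v, hv⟩ := card_eq_one.1 hs
  have a1 := e_erase (c := c) univ v
  have a2 := t7 h2 (univ.erase v) (by simp)
  rw [e_univ] at a1
  obtain ⟨i, hi⟩ := card_pos.1 (show 0 < dg c univ v by omega)
  simp only [mem_filter, mem_univ, true_and, subset_univ, and_true] at hi
  have hW : (univ \ c i).card = 6 := by
    rw [card_sdiff_of_subset (subset_univ _), hi.1]
    rfl
  have a3 := t6 h2 _ hW
  set E := univ.filter (fun j => (c j).card = 2) with hE
  have a4 := card_filter_add_card_filter_not (s := E) (fun j => c j ⊆ univ \ c i)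
  have a5 : (E.filter (fun j => c j ⊆ univ \ c i)).card = e c (univ \ c i) := by
    rw [hE, filter_filter]
    rfl
  have a6 : E.card = num c 2 := rfl
  set T := E.filter (fun j => ¬ c j ⊆ univ \ c i) with hT
  have hiT : i ∈ T := by
    simp only [hT, hE, mem_filter, mem_univ, true_and]
    refine ⟨hi.1, fun h => ?_⟩
    have := h hi.2
    simp [hi.2] at this
  obtain ⟨T', hiT', hT', hc⟩ := exists_subsuperset_card_eq
    (singleton_subset_iff.2 hiT) (show _ ≤ 3 by simp) (by omega)
  have hiT'' : i ∈ T' := singleton_subset_iff.1 hiT'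
  have hU : (c i ∪ (T'.erase i).biUnion (fun j => c j \ c i)).card ≤ 4 := by
    have b1 := card_union_le (c i) ((T'.erase i).biUnion (fun j => c j \ c i))
    have b2 := card_biUnion_le_card_mul (T'.erase i) (fun j => c j \ c i) 1 (by
      intro j hj
      have hjT := hT' (mem_of_mem_erase hj)
      simp only [hT, hE, mem_filter, mem_univ, true_and] at hjT
      obtain ⟨hj2, hjn⟩ := hjT
      have : (c j ∩ c i).Nonempty := by
        by_contra hne
        rw [not_nonempty_iff_eq_empty] at hne
        apply hjn
        intro y hy
        simp only [mem_sdiff, mem_univ, true_and]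
        intro hyi
        have : y ∈ c j ∩ c i := mem_inter.2 ⟨hy, hyi⟩
        simp [hne] at this
      have b3 := card_pos.2 this
      have b4 := card_sdiff_add_card_inter (c j) (c i)
      omega)
    rw [card_erase_of_mem hiT'', hc] at b2
    omega
  refine quad h2 (insert s T') ?_ _ hU ?_
  · rw [card_insert_of_notMem, hc]
    intro hsT
    have := hT' hsT
    simp only [hT, hE, mem_filter, mem_univ, true_and] at this
    omega
  · intro j hj
    rw [mem_insert] at hj
    rcases hj with rfl | hj
    · rw [hv, singleton_subset_iff]
      exact mem_union_left _ hi.2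
    · intro y hy
      by_cases hyi : y ∈ c i
      · exact mem_union_left _ hyi
      · apply mem_union_right
        rw [mem_biUnion]
        refine ⟨j, mem_erase.2 ⟨?_, hj⟩, mem_sdiff.2 ⟨hy, hyi⟩⟩
        rintro rfl
        exact hyi hy

lemma case2 (h2 : ∀ S : Finset (Fin 8), S.card = 4 →
      (univ.filter (fun j => c j ⊆ S)).card ≤ 3)
    (hex : ∀ P ∈ powersetCard 2 (univ : Finset (Fin 8)),
      (univ.filter (fun j => P ⊆ c j)).card = 1)
    (hsz : ∀ j, (c j).card = 1 ∨ (c j).card = 2 ∨ (c j).card = 3)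
    (h1 : num c 1 = 2) (hn : num c 2 = 7) : False := by
  obtain ⟨s, t, hst, hS⟩ := card_eq_two.1 h1
  have hs : s ∈ univ.filter (fun j => (c j).card = 1) := by rw [hS]; simp
  have ht : t ∈ univ.filter (fun j => (c j).card = 1) := by rw [hS]; simp
  simp only [mem_filter, mem_univ, true_and] at hs ht
  obtain ⟨u, hu⟩ := card_eq_one.1 hs
  obtain ⟨v, hv⟩ := card_eq_one.1 ht
  have a1 := odd_dg hex hsz u
  obtain ⟨i, hi⟩ := card_pos.1 (show 0 < dg c univ u by omega)
  simp only [mem_filter, mem_univ, true_and, subset_univ, and_true] at hi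
  -- a block through both singletons
  have hB : ∃ b, 2 ≤ (c b).card ∧ u ∈ c b ∧ v ∈ c b := by
    by_cases huv : u = v
    · exact ⟨i, by omega, hi.2, huv ▸ hi.2⟩
    · have := hex {u, v} (by simp [mem_powersetCard, card_pair huv])
      obtain ⟨b, hb⟩ := card_pos.1 (show 0 < _ by rw [this]; exact one_pos)
      simp only [mem_filter, mem_univ, true_and] at hb
      refine ⟨b, ?_, ?_, ?_⟩
      · have := card_le_card hb
        rwa [card_pair huv] at this
      · exact hb (by simp)
      · exact hb (by simp)
  obtain ⟨b, hb2, hbu, hbv⟩ := hB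
  have hf : ∃ f, f ≠ b ∧ (c f).card = 2 ∧ (c b ∪ c f).card ≤ 4 := by
    by_cases hib : i = b
    · subst hib
      obtain ⟨f, hf, hfi⟩ := exists_mem_ne (show 1 < num c 2 by omega) i
      simp only [mem_filter, mem_univ, true_and] at hf
      refine ⟨f, hfi, hf, ?_⟩
      have := card_union_le (c i) (c f)
      omega
    · refine ⟨i, hib, hi.1, ?_⟩
      have b1 := card_union_add_card_inter (c b) (c i)
      have b2 : 0 < (c b ∩ c i).card := card_pos.2 ⟨u, mem_inter.2 ⟨hbu, hi.2⟩⟩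
      have := hsz b
      omega
  obtain ⟨f, hfb, hf2, hU⟩ := hf
  refine quad h2 {s, t, b, f} ?_ _ hU ?_
  · have k1 : s ≠ b := by rintro rfl; omega
    have k2 : t ≠ b := by rintro rfl; omega
    have k3 : s ≠ f := by rintro rfl; omega
    have k4 : t ≠ f := by rintro rfl; omega
    have k5 := hfb.symm
    rw [card_insert_of_notMem, card_insert_of_notMem, card_pair k5]
    · simp [k2, k4]
    · simp [hst, k1, k3]
  · intro j hj
    simp only [mem_insert, mem_singleton] at hj
    rcases hj with rfl | rfl | rfl | rfl
    · rw [hu, singleton_subset_iff]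
      exact mem_union_left _ hbu
    · rw [hv, singleton_subset_iff]
      exact mem_union_left _ hbv
    · exact subset_union_left
    · exact subset_union_right

lemma upper (h1 : ∀ P : Finset (Fin 8), P.card = 2 →
      (univ.filter (fun j => P ⊆ c j)).card ≤ 1)
    (h2 : ∀ S : Finset (Fin 8), S.card = 4 →
      (univ.filter (fun j => c j ⊆ S)).card ≤ 3) : False := by
  have a0 := sum_by_num (c := c) (fun _ => 1)
  have a1 := sum_by_num (c := c) (fun k => k.choose 2)
  have a2 := sum_by_num (c := c) (fun k => (8 - k).choose 4)
  have hP1 : ∀ P ∈ powersetCard 2 (univ : Finset (Fin 8)),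
      (univ.filter (fun j => P ⊆ c j)).card ≤ 1 :=
    fun P hP => h1 P (mem_powersetCard.1 hP).2
  have b1 := sum_le_card_nsmul _ _ 1 hP1
  have b2 := sum_le_card_nsmul (powersetCard 4 (univ : Finset (Fin 8))) _ 3
    (fun S hS => h2 S (mem_powersetCard.1 hS).2)
  rw [← pair_sum, card_powersetCard] at b1
  rw [← quad_sum, card_powersetCard] at b2
  have hex : (∑ j, (c j).card.choose 2) = 28 →
      ∀ P ∈ powersetCard 2 (univ : Finset (Fin 8)),
      (univ.filter (fun j => P ⊆ c j)).card = 1 := by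
    intro h
    rw [pair_sum] at h
    refine (sum_eq_sum_iff_of_le hP1).1 ?_
    rw [h, sum_const, card_powersetCard]
    rfl
  have c2 : (8 : ℕ).choose 2 = 28 := rfl
  have c4 : (8 : ℕ).choose 4 = 70 := rfl
  simp only [card_univ, Fintype.card_fin, c2, c4, smul_eq_mul] at b1 b2
  simp only [sum_const, card_univ, Fintype.card_fin, smul_eq_mul, sum_range_succ,
    sum_range_zero] at a0
  rw [a1] at b1 hex
  rw [a2] at b2
  simp [sum_range_succ, Nat.choose] at b1 b2 hex
  have key : (num c 1 = 1 ∧ 9 ≤ num c 2) ∨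
      (num c 0 = 0 ∧ num c 4 = 0 ∧ num c 5 = 0 ∧ num c 6 = 0 ∧ num c 7 = 0 ∧ num c 8 = 0 ∧
        num c 3 * 3 + num c 2 = 28 ∧
        ((num c 2 = 10) ∨ (num c 1 = 2 ∧ num c 2 = 7))) ∨ 11 ≤ num c 2 := by
    clear a1 a2 hex hP1
    have m1 : num c 1 ≤ 2 := by omega
    have m0 : num c 0 = 0 := by omega
    have m8 : num c 8 = 0 := by omega
    have m7 : num c 7 = 0 := by omega
    have m6 : num c 6 = 0 := by omega
    have m4 : num c 4 ≤ 4 := by omega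
    have m5 : num c 5 ≤ 2 := by omega
    generalize num c 0 = n0 at *
    generalize num c 1 = n1 at *
    generalize num c 2 = n2 at *
    generalize num c 3 = n3 at *
    generalize num c 4 = n4 at *
    generalize num c 5 = n5 at *
    interval_cases n1 <;> interval_cases n4 <;> interval_cases n5 <;> omega
  rcases key with ⟨k1, k2⟩ | ⟨k0, k4, k5, k6, k7, k8, k28, k⟩ | k
  · exact case1 h2 k1 k2
  · have hsz : ∀ j, (c j).card = 1 ∨ (c j).card = 2 ∨ (c j).card = 3 := by
      intro j
      have hle : (c j).card ≤ 8 := by simpa using card_le_univ (c j)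
      have hne : ∀ k, num c k = 0 → (c j).card ≠ k := by
        intro k hk hj
        rw [num, card_eq_zero] at hk
        have : j ∈ univ.filter (fun j => (c j).card = k) := by simp [hj]
        simp [hk] at this
      have := hne 0 k0
      have := hne 4 k4
      have := hne 5 k5
      have := hne 6 k6
      have := hne 7 k7
      have := hne 8 k8
      omega
    have hex' := hex (by omega)
    have hex'' : ∀ P ∈ powersetCard 2 (univ : Finset (Fin 8)),
        (univ.filter (fun j => P ⊆ c j)).card = 1 := by
      intro P hP
      exact hex' P (mem_powersetCard.1 hP).2
    rcases k with k | ⟨k1, k2⟩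
    · exact case0 h2 hex'' hsz k
    · exact case2 h2 hex'' hsz k1 k2
  · have := t_step (c := c) univ 8 (fun x _ => t7 h2 _ (by simp))
    rw [e_univ] at this
    simp at this
    omega

end upper

end BR8

/-- BR_8(K_{2,2}, K_{4,4}) = 16. -/
theorem br_8_eq_16 :
    IsLeast {n : ℕ | 0 < n ∧ ∀ G : Finset (Fin 8 × Fin n),
      ContainsK 8 n 2 2 G ∨ ContainsK 8 n 4 4 (bipCompl 8 n G)} 16 := by
  constructor
  · refine ⟨by norm_num, fun G => ?_⟩
    by_contra hcon
    rw [not_or] at hcon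
    obtain ⟨hc2, hc4⟩ := hcon
    refine BR8.upper (c := fun j => Finset.univ.filter (fun x => (x, j) ∈ G)) ?_ ?_
    · intro P hP
      by_contra hlt
      obtain ⟨B, hB, hBc⟩ := Finset.exists_subset_card_eq (Nat.lt_of_not_le hlt)
      refine hc2 ⟨P, B, hP, hBc, fun x hx y hy => ?_⟩
      have h := (Finset.mem_filter.1 (hB hy)).2 hx
      simpa using h
    · intro S hS
      by_contra hlt
      obtain ⟨B, hB, hBc⟩ := Finset.exists_subset_card_eq (Nat.lt_of_not_le hlt)
      refine hc4 ⟨Sᶜ, B, by simp [Finset.card_compl, hS], hBc, fun x hx y hy => ?_⟩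
      have h := (Finset.mem_filter.1 (hB hy)).2
      simp only [bipCompl, Finset.mem_sdiff, Finset.mem_univ, true_and]
      intro hG
      exact (Finset.mem_compl.1 hx) (h (by simpa using hG))
  · rintro n ⟨-, hn⟩
    by_contra hlt
    obtain ⟨G, h1, h2⟩ := BR8.lower (n := n) (by omega)
    exact (hn G).elim h1 h2
end

section
/- 14 is the least positive integer n such that every subgraph G of the complete bipartite graph K_{9,n} contains K_{2,2} or the bipartite complement of G contains K_{4,4}; that is, BR_9(K_{2,2}, K_{4,4}) = 14. -/
/-- Evaluate a natural number before passing it on (helps kernel evaluation). -/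
def brForce (n : ℕ) (f : ℕ → Bool) : Bool :=
  Nat.rec (f 0) (fun m _ => f (Nat.succ m)) n

/-- Evaluate a group of classes, dropping the empty classes. -/
def brForceGroup (l : List (ℕ × ℕ)) : (List (ℕ × ℕ) → Bool) → Bool :=
  List.rec (fun f => f [])
    (fun p _ ih f => Nat.rec (ih f) (fun c _ =>
      brForce p.1 fun m => ih fun t' => f ((m, Nat.succ c) :: t')) p.2) l

def brForceGroups (l : List (List (ℕ × ℕ))) : (List (List (ℕ × ℕ)) → Bool) → Bool :=
  List.rec (fun f => f [])
    (fun g _ ih f => brForceGroup g fun g' => ih fun t' => f (g' :: t')) l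

/-- Total number of columns. -/
def brTotal (l : List (ℕ × ℕ)) : ℕ :=
  List.rec 0 (fun p _ ih => Nat.add p.2 ih) l

def brBit (m i : ℕ) : Bool := Nat.beq (Nat.land 1 (Nat.shiftRight m i)) 1

/-- Keep the columns that do not meet row `i`. -/
def brDrop (i : ℕ) (l : List (ℕ × ℕ)) : (List (ℕ × ℕ) → Bool) → Bool :=
  List.rec (fun f => f [])
    (fun p _ ih f => Bool.rec (ih fun t' => f (p :: t')) (ih f) (brBit p.1 i)) l

def brAll (f : ℕ → Bool) (n : ℕ) : Bool :=
  Nat.rec true (fun n ih => Bool.rec false ih (f n)) n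

/-- No choice of `d` further rows (bits `1, ..., n`) leaves more than 3 columns. -/
def brCheck (d : ℕ) : ℕ → List (ℕ × ℕ) → Bool :=
  Nat.rec (fun _ z => Nat.ble (brTotal z) 3)
    (fun _ ih n z => Bool.rec (brAll (fun i => brDrop (Nat.succ i) z (ih i)) n) true
      (Nat.ble (brTotal z) 3)) d

/-- All columns of a group avoid the new row. -/
def brDouble (l : List (ℕ × ℕ)) : List (ℕ × ℕ) :=
  List.rec [] (fun p _ ih => (Nat.add p.1 p.1, p.2) :: ih) l

/-- All ways to pick a column of the group compatible with `used`. -/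
def brPick (used : ℕ) (h : ℕ → List (ℕ × ℕ) → Bool) (l : List (ℕ × ℕ)) :
    List (ℕ × ℕ) → Bool :=
  List.rec (fun _ => true)
    (fun p t ih pre => Bool.rec false (ih (p :: pre))
      (Bool.rec true
        (h p.1 ((Nat.succ (Nat.add p.1 p.1), 1) :: (Nat.add p.1 p.1, Nat.pred p.2) ::
          brDouble (List.append pre t))) (Nat.beq (Nat.land p.1 used) 0))) l

/-- The next step of `brRec`, with the pruning tests. -/
def brNext (d bud L z b : ℕ) (k : ℕ → ℕ → ℕ → ℕ → List (ℕ × ℕ) → Bool)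
    (used tot vec miss : ℕ) (g : List (ℕ × ℕ)) : Bool :=
  Bool.rec true
    (Bool.rec true
      (brForce vec fun vec' =>
        Bool.rec true
          (brForce used fun used' => brForce tot fun tot' => brForce miss fun miss' =>
            k used' tot' vec' miss' g)
          (Nat.ble (Nat.shiftRight L b) vec'))
      (Nat.ble d (Nat.add (Nat.add tot b) z)))
    (Nat.ble miss bud)

/-- The branching of `brRec` at one group. -/
def brBranch (next : ℕ → ℕ → ℕ → ℕ → List (ℕ × ℕ) → Bool) (b : ℕ) (g : List (ℕ × ℕ))
    (used tot vec miss : ℕ) : Bool :=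
  Bool.rec
    (Bool.rec false
      (brPick used (fun m => next (Nat.lor used m) (Nat.succ tot) (Nat.add vec vec) miss) g [])
      (next used tot (Nat.succ (Nat.add vec vec)) (Nat.succ miss) (brDouble g)))
    (next used tot (Nat.add vec vec) miss (brDouble g))
    (brBit used b)

/-- Run through all possible new rows of degree `d`. -/
def brRec (d bud L z : ℕ) (f : List (List (ℕ × ℕ)) → ℕ → ℕ → ℕ → Bool)
    (gs : List (List (ℕ × ℕ))) :
    ℕ → ℕ → ℕ → ℕ → ℕ → List (List (ℕ × ℕ)) → Bool :=
  List.rec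
    (fun _ _ tot vec miss acc =>
      Bool.rec true
        (brForce (Nat.sub d tot) fun a => Bool.rec true (f acc vec miss a) (Nat.ble a z))
        (Nat.ble tot d))
    (fun g _ ih n used tot vec miss acc =>
      brForce (Nat.pred n) fun b =>
        brBranch (brNext d bud L z b fun used' tot' vec' miss' g' =>
          ih b used' tot' vec' miss' (g' :: acc)) b g used tot vec miss)
    gs

def brFlat (l : List (List (ℕ × ℕ))) : List (ℕ × ℕ) :=
  List.rec [] (fun g _ ih => List.append g ih) l

/-- What to do with a new row. -/
def brLeaf (k z d w : ℕ) (cont : List (List (ℕ × ℕ)) → ℕ → ℕ → ℕ → ℕ → Bool)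
    (acc : List (List (ℕ × ℕ))) (vec miss a : ℕ) : Bool :=
  brForceGroups (List.reverse ([(1, a)] :: acc)) fun gs' =>
    brForce (Nat.sub z a) fun z' =>
      Bool.rec true
        (brForce (Nat.add vec vec) fun lo' =>
          brForce (Nat.add w (Nat.add (Nat.mul 2 d) miss)) fun w' => cont gs' z' d lo' w')
        (brDrop 0 ((0, z') :: brFlat gs') (brCheck 3 k))

/-- `brSearch rem k gs z dlo lo w = true` means that the partial configuration is refuted. -/
def brSearch (rem : ℕ) : ℕ → List (List (ℕ × ℕ)) → ℕ → ℕ → ℕ → ℕ → Bool :=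
  Nat.rec (fun _ _ _ _ _ _ => false)
    (fun rem ih k gs z dlo lo w =>
      brForce (Nat.mul 2 (Nat.succ rem)) fun q =>
        brAll (fun e =>
          brForce (Nat.add dlo e) fun d =>
          brForce (Nat.sub 78 (Nat.add w (Nat.mul q d))) fun bud =>
          brForce (Bool.rec 0 lo (Nat.beq e 0)) fun L =>
          brRec d bud L z (brLeaf k z d w (ih (Nat.succ k))) gs k 0 0 0 0 [])
        (Nat.sub (Nat.succ (Nat.div (Nat.sub 78 w) q)) dlo)) rem


/-! ### Semantics -/

theorem brForce_eq (n : ℕ) (f : ℕ → Bool) : brForce n f = f n := by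
  cases n <;> rfl

theorem brBit_eq (m i : ℕ) : brBit m i = m.testBit i := by
  have h : Nat.land 1 (Nat.shiftRight m i) = (m >>> i) % 2 := Nat.one_and_eq_mod_two _
  unfold brBit
  rw [h, Nat.testBit_eq_decide_div_mod_eq, Nat.shiftRight_eq_div_pow]
  rcases Nat.mod_two_eq_zero_or_one (m / 2 ^ i) with h | h <;> rw [h] <;> rfl

theorem brAll_iff (f : ℕ → Bool) (n : ℕ) : brAll f n = true ↔ ∀ i < n, f i = true := by
  induction n with
  | zero => exact ⟨fun _ i hi => absurd hi (Nat.not_lt_zero i), fun _ => rfl⟩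
  | succ n ih =>
    have h : brAll f (n + 1) = Bool.rec false (brAll f n) (f n) := rfl
    rw [h]
    constructor
    · intro h i hi
      cases hf : f n with
      | false => rw [hf] at h; exact absurd h (by simp)
      | true =>
        rw [hf] at h
        rcases Nat.lt_succ_iff_lt_or_eq.mp hi with hi | rfl
        · exact ih.mp h i hi
        · exact hf
    · intro h
      rw [h n (Nat.lt_succ_self n)]
      exact ih.mpr fun i hi => h i (Nat.lt_succ_of_lt hi)

/-- The multiset of masks described by a list of classes. -/
def brExp : List (ℕ × ℕ) → Multiset ℕ
  | [] => 0
  | p :: t => Multiset.replicate p.2 p.1 + brExp t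

theorem brExp_append (l₁ l₂ : List (ℕ × ℕ)) : brExp (l₁ ++ l₂) = brExp l₁ + brExp l₂ := by
  induction l₁ with
  | nil => simp [brExp]
  | cons p t ih => simp [brExp, ih, add_assoc]

theorem brTotal_eq (l : List (ℕ × ℕ)) : brTotal l = (brExp l).card := by
  induction l with
  | nil => rfl
  | cons p t ih =>
    have h : brTotal (p :: t) = p.2 + brTotal t := rfl
    rw [h, ih]; simp [brExp]

theorem brDrop_eq (i : ℕ) (l : List (ℕ × ℕ)) : ∀ f : List (ℕ × ℕ) → Bool,
    ∃ l', brDrop i l f = f l' ∧ brExp l' = (brExp l).filter (fun m => m.testBit i = false) := by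
  induction l with
  | nil => intro f; exact ⟨[], rfl, by simp [brExp]⟩
  | cons p t ih =>
    intro f
    have h : brDrop i (p :: t) f =
      Bool.rec (brDrop i t fun t' => f (p :: t')) (brDrop i t f) (brBit p.1 i) := rfl
    rw [h, brBit_eq]
    cases hb : p.1.testBit i with
    | false =>
      obtain ⟨l', h1, h2⟩ := ih fun t' => f (p :: t')
      refine ⟨p :: l', h1, ?_⟩
      rw [brExp, brExp, h2, Multiset.filter_add]
      congr 1
      symm
      rw [Multiset.filter_eq_self]
      intro a ha
      rw [Multiset.eq_of_mem_replicate ha]; exact hb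
    | true =>
      obtain ⟨l', h1, h2⟩ := ih f
      refine ⟨l', h1, ?_⟩
      rw [brExp, h2, Multiset.filter_add]
      symm
      rw [add_eq_right, Multiset.filter_eq_nil]
      intro a ha
      rw [Multiset.eq_of_mem_replicate ha, hb]; simp

theorem brDouble_eq (l : List (ℕ × ℕ)) : brExp (brDouble l) = (brExp l).map (fun m => 2 * m) := by
  induction l with
  | nil => rfl
  | cons p t ih =>
    have h : brDouble (p :: t) = (p.1 + p.1, p.2) :: brDouble t := rfl
    rw [h, brExp, brExp, ih, Multiset.map_add, Multiset.map_replicate, two_mul]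

theorem brForceGroup_eq (l : List (ℕ × ℕ)) : ∃ l', brExp l' = brExp l ∧
    ∀ f : List (ℕ × ℕ) → Bool, brForceGroup l f = f l' := by
  induction l with
  | nil => exact ⟨[], rfl, fun f => rfl⟩
  | cons p t ih =>
    obtain ⟨l', h1, h2⟩ := ih
    obtain ⟨m, c⟩ := p
    cases c with
    | zero =>
      refine ⟨l', by simp [brExp, h1], fun f => ?_⟩
      have h : brForceGroup ((m, 0) :: t) f = brForceGroup t f := rfl
      rw [h, h2]
    | succ c =>
      refine ⟨(m, c + 1) :: l', by simp [brExp, h1], fun f => ?_⟩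
      have h : brForceGroup ((m, c + 1) :: t) f =
        brForce m fun m => brForceGroup t fun t' => f ((m, c + 1) :: t') := rfl
      rw [h, brForce_eq, h2]

theorem brForceGroups_eq (l : List (List (ℕ × ℕ))) : ∃ l', l'.map brExp = l.map brExp ∧
    ∀ f : List (List (ℕ × ℕ)) → Bool, brForceGroups l f = f l' := by
  induction l with
  | nil => exact ⟨[], rfl, fun f => rfl⟩
  | cons g t ih =>
    obtain ⟨l', h1, h2⟩ := ih
    obtain ⟨g', h3, h4⟩ := brForceGroup_eq g
    refine ⟨g' :: l', by simp [h1, h3], fun f => ?_⟩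
    have h : brForceGroups (g :: t) f =
      brForceGroup g fun g' => brForceGroups t fun t' => f (g' :: t') := rfl
    rw [h, h4, h2]

/-- If every pick is refuted, so is the pick of a class with mask `m`. -/
theorem brPick_sound (used : ℕ) (h : ℕ → List (ℕ × ℕ) → Bool) (m : ℕ)
    (hm : m &&& used = 0) (l : List (ℕ × ℕ)) : ∀ pre : List (ℕ × ℕ), m ∈ brExp l →
    brPick used h l pre = true →
    ∃ g', brExp g' = (2 * m + 1) ::ₘ ((brExp pre + brExp l).erase m).map (fun m => 2 * m) ∧
      h m g' = true := by
  induction l with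
  | nil => intro pre hl; simp [brExp] at hl
  | cons p t ih =>
    intro pre hl hp
    have hdef : brPick used h (p :: t) pre = Bool.rec false (brPick used h t (p :: pre))
      (Bool.rec true
        (h p.1 ((p.1 + p.1 + 1, 1) :: (p.1 + p.1, p.2 - 1) ::
          brDouble (pre ++ t))) (Nat.beq (p.1 &&& used) 0)) := rfl
    rw [hdef] at hp
    by_cases hc : m ∈ Multiset.replicate p.2 p.1
    · obtain ⟨hc0, rfl⟩ := Multiset.mem_replicate.mp hc
      rw [hm] at hp
      refine ⟨(p.1 + p.1 + 1, 1) :: (p.1 + p.1, p.2 - 1) :: brDouble (pre ++ t), ?_, ?_⟩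
      rotate_left
      · by_contra hne
        rw [Bool.not_eq_true] at hne
        change (Bool.rec false (brPick used h t (p :: pre)) (h p.1 _) : Bool) = true at hp
        rw [hne] at hp
        exact absurd hp (by simp)
      · obtain ⟨q, c⟩ := p
        obtain ⟨c, rfl⟩ : ∃ c', c = c' + 1 := ⟨c - 1, by simp at hc0; omega⟩
        simp only [brExp, brDouble_eq, brExp_append, Multiset.replicate_succ,
          Multiset.replicate_zero, Nat.add_sub_cancel, Multiset.cons_add, Multiset.add_cons,
          Multiset.erase_cons_head, Multiset.map_add, Multiset.map_replicate, zero_add, ← two_mul]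
        congr 1
        abel
    · have hl' : m ∈ brExp t := by
        rw [brExp, Multiset.mem_add] at hl
        exact hl.resolve_left hc
      have hp' : brPick used h t (p :: pre) = true := by
        generalize (Bool.rec true
          (h p.1 ((p.1 + p.1 + 1, 1) :: (p.1 + p.1, p.2 - 1) ::
          brDouble (pre ++ t))) (Nat.beq (p.1 &&& used) 0) : Bool) = b at hp
        cases b with
        | false => exact absurd hp (by simp)
        | true => exact hp
      obtain ⟨g', h1, h2⟩ := ih (p :: pre) hl' hp'
      refine ⟨g', ?_, h2⟩
      rw [h1, brExp, brExp]
      congr 3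
      abel

/-- The mask of a column with respect to a list of rows (newest row = lowest bit). -/
def brMask (N : Fin 9 → Finset (Fin 14)) : List (Fin 9) → Fin 14 → ℕ
  | [], _ => 0
  | x :: l, c => 2 * brMask N l c + if c ∈ N x then 1 else 0

/-- The vector of rows of the list which do not meet row `r`. -/
def brMV (N : Fin 9 → Finset (Fin 14)) (r : Fin 9) : List (Fin 9) → ℕ
  | [] => 0
  | x :: l => 2 * brMV N r l + if N x ∩ N r = ∅ then 1 else 0

/-- The number of rows of the list which do not meet row `r`. -/
def brMC (N : Fin 9 → Finset (Fin 14)) (r : Fin 9) : List (Fin 9) → ℕ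
  | [] => 0
  | x :: l => brMC N r l + if N x ∩ N r = ∅ then 1 else 0

/-- The groups `gs` describe the columns of `A` met by the rows `xs`, grouped by the first row
that meets them; there are `z` further columns. -/
def brGRep (N : Fin 9 → Finset (Fin 14)) (mk : Fin 14 → ℕ) :
    List (Fin 9) → Finset (Fin 14) → List (List (ℕ × ℕ)) → ℕ → Prop
  | [], A, gs, z => gs = [] ∧ z = A.card
  | _ :: _, _, [], _ => False
  | x :: xs, A, g :: gs, z =>
    (A ∩ N x).val.map mk = brExp g ∧ brGRep N mk xs (A \ N x) gs z

theorem brMask_zero (N : Fin 9 → Finset (Fin 14)) (l : List (Fin 9)) (c : Fin 14)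
    (h : ∀ x ∈ l, c ∉ N x) : brMask N l c = 0 := by
  induction l with
  | nil => rfl
  | cons x l ih =>
    rw [brMask, ih fun y hy => h y (List.mem_cons_of_mem x hy), if_neg (h x List.mem_cons_self)]

theorem brMask_testBit (N : Fin 9 → Finset (Fin 14)) (p q : List (Fin 9)) (x : Fin 9)
    (c : Fin 14) : (brMask N (p ++ x :: q) c).testBit p.length = decide (c ∈ N x) := by
  induction p with
  | nil =>
    simp only [List.nil_append, brMask, List.length_nil, Nat.testBit_zero]
    by_cases h : c ∈ N x <;> simp [h]
  | cons y p ih =>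
    simp only [List.cons_append, brMask, List.length_cons]
    rw [Nat.testBit_succ, ← ih]
    congr 1
    split_ifs <;> omega

theorem brMask_testBit' (N : Fin 9 → Finset (Fin 14)) (l : List (Fin 9)) (j : ℕ) :
    (∃ x ∈ l, ∀ c, (brMask N l c).testBit j = decide (c ∈ N x)) ∨
      ∀ c, (brMask N l c).testBit j = false := by
  rcases Nat.lt_or_ge j l.length with hj | hj
  · left
    refine ⟨l[j], List.getElem_mem hj, fun c => ?_⟩
    have h := brMask_testBit N (l.take j) (l.drop (j + 1)) l[j] c
    rw [List.getElem_cons_drop, List.take_append_drop, List.length_take, min_eq_left hj.le] at h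
    exact h
  · right
    intro c
    apply Nat.testBit_lt_two_pow
    refine lt_of_lt_of_le ?_ (Nat.pow_le_pow_right (by norm_num) hj)
    clear hj
    induction l with
    | nil => simp [brMask]
    | cons x l ih =>
      rw [brMask, List.length_cons, pow_succ]
      split_ifs <;> omega

theorem brMV_lt (N : Fin 9 → Finset (Fin 14)) (r : Fin 9) (l : List (Fin 9)) :
    brMV N r l < 2 ^ l.length := by
  induction l with
  | nil => simp [brMV]
  | cons x l ih => rw [brMV, List.length_cons, pow_succ]; split_ifs <;> omega

theorem brMV_append (N : Fin 9 → Finset (Fin 14)) (r : Fin 9) (p l : List (Fin 9)) :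
    brMV N r (p ++ l) < 2 ^ p.length * (brMV N r l + 1) := by
  induction p with
  | nil => simp
  | cons x p ih =>
    rw [List.cons_append, brMV, List.length_cons, pow_succ, mul_assoc, mul_left_comm]
    split_ifs <;> omega

theorem brMC_append (N : Fin 9 → Finset (Fin 14)) (r : Fin 9) (p l : List (Fin 9)) :
    brMC N r l ≤ brMC N r (p ++ l) := by
  induction p with
  | nil => simp
  | cons x p ih => rw [List.cons_append, brMC]; omega

theorem brGRep_card (N : Fin 9 → Finset (Fin 14)) (mk : Fin 14 → ℕ)
    (hN : ∀ x y, x ≠ y → (N x ∩ N y).card ≤ 1) (r : Fin 9) (xs : List (Fin 9)) :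
    ∀ A gs z, r ∉ xs → brGRep N mk xs A gs z → (N r ∩ A).card ≤ xs.length + z := by
  induction xs with
  | nil =>
    intro A gs z _ h
    rw [h.2]
    simpa using Finset.card_le_card Finset.inter_subset_right
  | cons x xs ih =>
    intro A gs z hr h
    cases gs with
    | nil => exact h.elim
    | cons g gs =>
      have h1 := ih _ _ _ (fun h' => hr (List.mem_cons_of_mem x h')) h.2
      have h2 := hN r x (fun h' => hr (h' ▸ List.mem_cons_self))
      have h3 : N r ∩ A ⊆ (N r ∩ (A \ N x)) ∪ (N r ∩ N x) := by
        intro c hc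
        simp only [Finset.mem_union, Finset.mem_inter, Finset.mem_sdiff] at hc ⊢
        tauto
      have h4 := (Finset.card_le_card h3).trans (Finset.card_union_le _ _)
      rw [List.length_cons]
      omega

theorem brNext_sound {d bud L z b : ℕ} {k : ℕ → ℕ → ℕ → ℕ → List (ℕ × ℕ) → Bool}
    {used tot vec miss : ℕ} {g : List (ℕ × ℕ)} (h1 : miss ≤ bud) (h2 : d ≤ tot + b + z)
    (h3 : L >>> b ≤ vec) (h : brNext d bud L z b k used tot vec miss g = true) :
    k used tot vec miss g = true := by
  unfold brNext at h
  simp only [brForce_eq] at h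
  have e1 : Nat.ble miss bud = true := Nat.ble_eq_true_of_le h1
  have e2 : Nat.ble d (Nat.add (Nat.add tot b) z) = true := Nat.ble_eq_true_of_le h2
  have e3 : Nat.ble (Nat.shiftRight L b) vec = true := Nat.ble_eq_true_of_le h3
  rw [e1, e2, e3] at h
  exact h

set_option maxHeartbeats 1000000 in
theorem brRec_sound (N : Fin 9 → Finset (Fin 14))
    (hN : ∀ x y, x ≠ y → (N x ∩ N y).card ≤ 1) (r : Fin 9) (l : List (Fin 9)) (hr : r ∉ l)
    (bud L z : ℕ) (f : List (List (ℕ × ℕ)) → ℕ → ℕ → ℕ → Bool)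
    (hbud : brMC N r l ≤ bud) (hL : L ≤ brMV N r l)
    (hf : ∀ acc a, brGRep N (brMask N (r :: l)) (r :: l).reverse Finset.univ
      (acc.reverse ++ [[(1, a)]]) (z - a) → f acc (brMV N r l) (brMC N r l) a = true → False)
    (gs : List (List (ℕ × ℕ))) :
    ∀ (xs prev : List (Fin 9)) (A : Finset (Fin 14)) (used : ℕ) (acc : List (List (ℕ × ℕ))),
      l = xs.reverse ++ prev → brGRep N (brMask N l) xs A gs z →
      (∀ c, c ∈ A ↔ ∀ x ∈ prev, c ∉ N x) →
      (∀ j, used.testBit j = true ↔ ∃ c ∈ N r \ A, (brMask N l c).testBit j = true) →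
      (∀ gs' z', brGRep N (brMask N (r :: l)) (xs ++ [r]) A gs' z' →
        brGRep N (brMask N (r :: l)) (r :: l).reverse Finset.univ (acc.reverse ++ gs') z') →
      brRec (N r).card bud L z f gs xs.length used (N r \ A).card (brMV N r prev)
        (brMC N r prev) acc = true → False := by
  have hcol : ∀ x, x ≠ r → ∀ c c', c ∈ N x → c ∈ N r → c' ∈ N x → c' ∈ N r → c = c' := by
    intro x hx c c' h1 h2 h3 h4
    exact Finset.card_le_one.mp (hN x r hx) c (Finset.mem_inter.mpr ⟨h1, h2⟩) c'
      (Finset.mem_inter.mpr ⟨h3, h4⟩)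
  induction gs with
  | nil =>
    intro xs prev A used acc hl hG hA hused hacc h
    cases xs with
    | cons x xs => exact hG
    | nil =>
      have hl : l = prev := by simpa using hl
      subst hl
      have hz : z = A.card := hG.2
      have hcard : (N r \ A).card + (A ∩ N r).card = (N r).card := by
        rw [Finset.inter_comm]; exact Finset.card_sdiff_add_card_inter _ _
      have hzc : (A ∩ N r).card ≤ z := hz ▸ Finset.card_le_card Finset.inter_subset_left
      have hdef : brRec (N r).card bud L z f [] 0 used (N r \ A).card (brMV N r l)
        (brMC N r l) acc = Bool.rec true
        (brForce ((N r).card - (N r \ A).card) fun a =>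
          Bool.rec true (f acc (brMV N r l) (brMC N r l) a) (Nat.ble a z))
        (Nat.ble (N r \ A).card (N r).card) := rfl
      have e1 : Nat.ble (N r \ A).card (N r).card = true :=
        Nat.ble_eq_true_of_le (Finset.card_le_card Finset.sdiff_subset)
      have e2 : (N r).card - (N r \ A).card = (A ∩ N r).card := by omega
      have e3 : Nat.ble (A ∩ N r).card z = true := Nat.ble_eq_true_of_le hzc
      rw [List.length_nil, hdef, brForce_eq, e1, e2, e3] at h
      refine hf acc (A ∩ N r).card (hacc _ _ ?_) h
      refine ⟨?_, rfl, ?_⟩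
      · have : ∀ c ∈ A ∩ N r, brMask N (r :: l) c = 1 := by
          intro c hc
          rw [Finset.mem_inter] at hc
          rw [brMask, brMask_zero N l c ((hA c).mp hc.1), if_pos hc.2]
        rw [Multiset.map_congr rfl this, Multiset.map_const']
        simp only [brExp, add_zero]
        rfl
      · have := Finset.card_sdiff_add_card_inter A (N r)
        omega
  | cons g gs ih =>
    intro xs prev A used acc hl hG hA hused hacc h
    cases xs with
    | nil => exact absurd hG.1 (by simp)
    | cons x xs =>
      obtain ⟨hg, hG'⟩ := hG
      have hl' : l = xs.reverse ++ (x :: prev) := by rw [hl]; simp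
      have hxl : x ∈ l := by rw [hl']; simp
      have hxr : x ≠ r := fun h' => hr (h' ▸ hxl)
      have hbit : ∀ c, (brMask N l c).testBit xs.length = decide (c ∈ N x) := by
        intro c
        have := brMask_testBit N xs.reverse prev x c
        rwa [← hl', List.length_reverse] at this
      have hA' : ∀ c, c ∈ A \ N x ↔ ∀ y ∈ x :: prev, c ∉ N y := by
        intro c
        rw [Finset.mem_sdiff, hA]
        simp only [List.mem_cons, forall_eq_or_imp]
        tauto
      -- the common continuation
      have key : ∀ (used' tot' vec' miss' : ℕ) (g' : List (ℕ × ℕ)),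
          tot' = (N r \ (A \ N x)).card →
          vec' = brMV N r (x :: prev) → miss' = brMC N r (x :: prev) →
          (∀ j, used'.testBit j = true ↔
            ∃ c ∈ N r \ (A \ N x), (brMask N l c).testBit j = true) →
          (A ∩ N x).val.map (brMask N (r :: l)) = brExp g' →
          brNext (N r).card bud L z xs.length (fun used' tot' vec' miss' g' =>
            brRec (N r).card bud L z f gs xs.length used' tot' vec' miss' (g' :: acc))
            used' tot' vec' miss' g' = true → False := by
        intro used' tot' vec' miss' g' ht hv hm hu hg' hn
        subst ht hv hm
        have h1 : brMC N r (x :: prev) ≤ bud := by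
          refine le_trans ?_ hbud
          rw [hl']; exact brMC_append N r _ _
        have h2 : (N r).card ≤ (N r \ (A \ N x)).card + xs.length + z := by
          have a1 := brGRep_card N _ hN r xs _ _ _ (fun h' => hr (by rw [hl']; simp [h'])) hG'
          have a2 := Finset.card_sdiff_add_card_inter (N r) (A \ N x)
          omega
        have h3 : L >>> xs.length ≤ brMV N r (x :: prev) := by
          have a1 := brMV_append N r xs.reverse (x :: prev)
          rw [← hl', List.length_reverse] at a1
          rw [Nat.shiftRight_eq_div_pow]
          apply Nat.le_of_lt_succ
          apply Nat.div_lt_of_lt_mul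
          exact lt_of_le_of_lt hL a1
        refine ih xs (x :: prev) (A \ N x) used' (g' :: acc) hl' hG' hA' hu ?_
          (brNext_sound h1 h2 h3 hn)
        intro gs' z' hgs
        have := hacc (g' :: gs') z' ⟨hg', hgs⟩
        simpa using this
      have hdef : brRec (N r).card bud L z f (g :: gs) (xs.length + 1) used (N r \ A).card
          (brMV N r prev) (brMC N r prev) acc =
        brForce xs.length fun b =>
          brBranch (brNext (N r).card bud L z b fun used' tot' vec' miss' g' =>
            brRec (N r).card bud L z f gs b used' tot' vec' miss' (g' :: acc)) b g used
            (N r \ A).card (brMV N r prev) (brMC N r prev) := rfl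
      rw [List.length_cons, hdef, brForce_eq, brBranch, brBit_eq] at h
      have hdbl : (∀ c ∈ A ∩ N x, c ∉ N r) →
          (A ∩ N x).val.map (brMask N (r :: l)) = brExp (brDouble g) := by
        intro hc
        rw [brDouble_eq, ← hg, Multiset.map_map]
        refine Multiset.map_congr rfl fun c hc' => ?_
        rw [brMask, if_neg (hc c hc')]; rfl
      have hsd : (∀ c ∈ A ∩ N x, c ∉ N r) → N r \ (A \ N x) = N r \ A := by
        intro hc
        ext c
        have := hc c
        simp only [Finset.mem_sdiff, Finset.mem_inter] at this ⊢
        tauto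
      cases hub : used.testBit xs.length with
      | true =>
        rw [hub] at h
        obtain ⟨c, hc, hcx⟩ := (hused _).mp hub
        rw [hbit, decide_eq_true_eq] at hcx
        rw [Finset.mem_sdiff] at hc
        have hno : ∀ c ∈ A ∩ N x, c ∉ N r := by
          intro c' hc' hc'r
          rw [Finset.mem_inter] at hc'
          exact hc.2 (hcol x hxr c c' hcx hc.1 hc'.2 hc'r ▸ hc'.1)
        have hne : N x ∩ N r ≠ ∅ := Finset.ne_empty_of_mem (Finset.mem_inter.mpr ⟨hcx, hc.1⟩)
        refine key _ _ _ _ _ (by rw [hsd hno]) ?_ ?_ ?_ (hdbl hno) h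
        · rw [brMV, if_neg hne, two_mul]; rfl
        · rw [brMC, if_neg hne, add_zero]
        · rw [hsd hno]; exact hused
      | false =>
        rw [hub] at h
        have hprev : ∀ c ∈ N r \ A, c ∉ N x := by
          intro c hc hcx
          have : used.testBit xs.length = true :=
            (hused _).mpr ⟨c, hc, by rw [hbit]; simpa using hcx⟩
          rw [hub] at this
          exact absurd this (by simp)
        have hskip : (∀ c ∈ A ∩ N x, c ∉ N r) → brNext (N r).card bud L z xs.length
            (fun used' tot' vec' miss' g' =>
              brRec (N r).card bud L z f gs xs.length used' tot' vec' miss' (g' :: acc))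
            used (N r \ A).card (Nat.succ (Nat.add (brMV N r prev) (brMV N r prev)))
            (Nat.succ (brMC N r prev)) (brDouble g) = true → False := by
          intro hno hn
          have hemp : N x ∩ N r = ∅ := by
            rw [Finset.eq_empty_iff_forall_notMem]
            intro c hc
            rw [Finset.mem_inter] at hc
            by_cases hcA : c ∈ A
            · exact hno c (Finset.mem_inter.mpr ⟨hcA, hc.1⟩) hc.2
            · exact hprev c (Finset.mem_sdiff.mpr ⟨hc.2, hcA⟩) hc.1
          refine key _ _ _ _ _ (by rw [hsd hno]) ?_ ?_ ?_ (hdbl hno) hn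
          · rw [brMV, if_pos hemp, two_mul]; rfl
          · rw [brMC, if_pos hemp]
          · rw [hsd hno]; exact hused
        have hboth : ∀ b p : Bool, (Bool.rec false p b : Bool) = true → b = true ∧ p = true := by
          intro b p; cases b <;> simp
        obtain ⟨hs, hp⟩ := hboth _ _ h
        by_cases hno : ∀ c ∈ A ∩ N x, c ∉ N r
        · exact hskip hno hs
        · push Not at hno
          obtain ⟨c, hcA, hcr⟩ := hno
          have hcA' := Finset.mem_inter.mp hcA
          have hland : brMask N l c &&& used = 0 := by
            apply Nat.eq_of_testBit_eq
            intro j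
            rw [Nat.testBit_and, Nat.zero_testBit, Bool.and_eq_false_iff]
            by_contra hcon
            simp only [not_or, Bool.not_eq_false] at hcon
            obtain ⟨c', hc', hc'j⟩ := (hused j).mp hcon.2
            rw [Finset.mem_sdiff] at hc'
            rcases brMask_testBit' N l j with ⟨y, hy, hyj⟩ | hyj
            · have a1 := hcon.1
              rw [hyj, decide_eq_true_eq] at a1 hc'j
              have hyr : y ≠ r := fun h' => hr (h' ▸ hy)
              exact hc'.2 (hcol y hyr c c' a1 hcr hc'j hc'.1 ▸ hcA'.1)
            · rw [hyj] at hc'j; exact absurd hc'j (by simp)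
          have hmem : brMask N l c ∈ brExp g := by
            rw [← hg]; exact Multiset.mem_map_of_mem _ hcA
          obtain ⟨g', hg', hn⟩ := brPick_sound used _ (brMask N l c) hland g [] hmem hp
          have huniq : ∀ c' ∈ A ∩ N x, c' ∈ N r → c' = c := fun c' h1 h2 =>
            hcol x hxr c' c (Finset.mem_inter.mp h1).2 h2 hcA'.2 hcr
          have hins : N r \ (A \ N x) = insert c (N r \ A) := by
            ext c'
            have a1 := huniq c'
            simp only [Finset.mem_sdiff, Finset.mem_inter, Finset.mem_insert] at a1 ⊢
            constructor
            · intro h'; tauto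
            · rintro (rfl | h')
              · tauto
              · tauto
          have hne : N x ∩ N r ≠ ∅ :=
            Finset.ne_empty_of_mem (Finset.mem_inter.mpr ⟨hcA'.2, hcr⟩)
          refine key _ _ _ _ _ ?_ ?_ ?_ ?_ ?_ hn
          · rw [hins, Finset.card_insert_of_notMem (by simp [hcA'.1])]
          · rw [brMV, if_neg hne, two_mul]; rfl
          · rw [brMC, if_neg hne, add_zero]
          · intro j
            change (used ||| brMask N l c).testBit j = true ↔ _
            rw [Nat.testBit_or, Bool.or_eq_true, hused, hins]
            simp only [Finset.mem_insert, exists_eq_or_imp]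
            exact or_comm
          · rw [hg', brExp, zero_add, ← hg]
            have hsplit : (A ∩ N x).val = c ::ₘ ((A ∩ N x).erase c).val := by
              rw [Finset.erase_val, Multiset.cons_erase hcA]
            rw [hsplit, Multiset.map_cons, Multiset.map_cons, Multiset.erase_cons_head,
              Multiset.map_map]
            congr 1
            · rw [brMask, if_pos hcr]
            · refine Multiset.map_congr rfl fun c' hc' => ?_
              have hc'' : c' ∈ (A ∩ N x).erase c := hc'
              rw [Finset.mem_erase] at hc''
              rw [brMask, if_neg fun h' => hc''.1 (huniq c' hc''.2 h')]; rfl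

/-! ### The check of quadruples of rows -/

theorem brCheck_sound (N : Fin 9 → Finset (Fin 14))
    (H4 : ∀ S : Finset (Fin 9), S.card = 4 →
      (Finset.univ.filter fun c => ∀ x ∈ S, c ∉ N x).card ≤ 3)
    (l : List (Fin 9)) (hnd : l.Nodup) (d : ℕ) :
    ∀ (n : ℕ) (z : List (ℕ × ℕ)) (S : Finset (Fin 9)), S.card + d = 4 → n + 1 ≤ l.length →
      (∀ (j : ℕ) (hj : j < l.length), 1 ≤ j → j ≤ n → l[j] ∉ S) →
      brExp z = (Finset.univ.filter fun c => ∀ x ∈ S, c ∉ N x).val.map (brMask N l) →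
      brCheck d n z = true := by
  induction d with
  | zero =>
    intro n z S hS _ _ hz
    have hdef : brCheck 0 n z = Nat.ble (brTotal z) 3 := rfl
    rw [hdef, brTotal_eq, hz, Multiset.card_map]
    exact Nat.ble_eq_true_of_le (H4 S hS)
  | succ d ih =>
    intro n z S hS hn hl hz
    have hdef : brCheck (d + 1) n z =
      Bool.rec (brAll (fun i => brDrop (i + 1) z (brCheck d i)) n) true
        (Nat.ble (brTotal z) 3) := rfl
    rw [hdef]
    cases Nat.ble (brTotal z) 3 with
    | true => rfl
    | false =>
      change brAll _ n = true
      rw [brAll_iff]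
      intro i hi
      obtain ⟨z', h1, h2⟩ := brDrop_eq (i + 1) z (brCheck d i)
      rw [h1]
      have hil : i + 1 < l.length := by omega
      have hnot : l[i + 1] ∉ S := hl (i + 1) hil (by omega) (by omega)
      refine ih i z' (insert l[i + 1] S) ?_ (by omega) ?_ ?_
      · rw [Finset.card_insert_of_notMem hnot]; omega
      · intro j hj h1j hji hmem
        rw [Finset.mem_insert] at hmem
        rcases hmem with hmem | hmem
        · have := (List.Nodup.getElem_inj_iff hnd).mp hmem
          omega
        · exact hl j hj h1j (by omega) hmem
      · rw [h2, hz, Multiset.filter_map]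
        congr 1
        have hbit : ∀ c, (brMask N l c).testBit (i + 1) = decide (c ∈ N l[i + 1]) := by
          intro c
          have h := brMask_testBit N (l.take (i + 1)) (l.drop (i + 1 + 1)) l[i + 1] c
          rwa [List.getElem_cons_drop, List.take_append_drop, List.length_take,
            min_eq_left hil.le] at h
        rw [← Finset.filter_val, Finset.filter_filter]
        congr 1
        ext c
        simp only [Finset.mem_filter, Finset.mem_univ, true_and, Function.comp, hbit,
          Finset.forall_mem_insert, decide_eq_false_iff_not]
        exact and_comm

theorem brGRep_flat (N : Fin 9 → Finset (Fin 14)) (mk : Fin 14 → ℕ) (xs : List (Fin 9)) :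
    ∀ A gs z, brGRep N mk xs A gs z → (∀ c ∈ A, (∀ x ∈ xs, c ∉ N x) → mk c = 0) →
      A.val.map mk = brExp (brFlat gs) + Multiset.replicate z 0 := by
  induction xs with
  | nil =>
    intro A gs z h h0
    rw [h.1, h.2]
    have : ∀ c ∈ A, mk c = 0 := fun c hc => h0 c hc (by simp)
    rw [Multiset.map_congr rfl this, Multiset.map_const']
    change _ = 0 + _
    rw [zero_add]
    rfl
  | cons x xs ih =>
    intro A gs z h h0
    cases gs with
    | nil => exact h.elim
    | cons g gs =>
      have h1 := ih _ _ _ h.2 (by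
        intro c hc hx
        rw [Finset.mem_sdiff] at hc
        refine h0 c hc.1 ?_
        intro y hy
        rcases List.mem_cons.mp hy with rfl | hy
        · exact hc.2
        · exact hx y hy)
      have hdef : brFlat (g :: gs) = g ++ brFlat gs := rfl
      have hsplit : A.val = (A ∩ N x).val + (A \ N x).val := by
        rw [← Finset.filter_mem_eq_inter, ← Finset.filter_notMem_eq_sdiff]
        simp only [Finset.filter_val]
        exact (Multiset.filter_add_not _ _).symm
      rw [hdef, brExp_append, hsplit, Multiset.map_add, h.1, h1, add_assoc]

theorem brGRep_congr (N : Fin 9 → Finset (Fin 14)) (mk : Fin 14 → ℕ) (xs : List (Fin 9)) :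
    ∀ A gs gs' z, gs'.map brExp = gs.map brExp → brGRep N mk xs A gs z →
      brGRep N mk xs A gs' z := by
  induction xs with
  | nil =>
    intro A gs gs' z he h
    obtain ⟨rfl, h2⟩ := h
    exact ⟨by simpa using he, h2⟩
  | cons x xs ih =>
    intro A gs gs' z he h
    cases gs with
    | nil => exact h.elim
    | cons g gs =>
      cases gs' with
      | nil => simp at he
      | cons g' gs' =>
        simp only [List.map_cons, List.cons.injEq] at he
        exact ⟨h.1.trans he.1.symm, ih _ _ _ _ he.2 h.2⟩

/-! ### The counting bound -/

def brW (N : Fin 9 → Finset (Fin 14)) : List (Fin 9) → ℕ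
  | [] => 0
  | x :: l => brW N l + (2 * (N x).card + brMC N x l)

def brK (N : Fin 9 → Finset (Fin 14)) : List (Fin 9) → Fin 14 → ℕ
  | [], _ => 0
  | x :: l, c => brK N l c + if c ∈ N x then 1 else 0

theorem brMC_count (N : Fin 9 → Finset (Fin 14))
    (hN : ∀ x y, x ≠ y → (N x ∩ N y).card ≤ 1) (r : Fin 9) (l : List (Fin 9)) (hr : r ∉ l) :
    brMC N r l + ∑ c, (if c ∈ N r then brK N l c else 0) = l.length := by
  induction l with
  | nil => simp [brMC, brK]
  | cons x l ih =>
    have ih := ih fun h => hr (List.mem_cons_of_mem x h)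
    have hxr : x ≠ r := fun h => hr (h ▸ List.mem_cons_self)
    have h1 : ∑ c, (if c ∈ N r then brK N (x :: l) c else 0) =
        ∑ c, (if c ∈ N r then brK N l c else 0) + (N x ∩ N r).card := by
      rw [Finset.card_eq_sum_ones, ← Finset.sum_filter_add_sum_filter_not Finset.univ
        (fun c => c ∈ N x ∩ N r) (fun c => if c ∈ N r then brK N (x :: l) c else 0)] 
      rw [← Finset.sum_filter_add_sum_filter_not Finset.univ
        (fun c => c ∈ N x ∩ N r) (fun c => if c ∈ N r then brK N l c else 0)]
      have e1 : ∑ c ∈ Finset.univ.filter (fun c => c ∈ N x ∩ N r),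
          (if c ∈ N r then brK N (x :: l) c else 0) =
          ∑ c ∈ Finset.univ.filter (fun c => c ∈ N x ∩ N r),
          (if c ∈ N r then brK N l c else 0) + ∑ c ∈ N x ∩ N r, 1 := by
        rw [Finset.filter_univ_mem, ← Finset.sum_add_distrib]
        refine Finset.sum_congr rfl fun c hc => ?_
        rw [Finset.mem_inter] at hc
        rw [if_pos hc.2, if_pos hc.2, brK, if_pos hc.1]
      have e2 : ∑ c ∈ Finset.univ.filter (fun c => ¬ c ∈ N x ∩ N r),
          (if c ∈ N r then brK N (x :: l) c else 0) =
          ∑ c ∈ Finset.univ.filter (fun c => ¬ c ∈ N x ∩ N r),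
          (if c ∈ N r then brK N l c else 0) := by
        refine Finset.sum_congr rfl fun c hc => ?_
        rw [Finset.mem_filter, Finset.mem_inter] at hc
        by_cases hcr : c ∈ N r
        · rw [if_pos hcr, if_pos hcr, brK, if_neg fun h => hc.2 ⟨h, hcr⟩, add_zero]
        · rw [if_neg hcr, if_neg hcr]
      rw [e1, e2]
      omega
    have h2 := hN x r hxr
    rw [h1, brMC, List.length_cons]
    split_ifs with h
    · rw [h, Finset.card_empty]; omega
    · have := Finset.card_pos.mpr (Finset.nonempty_iff_ne_empty.mpr h)
      omega

theorem brW_count (N : Fin 9 → Finset (Fin 14))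
    (hN : ∀ x y, x ≠ y → (N x ∩ N y).card ≤ 1) (l : List (Fin 9)) (hl : l.Nodup) :
    brW N l + ∑ c, (brK N l c).choose 2 = ∑ c, 2 * brK N l c + l.length.choose 2 := by
  induction l with
  | nil => simp [brW, brK]
  | cons x l ih =>
    rw [List.nodup_cons] at hl
    have ih := ih hl.2
    have h0 := brMC_count N hN x l hl.1
    have h1 : ∑ c, (brK N (x :: l) c).choose 2 =
        ∑ c, (brK N l c).choose 2 + ∑ c, (if c ∈ N x then brK N l c else 0) := by
      rw [← Finset.sum_add_distrib]
      refine Finset.sum_congr rfl fun c _ => ?_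
      rw [brK]
      split_ifs
      · rw [Nat.choose_succ_succ', Nat.choose_one_right, add_comm]
      · rfl
    have h2 : ∑ c, 2 * brK N (x :: l) c = ∑ c, 2 * brK N l c + 2 * (N x).card := by
      have : (N x).card = ∑ c, if c ∈ N x then 1 else 0 := by simp
      rw [this, Finset.mul_sum, ← Finset.sum_add_distrib]
      refine Finset.sum_congr rfl fun c _ => ?_
      rw [brK, mul_add]
    have h3 : (x :: l).length.choose 2 = l.length + l.length.choose 2 := by
      rw [List.length_cons, Nat.choose_succ_succ', Nat.choose_one_right]
    rw [h1, h2, h3, brW]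
    omega

theorem brW_le (N : Fin 9 → Finset (Fin 14))
    (hN : ∀ x y, x ≠ y → (N x ∩ N y).card ≤ 1) (l : List (Fin 9)) (hl : l.Nodup)
    (h9 : l.length = 9) : brW N l ≤ 78 := by
  have h := brW_count N hN l hl
  have hk : ∀ k : ℕ, 2 * k ≤ k.choose 2 + 3 := by
    intro k
    induction k with
    | zero => simp
    | succ k ih =>
      rw [Nat.choose_succ_succ', Nat.choose_one_right]
      rcases Nat.lt_or_ge k 2 with hk | hk
      · interval_cases k <;> simp
      · change 2 * (k + 1) ≤ k + k.choose 2 + 3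
        omega
  have h1 : ∑ c, 2 * brK N l c ≤ ∑ c, ((brK N l c).choose 2 + 3) :=
    Finset.sum_le_sum fun c _ => hk _
  rw [Finset.sum_add_distrib] at h1
  simp only [Finset.sum_const, Finset.card_univ, Fintype.card_fin, smul_eq_mul] at h1
  have h2 : l.length.choose 2 = 36 := by rw [h9]; rfl
  omega

theorem brW_append (N : Fin 9 → Finset (Fin 14)) (d : ℕ) (m l : List (Fin 9))
    (hm : ∀ y ∈ m, d ≤ (N y).card) : brW N l + 2 * m.length * d ≤ brW N (m ++ l) := by
  induction m with
  | nil => simp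
  | cons y m ih =>
    have ih := ih fun y' hy => hm y' (List.mem_cons_of_mem y hy)
    have h1 := hm y List.mem_cons_self
    rw [List.cons_append, brW, List.length_cons]
    nlinarith

/-! ### The search -/

theorem brSearch_sound (N : Fin 9 → Finset (Fin 14))
    (hN : ∀ x y, x ≠ y → (N x ∩ N y).card ≤ 1)
    (H4 : ∀ S : Finset (Fin 9), S.card = 4 →
      (Finset.univ.filter fun c => ∀ x ∈ S, c ∉ N x).card ≤ 3) (rem : ℕ) :
    ∀ (l : List (Fin 9)) (gs : List (List (ℕ × ℕ))) (z dlo lo : ℕ), l.Nodup →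
      l.length + rem = 9 → brGRep N (brMask N l) l.reverse Finset.univ gs z →
      (∀ r, r ∉ l → dlo ≤ (N r).card ∧ ((N r).card = dlo → lo ≤ brMV N r l)) →
      brSearch rem l.length gs z dlo lo (brW N l) = true → False := by
  induction rem with
  | zero =>
    intro l gs z dlo lo _ _ _ _ h
    exact Bool.false_ne_true h
  | succ rem ih =>
    intro l gs z dlo lo hnd hlen hG hlo h
    -- the minimal new row
    have hcard : l.toFinset.card = l.length := List.toFinset_card_of_nodup hnd
    have hne : (Finset.univ.filter fun r : Fin 9 => r ∉ l).Nonempty := by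
      rw [Finset.nonempty_iff_ne_empty]
      intro he
      have : (Finset.univ : Finset (Fin 9)) ⊆ l.toFinset := by
        intro r _
        by_contra hr
        have : r ∈ (Finset.univ.filter fun r : Fin 9 => r ∉ l) := by
          simpa using hr
        rw [he] at this
        simp at this
      have := Finset.card_le_card this
      rw [hcard, Finset.card_univ, Fintype.card_fin] at this
      omega
    obtain ⟨r, hrm, hmin⟩ := Finset.exists_min_image _
      (fun r => (N r).card * 2 ^ l.length + brMV N r l) hne
    have hr : r ∉ l := by simpa using hrm
    have hmin' : ∀ y, y ∉ l → (N r).card ≤ (N y).card ∧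
        ((N y).card = (N r).card → brMV N r l ≤ brMV N y l) := by
      intro y hy
      have h1 := hmin y (by simpa using hy)
      have h2 := brMV_lt N y l
      constructor
      · by_contra hlt
        have h3 : ((N y).card + 1) * 2 ^ l.length ≤ (N r).card * 2 ^ l.length :=
          Nat.mul_le_mul_right _ (by omega)
        rw [add_mul, one_mul] at h3
        omega
      · intro he
        simp only [he] at h1
        omega
    have hnd' : (r :: l).Nodup := List.nodup_cons.mpr ⟨hr, hnd⟩
    -- the budget
    have hW : brW N l + 2 * (rem + 1) * (N r).card + brMC N r l ≤ 78 := by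
      let m : List (Fin 9) := (Finset.univ \ (r :: l).toFinset).toList
      have hmem : ∀ y, y ∈ m ↔ y ∉ r :: l := by
        intro y
        simp only [m, Finset.mem_toList, Finset.mem_sdiff, Finset.mem_univ, true_and,
          List.mem_toFinset]
      have hmlen : m.length = rem := by
        simp only [m, Finset.length_toList]
        rw [Finset.card_sdiff_of_subset (Finset.subset_univ _),
          List.toFinset_card_of_nodup hnd', Finset.card_univ, Fintype.card_fin, List.length_cons]
        omega
      have hmnd : (m ++ r :: l).Nodup := by
        rw [List.nodup_append]
        refine ⟨Finset.nodup_toList _, hnd', ?_⟩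
        intro a ha b hb hab
        exact (hmem a).mp ha (hab ▸ hb)
      have h1 := brW_le N hN (m ++ r :: l) hmnd (by
        rw [List.length_append, List.length_cons, hmlen]; omega)
      have h2 := brW_append N (N r).card m (r :: l) (fun y hy =>
        (hmin' y fun hy' => (hmem y).mp hy (List.mem_cons_of_mem r hy')).1)
      rw [hmlen, brW] at h2
      have h3 : 2 * (rem + 1) * (N r).card = 2 * rem * (N r).card + 2 * (N r).card := by ring
      omega
    obtain ⟨hdlo, hlo'⟩ := hlo r hr
    have hdef : brSearch (rem + 1) l.length gs z dlo lo (brW N l) =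
      brForce (2 * (rem + 1)) fun q =>
        brAll (fun e =>
          brForce (dlo + e) fun d =>
          brForce (78 - (brW N l + q * d)) fun bud =>
          brForce (Bool.rec 0 lo (Nat.beq e 0)) fun L =>
          brRec d bud L z (brLeaf l.length z d (brW N l) (brSearch rem (l.length + 1)))
            gs l.length 0 0 0 0 [])
        ((78 - brW N l) / q + 1 - dlo) := rfl
    rw [hdef, brForce_eq, brAll_iff] at h
    have he : (N r).card - dlo < (78 - brW N l) / (2 * (rem + 1)) + 1 - dlo := by
      have : (N r).card ≤ (78 - brW N l) / (2 * (rem + 1)) := by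
        rw [Nat.le_div_iff_mul_le (by omega), mul_comm]
        omega
      omega
    have h := h _ he
    simp only [brForce_eq] at h
    rw [Nat.add_sub_cancel' hdlo] at h
    have hL : (Bool.rec 0 lo (Nat.beq ((N r).card - dlo) 0) : ℕ) ≤ brMV N r l := by
      cases hb : Nat.beq ((N r).card - dlo) 0 with
      | false => exact Nat.zero_le _
      | true =>
        have := Nat.eq_of_beq_eq_true hb
        exact hlo' (by omega)
    refine brRec_sound N hN r l hr (78 - (brW N l + 2 * (rem + 1) * (N r).card)) _ z
      (brLeaf l.length z (N r).card (brW N l) (brSearch rem (l.length + 1))) (by omega) hL ?_ gs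
      l.reverse [] Finset.univ 0 []
      (by simp) hG (by simp) (by simp) (fun gs' z' h' => by simpa using h') ?_
    rotate_left
    · have h0 : (N r \ Finset.univ).card = 0 := by
        rw [Finset.sdiff_eq_empty_iff_subset.mpr (Finset.subset_univ _), Finset.card_empty]
      rw [h0, List.length_reverse]
      exact h
    intro acc a hrep hleaf
    unfold brLeaf at hleaf
    obtain ⟨gs', hgs', hforce⟩ := brForceGroups_eq (List.reverse ([(1, a)] :: acc))
    rw [hforce] at hleaf
    simp only [brForce_eq] at hleaf
    rw [List.reverse_cons] at hgs'
    have hrep' := brGRep_congr N _ _ _ _ gs' _ hgs' hrep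
    have hflat := brGRep_flat N _ _ _ _ _ hrep' (by
      intro c _ hc
      exact brMask_zero N _ c fun x hx => hc x (List.mem_reverse.mpr hx))
    have hchk : brDrop 0 ((0, Nat.sub z a) :: brFlat gs') (brCheck 3 l.length) = true := by
      obtain ⟨z', h1, h2⟩ := brDrop_eq 0 ((0, Nat.sub z a) :: brFlat gs') (brCheck 3 l.length)
      rw [h1]
      refine brCheck_sound N H4 (r :: l) hnd' 3 l.length z' {r} (by simp) (by simp) ?_ ?_
      · intro j hj h1j _ hmem
        rw [Finset.mem_singleton] at hmem
        obtain ⟨j, rfl⟩ : ∃ i, j = i + 1 := ⟨j - 1, by omega⟩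
        rw [List.getElem_cons_succ] at hmem
        exact hr (hmem ▸ List.getElem_mem _)
      · rw [h2, brExp]
        have : Multiset.replicate (Nat.sub z a) 0 + brExp (brFlat gs') =
            (Finset.univ : Finset (Fin 14)).val.map (brMask N (r :: l)) := by
          rw [hflat, add_comm]; rfl
        dsimp only
        rw [this, Multiset.filter_map]
        congr 1
        rw [← Finset.filter_val]
        congr 1
        ext c
        have hb := brMask_testBit N [] l r c
        simp only [List.nil_append, List.length_nil] at hb
        simp only [Finset.mem_filter, Finset.mem_univ, true_and, Function.comp, hb,
          Finset.mem_singleton, forall_eq, decide_eq_false_iff_not]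
    rw [hchk] at hleaf
    refine ih (r :: l) gs' (z - a) (N r).card (2 * brMV N r l) hnd'
      (by rw [List.length_cons]; omega) hrep' ?_ ?_
    · intro y hy
      rw [List.mem_cons, not_or] at hy
      obtain ⟨h1, h2⟩ := hmin' y hy.2
      refine ⟨h1, fun he => ?_⟩
      have := h2 he
      rw [brMV]
      omega
    · rw [two_mul]
      exact hleaf

theorem br_upper (h : brSearch 9 0 [] 14 0 0 0 = true) (G : Finset (Fin 9 × Fin 14)) :
    ContainsK 9 14 2 2 G ∨ ContainsK 9 14 4 4 (bipCompl 9 14 G) := by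
  by_contra hcon
  rw [not_or] at hcon
  obtain ⟨h22, h44⟩ := hcon
  have hmem : ∀ x c, c ∈ nbhd 9 14 G x ↔ (x, c) ∈ G := by
    intro x c
    simp [nbhd]
  refine brSearch_sound (nbhd 9 14 G) ?_ ?_ 9 [] [] 14 0 0 List.nodup_nil rfl ⟨rfl, rfl⟩
    (fun r _ => ⟨Nat.zero_le _, fun _ => Nat.zero_le _⟩) h
  · intro x y hxy
    by_contra hlt
    obtain ⟨B, hB, hBc⟩ := Finset.exists_subset_card_eq
      (show 2 ≤ (nbhd 9 14 G x ∩ nbhd 9 14 G y).card by omega)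
    refine h22 ⟨{x, y}, B, Finset.card_pair hxy, hBc, ?_⟩
    intro x' hx' c hc
    have := Finset.mem_inter.mp (hB hc)
    rw [hmem, hmem] at this
    rw [Finset.mem_insert, Finset.mem_singleton] at hx'
    rcases hx' with rfl | rfl
    · exact this.1
    · exact this.2
  · intro S hS
    by_contra hlt
    obtain ⟨B, hB, hBc⟩ := Finset.exists_subset_card_eq (show 4 ≤ (Finset.univ.filter
      fun c => ∀ x ∈ S, c ∉ nbhd 9 14 G x).card by omega)
    refine h44 ⟨S, B, hS, hBc, ?_⟩
    intro x hx c hc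
    have := (Finset.mem_filter.mp (hB hc)).2 x hx
    rw [hmem] at this
    simp [bipCompl, this]

/-- Rows of an extremal configuration with 13 columns. -/
def brEx : Fin 9 → Finset (Fin 13) :=
  ![{2, 4, 6, 9}, {0, 2, 3, 5}, {3, 4, 8, 10}, {1, 2, 7, 8}, {3, 6, 7, 11}, {5, 10, 12},
    {0, 1, 6, 10}, {0, 8, 9, 11}, {7, 9, 12}]

theorem brEx_two : ∀ x y, x ≠ y → (brEx x ∩ brEx y).card ≤ 1 := by decide +kernel

theorem brEx_four : ∀ a b c d : Fin 9, a < b → b < c → c < d →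
    (Finset.univ.filter fun j => j ∉ brEx a ∧ j ∉ brEx b ∧ j ∉ brEx c ∧ j ∉ brEx d).card ≤ 3 := by
  decide +kernel

theorem br_lower (n : ℕ) (hn : n ≤ 13) : ∃ G : Finset (Fin 9 × Fin n),
    ¬ ContainsK 9 n 2 2 G ∧ ¬ ContainsK 9 n 4 4 (bipCompl 9 n G) := by
  refine ⟨Finset.univ.filter fun p => Fin.castLE hn p.2 ∈ brEx p.1, ?_, ?_⟩
  · rintro ⟨A, B, hA, hB, h⟩
    obtain ⟨x, y, hxy, rfl⟩ := Finset.card_eq_two.mp hA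
    have hsub : B.map (Fin.castLEEmb hn) ⊆ brEx x ∩ brEx y := by
      intro c hc
      obtain ⟨b, hb, rfl⟩ := Finset.mem_map.mp hc
      have h1 := h x (by simp) b hb
      have h2 := h y (by simp) b hb
      rw [Finset.mem_filter] at h1 h2
      exact Finset.mem_inter.mpr ⟨h1.2, h2.2⟩
    have h1 := Finset.card_le_card hsub
    rw [Finset.card_map, hB] at h1
    have := brEx_two x y hxy
    omega
  · rintro ⟨A, B, hA, hB, h⟩
    let e := A.orderEmbOfFin hA
    have hsub : B.map (Fin.castLEEmb hn) ⊆ Finset.univ.filter fun j =>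
        j ∉ brEx (e 0) ∧ j ∉ brEx (e 1) ∧ j ∉ brEx (e 2) ∧ j ∉ brEx (e 3) := by
      intro c hc
      obtain ⟨b, hb, rfl⟩ := Finset.mem_map.mp hc
      have h1 : ∀ i, Fin.castLEEmb hn b ∉ brEx (e i) := by
        intro i hi
        have := h (e i) (A.orderEmbOfFin_mem hA i) b hb
        simp only [bipCompl, Finset.mem_sdiff, Finset.mem_filter, Finset.mem_univ, true_and] at this
        exact this hi
      simp only [Finset.mem_filter, Finset.mem_univ, true_and]
      exact ⟨h1 0, h1 1, h1 2, h1 3⟩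
    have h1 := Finset.card_le_card hsub
    rw [Finset.card_map, hB] at h1
    have := brEx_four (e 0) (e 1) (e 2) (e 3) (e.strictMono (by decide))
      (e.strictMono (by decide)) (e.strictMono (by decide))
    omega

theorem brSearch_true : brSearch 9 0 [] 14 0 0 0 = true := by decide +kernel

/-- BR_9(K_{2,2}, K_{4,4}) = 14. -/
theorem br_9_eq_14 :
    IsLeast {n : ℕ | 0 < n ∧ ∀ G : Finset (Fin 9 × Fin n),
      ContainsK 9 n 2 2 G ∨ ContainsK 9 n 4 4 (bipCompl 9 n G)} 14 := by
  constructor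
  · exact ⟨by norm_num, br_upper brSearch_true⟩
  · rintro n ⟨_, hn⟩
    by_contra hlt
    obtain ⟨G, h1, h2⟩ := br_lower n (by omega)
    rcases hn G with h | h
    · exact h1 h
    · exact h2 h
end

section
/- For every m with 10 ≤ m ≤ 13, 14 is the least positive integer n such that every subgraph G of the complete bipartite graph K_{m,n} contains K_{2,2} or the bipartite complement of G contains K_{4,4}; that is, BR_m(K_{2,2}, K_{4,4}) = 14 for each m ∈ {10, 11, 12, 13}. -/
set_option linter.all false
def kern (x : ℕ) : ℕ := Nat.land x (Nat.sub x (nat_lit 1))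
noncomputable def isNZ (x : ℕ) : Bool := Nat.ble (nat_lit 1) x
noncomputable def allR (p : ℕ → Bool) (l : List ℕ) : Bool :=
  List.rec (motive := fun _ => Bool) true (fun a _ ih => Bool.rec (motive := fun _ => Bool) false ih (p a)) l
noncomputable def filterR (p : ℕ → Bool) (l : List ℕ) : List ℕ :=
  List.rec (motive := fun _ => List ℕ) [] (fun a _ ih => Bool.rec (motive := fun _ => List ℕ) ih (a :: ih) (p a)) l
noncomputable def mapApp (f : ℕ → ℕ) (l r : List ℕ) : List ℕ :=
  List.rec (motive := fun _ => List ℕ) r (fun a _ ih => f a :: ih) l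
def canonOk (U v : ℕ) : Bool := Nat.beq (Nat.land (Nat.land v (Nat.xor (nat_lit 16383) (Nat.shiftRight v (nat_lit 1)))) U) (nat_lit 0)
def okT (T w : ℕ) : Bool := Nat.beq (kern (kern (kern (Nat.xor (Nat.lor T w) w)))) (nat_lit 0)
noncomputable def okNext (v : ℕ) (Ts : List ℕ) (w : ℕ) : Bool :=
  Bool.rec (motive := fun _ => Bool) false (allR (fun T => okT T w) Ts) (Nat.beq (kern (Nat.land v w)) (nat_lit 0))
/-- singles: rows, pairs : complements of unions of pairs -/
noncomputable def search (n : ℕ) : List ℕ → List ℕ → ℕ → List ℕ → Bool :=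
  Nat.rec (motive := fun _ => List ℕ → List ℕ → ℕ → List ℕ → Bool) (fun _ _ _ _ => false)
   (fun _ ih rows prs U cands =>
     List.rec (motive := fun _ => Bool) true (fun v tl rest =>
       Bool.rec (motive := fun _ => Bool) rest
         (Bool.rec (motive := fun _ => Bool) false rest
           (ih (v :: rows) (mapApp (fun r => Nat.xor (nat_lit 16383) (Nat.lor r v)) rows prs)
             (Nat.land U (Nat.xor (nat_lit 16383) (Nat.xor v (Nat.shiftRight v (nat_lit 1)))))
             (filterR (okNext v (filterR (fun T => isNZ (kern (kern (kern T)))) (mapApp (fun T => Nat.xor (Nat.lor T v) v) prs []))) (v :: tl)) ))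
         (canonOk U v)) cands) n
noncomputable def downR (n : ℕ) : List ℕ := Nat.rec (motive := fun _ => List ℕ) [] (fun k ih => k :: ih) n
noncomputable def cands0 : List ℕ := filterR (fun v => Nat.beq (kern (kern (kern (kern v)))) (nat_lit 0)) (downR (nat_lit 16384))
theorem search_true : search (nat_lit 8) [] [] (nat_lit 8191) cands0 = true := by decide +kernel

theorem kern_lt {x : ℕ} (hx : x ≠ 0) : kern x < x := by
  have : kern x ≤ x - 1 := Nat.and_le_right
  omega

theorem kern_bit {x j : ℕ} (h : (kern x).testBit j = true) : x.testBit j = true := by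
  have h' : (x &&& (x - 1)).testBit j = true := h
  rw [Nat.testBit_and] at h'
  simp at h'
  exact h'.1

/-- the positions below 14 of the bits of a number. -/
def bitset (x : ℕ) : Finset (Fin 14) := Finset.univ.filter fun j => x.testBit j = true

theorem mem_bitset {x : ℕ} {j : Fin 14} : j ∈ bitset x ↔ x.testBit j = true := by
  simp [bitset]

theorem bitset_nonempty {x : ℕ} (hx : x < 2 ^ 14) (h : x ≠ 0) : (bitset x).Nonempty := by
  by_contra hne
  apply h
  apply Nat.eq_of_testBit_eq
  intro i
  rw [Nat.zero_testBit]
  by_cases hi : i < 14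
  · rw [Finset.not_nonempty_iff_eq_empty] at hne
    by_contra hb
    have : (⟨i, hi⟩ : Fin 14) ∈ bitset x := mem_bitset.2 (by simpa using hb)
    rw [hne] at this
    simp at this
  · exact Nat.testBit_lt_two_pow (lt_of_lt_of_le hx (Nat.pow_le_pow_right (by norm_num) (by omega)))

theorem kern_le (x : ℕ) : kern x ≤ x := Nat.and_le_left

theorem card_kern {x : ℕ} (hx : x < 2 ^ 14) (h : x ≠ 0) :
    (bitset (kern x)).card + 1 ≤ (bitset x).card := by
  apply Finset.card_lt_card
  refine ⟨fun j hj => mem_bitset.2 (kern_bit (mem_bitset.1 hj)), fun hsub => ?_⟩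
  have : kern x = x := by
    apply Nat.eq_of_testBit_eq
    intro i
    by_cases hi : i < 14
    · by_cases hb : x.testBit i = true
      · rw [hb]
        exact mem_bitset.1 (hsub (mem_bitset.2 hb : (⟨i, hi⟩ : Fin 14) ∈ bitset x))
      · have : ¬ (kern x).testBit i = true := fun h' => hb (kern_bit h')
        simp at this hb
        rw [this, hb]
    · have h2 : (2:ℕ) ^ 14 ≤ 2 ^ i := Nat.pow_le_pow_right (by norm_num) (by omega)
      rw [Nat.testBit_lt_two_pow (lt_of_lt_of_le hx h2),
        Nat.testBit_lt_two_pow (lt_of_le_of_lt (kern_le x) (lt_of_lt_of_le hx h2))]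
  have := kern_lt h
  omega

theorem kern_zero : kern 0 = 0 := by decide

theorem kern_iter {k : ℕ} : ∀ {x : ℕ}, x < 2 ^ 14 → (bitset x).card ≤ k → kern^[k] x = 0 := by
  induction k with
  | zero =>
    intro x hx h
    by_contra hne
    have := (bitset_nonempty hx hne).card_pos
    omega
  | succ k ih =>
    intro x hx h
    rw [Function.iterate_succ_apply]
    by_cases h0 : x = 0
    · subst h0
      rw [kern_zero]
      exact ih (by norm_num) (by simp [bitset])
    · exact ih (lt_of_le_of_lt (kern_le x) hx) (by have := card_kern hx h0; omega)

theorem allR_eq_true {p : ℕ → Bool} {l : List ℕ} (h : ∀ a ∈ l, p a = true) : allR p l = true := by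
  induction l with
  | nil => rfl
  | cons a l ih =>
    have h1 : allR p (a :: l) = Bool.rec (motive := fun _ => Bool) false (allR p l) (p a) := rfl
    rw [h1, h a (by simp), ih (fun b hb => h b (by simp [hb]))]

theorem mem_filterR {p : ℕ → Bool} {l : List ℕ} {x : ℕ} :
    x ∈ filterR p l ↔ x ∈ l ∧ p x = true := by
  induction l with
  | nil => simp [filterR]
  | cons a l ih =>
    have h1 : filterR p (a :: l) =
      Bool.rec (motive := fun _ => List ℕ) (filterR p l) (a :: filterR p l) (p a) := rfl
    rw [h1]
    cases hp : p a
    · simp only [ih, List.mem_cons]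
      constructor
      · rintro ⟨h, h'⟩; exact ⟨Or.inr h, h'⟩
      · rintro ⟨rfl | h, h'⟩
        · rw [hp] at h'; cases h'
        · exact ⟨h, h'⟩
    · simp only [ih, List.mem_cons]
      constructor
      · rintro (rfl | ⟨h, h'⟩)
        · exact ⟨Or.inl rfl, hp⟩
        · exact ⟨Or.inr h, h'⟩
      · rintro ⟨rfl | h, h'⟩
        · exact Or.inl rfl
        · exact Or.inr ⟨h, h'⟩

theorem pairwise_filterR {p : ℕ → Bool} {l : List ℕ} (h : l.Pairwise (· ≥ ·)) :
    (filterR p l).Pairwise (· ≥ ·) := by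
  induction l with
  | nil => exact List.Pairwise.nil
  | cons a l ih =>
    have h1 : filterR p (a :: l) =
      Bool.rec (motive := fun _ => List ℕ) (filterR p l) (a :: filterR p l) (p a) := rfl
    rw [List.pairwise_cons] at h
    rw [h1]
    cases p a
    · exact ih h.2
    · exact List.pairwise_cons.2 ⟨fun b hb => h.1 b (mem_filterR.1 hb).1, ih h.2⟩

theorem mem_mapApp {f : ℕ → ℕ} {l r : List ℕ} {x : ℕ} :
    x ∈ mapApp f l r ↔ (∃ a ∈ l, f a = x) ∨ x ∈ r := by
  induction l with
  | nil => simp [mapApp]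
  | cons a l ih =>
    have h1 : mapApp f (a :: l) r = f a :: mapApp f l r := rfl
    rw [h1, List.mem_cons, ih]
    simp [or_assoc, eq_comm]

theorem mem_downR {n x : ℕ} : x ∈ downR n ↔ x < n := by
  induction n with
  | zero => simp [downR]
  | succ n ih =>
    have h1 : downR (n + 1) = n :: downR n := rfl
    rw [h1, List.mem_cons, ih]
    omega

theorem pairwise_downR {n : ℕ} : (downR n).Pairwise (· ≥ ·) := by
  induction n with
  | zero => exact List.Pairwise.nil
  | succ n ih =>
    have h1 : downR (n + 1) = n :: downR n := rfl
    rw [h1]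
    exact List.pairwise_cons.2 ⟨fun b hb => (mem_downR.1 hb).le, ih⟩

theorem search_cons (n : ℕ) (rows prs : List ℕ) (U v : ℕ) (tl : List ℕ) :
    search (n + 1) rows prs U (v :: tl) =
      Bool.rec (motive := fun _ => Bool) (search (n + 1) rows prs U tl)
         (Bool.rec (motive := fun _ => Bool) false (search (n + 1) rows prs U tl)
           (search n (v :: rows)
             (mapApp (fun r => Nat.xor (nat_lit 16383) (Nat.lor r v)) rows prs)
             (Nat.land U (Nat.xor (nat_lit 16383) (Nat.xor v (Nat.shiftRight v (nat_lit 1)))))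
             (filterR (okNext v (filterR (fun T => isNZ (kern (kern (kern T))))
               (mapApp (fun T => Nat.xor (Nat.lor T v) v) prs []))) (v :: tl))))
         (canonOk U v) := rfl

theorem testBit_16383 (j : ℕ) : (16383 : ℕ).testBit j = decide (j < 14) := by
  have : (16383 : ℕ) = 2 ^ 14 - 1 := by norm_num
  rw [this, Nat.testBit_two_pow_sub_one]

theorem bit_T (a b v w j : ℕ) (ha : a.testBit j = true → j < 14)
    (h : (((((16383 ^^^ (a ||| b)) ||| v) ^^^ v) ||| w) ^^^ w).testBit j = true)
    (hb : b.testBit j = true → j < 14) :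
    j < 14 ∧ a.testBit j = false ∧ b.testBit j = false ∧ v.testBit j = false ∧
      w.testBit j = false := by
  simp only [Nat.testBit_xor, Nat.testBit_or, testBit_16383] at h
  by_cases hj : j < 14
  · simp only [hj, decide_true, true_and] at h ⊢
    cases hA : a.testBit j <;> cases hB : b.testBit j <;> cases hV : v.testBit j <;>
      cases hW : w.testBit j <;> simp [hA, hB, hV, hW] at h ⊢
  · exfalso
    have hA : a.testBit j = false := by
      by_contra hc; exact hj (ha (by simpa using hc))
    have hB : b.testBit j = false := by
      by_contra hc; exact hj (hb (by simpa using hc))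
    cases hV : v.testBit j <;> cases hW : w.testBit j <;> simp [hA, hB, hV, hW, hj] at h

/-- What the search excludes: eight rows, as bit masks. -/
structure GoodSeq (c : ℕ → ℕ) : Prop where
  lt : ∀ i, i < 8 → c i < 2 ^ 14
  deg : ∀ i, i < 8 → (bitset (c i)).card ≤ 4
  anti : ∀ i j, i < j → j < 8 → c j ≤ c i
  pair : ∀ i j, i < j → j < 8 → (bitset (c i &&& c j)).card ≤ 1
  quad : ∀ i j k l, i < j → j < k → k < l → l < 8 → ∀ B : Finset (Fin 14),
    (∀ y ∈ B, (c i).testBit y = false ∧ (c j).testBit y = false ∧ (c k).testBit y = false ∧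
      (c l).testBit y = false) → B.card ≤ 3
  canon : ∀ i p, i < 8 → p < 13 →
    (∀ i', i' < i → (c i').testBit p = (c i').testBit (p + 1)) →
    (c i).testBit p = true → (c i).testBit (p + 1) = true

theorem GoodSeq.bit_lt {c : ℕ → ℕ} (hc : GoodSeq c) {i j : ℕ} (hi : i < 8)
    (h : (c i).testBit j = true) : j < 14 := by
  by_contra hj
  have h2 : (2:ℕ) ^ 14 ≤ 2 ^ j := Nat.pow_le_pow_right (by norm_num) (by omega)
  rw [Nat.testBit_lt_two_pow (lt_of_lt_of_le (hc.lt i hi) h2)] at h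
  cases h

theorem GoodSeq.canonOk {c : ℕ → ℕ} (hc : GoodSeq c) {k U : ℕ} (hk : k < 8)
    (hU : ∀ p, U.testBit p = true → p < 13 ∧ ∀ i, i < k → (c i).testBit p = (c i).testBit (p + 1)) :
    canonOk U (c k) = true := by
  have h : (((c k) &&& (16383 ^^^ ((c k) >>> 1))) &&& U) = 0 := by
    apply Nat.eq_of_testBit_eq
    intro p
    rw [Nat.zero_testBit]
    by_contra hb
    simp only [Nat.testBit_and, Nat.testBit_xor, Nat.testBit_shiftRight, testBit_16383,
      Bool.not_eq_false, Bool.and_eq_true] at hb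
    obtain ⟨⟨h1, h2⟩, h3⟩ := hb
    obtain ⟨hp, h4⟩ := hU p h3
    have h5 := hc.canon k p hk hp h4 h1
    rw [Nat.add_comm 1 p, h5] at h2
    have : p < 14 := by omega
    simp [this] at h2
  unfold _root_.canonOk
  rw [Nat.beq_eq]
  exact h

theorem GoodSeq.okNext {c : ℕ → ℕ} (hc : GoodSeq c) {k l : ℕ} (hkl : k < l) (hl : l < 8)
    {prs : List ℕ}
    (hprs : ∀ T ∈ prs, ∃ i j, i < j ∧ j < k ∧ T = 16383 ^^^ (c i ||| c j)) :
    okNext (c k) (filterR (fun T => isNZ (kern (kern (kern T))))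
      (mapApp (fun T => Nat.xor (Nat.lor T (c k)) (c k)) prs [])) (c l) = true := by
  have h1 : Nat.beq (kern (Nat.land (c k) (c l))) 0 = true := by
    rw [Nat.beq_eq]
    exact kern_iter (k := 1) (lt_of_le_of_lt Nat.and_le_left (hc.lt k (by omega)))
      (hc.pair k l hkl hl)
  unfold _root_.okNext
  rw [h1]
  apply allR_eq_true
  intro T hT
  obtain ⟨hT, -⟩ := mem_filterR.1 hT
  rcases mem_mapApp.1 hT with ⟨P, hP, rfl⟩ | h
  swap
  · simp at h
  obtain ⟨i, j, hij, hjk, rfl⟩ := hprs P hP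
  unfold okT
  rw [Nat.beq_eq]
  have key : ∀ b, (((((16383 ^^^ (c i ||| c j)) ||| c k) ^^^ c k) ||| c l) ^^^ c l).testBit b = true →
      _ := fun b hb => bit_T (c i) (c j) (c k) (c l) b (hc.bit_lt (by omega)) hb
        (hc.bit_lt (by omega))
  refine kern_iter (k := 3) (x := ((((16383 ^^^ (c i ||| c j)) ||| c k) ^^^ c k) ||| c l) ^^^ c l)
    ?_ ?_
  · apply Nat.lt_pow_two_of_testBit
    intro b hb
    by_contra hcon
    have := (key b (by simpa using hcon)).1
    omega
  · apply hc.quad i j k l hij hjk hkl hl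
    intro y hy
    exact (key y (mem_bitset.1 hy)).2

theorem search_sound {c : ℕ → ℕ} (hc : GoodSeq c) : ∀ (n k : ℕ), k + n = 8 →
    ∀ (rows prs : List ℕ) (U : ℕ) (cands : List ℕ),
      (∀ r ∈ rows, ∃ i, i < k ∧ r = c i) →
      (∀ T ∈ prs, ∃ i j, i < j ∧ j < k ∧ T = 16383 ^^^ (c i ||| c j)) →
      (∀ p, U.testBit p = true → p < 13 ∧ ∀ i, i < k → (c i).testBit p = (c i).testBit (p + 1)) →
      cands.Pairwise (· ≥ ·) → (∀ j, k ≤ j → j < 8 → c j ∈ cands) →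
      search n rows prs U cands = false := by
  intro n
  induction n with
  | zero => intros; rfl
  | succ n ih =>
    intro k hk rows prs U cands hrows hprs hU
    induction cands with
    | nil =>
      intro _ hmem
      have := hmem k le_rfl (by omega)
      simp at this
    | cons v tl ihl =>
      intro hs hmem
      rw [search_cons]
      by_cases hv : v = c k
      · rw [hv, hc.canonOk (by omega) hU]
        rw [ih (k + 1) (by omega)]
        · intro r hr
          rcases List.mem_cons.1 hr with rfl | hr
          · exact ⟨k, by omega, rfl⟩
          · obtain ⟨i, hi, h⟩ := hrows r hr
            exact ⟨i, by omega, h⟩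
        · intro T hT
          rcases mem_mapApp.1 hT with ⟨a, ha, rfl⟩ | hT
          · obtain ⟨i, hi, rfl⟩ := hrows a ha
            exact ⟨i, k, hi, by omega, rfl⟩
          · obtain ⟨i, j, h1, h2, h3⟩ := hprs T hT
            exact ⟨i, j, h1, by omega, h3⟩
        · intro p hp
          have hp' : (U &&& (16383 ^^^ (c k ^^^ (c k >>> 1)))).testBit p = true := hp
          simp only [Nat.testBit_and, Nat.testBit_xor, Nat.testBit_shiftRight, testBit_16383,
            Bool.and_eq_true] at hp'
          obtain ⟨h1, h2⟩ := hp'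
          obtain ⟨h3, h4⟩ := hU p h1
          refine ⟨h3, fun i hi => ?_⟩
          by_cases hik : i < k
          · exact h4 i hik
          · have : i = k := by omega
            subst this
            have h14 : p < 14 := by omega
            rw [Nat.add_comm 1 p] at h2
            cases hA : (c i).testBit p <;> cases hB : (c i).testBit (p + 1) <;>
              simp [hA, hB, h14] at h2 ⊢
        · exact pairwise_filterR (hv ▸ hs)
        · intro j h1 h2
          rw [mem_filterR]
          exact ⟨hv ▸ hmem j (by omega) h2, hc.okNext (by omega) h2 hprs⟩
      · have hrest : search (n + 1) rows prs U tl = false := by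
          apply ihl (List.pairwise_cons.1 hs).2
          have hk1 : c k ∈ tl := by
            rcases List.mem_cons.1 (hmem k le_rfl (by omega)) with h | h
            · exact absurd h.symm hv
            · exact h
          have hlt : c k < v := lt_of_le_of_ne ((List.pairwise_cons.1 hs).1 _ hk1) (Ne.symm hv)
          intro j h1 h2
          rcases List.mem_cons.1 (hmem j h1 h2) with h | h
          · exfalso
            rcases h1.lt_or_eq with h3 | h3
            · have := hc.anti k j h3 h2
              omega
            · subst h3; omega
          · exact h
        rw [hrest]
        generalize canonOk U v = b1
        generalize search n _ _ _ _ = b2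
        cases b1 <;> cases b2 <;> rfl

theorem no_goodSeq (c : ℕ → ℕ) (hc : GoodSeq c) : False := by
  have h := search_sound hc 8 0 rfl [] [] 8191 cands0 (by simp) (by simp) ?_ ?_ ?_
  · have h2 := search_true
    rw [show search (nat_lit 8) [] [] (nat_lit 8191) cands0 = search 8 [] [] 8191 cands0 from rfl,
      h] at h2
    cases h2
  · intro p hp
    have : (8191 : ℕ) = 2 ^ 13 - 1 := by norm_num
    rw [this, Nat.testBit_two_pow_sub_one] at hp
    exact ⟨by simpa using hp, fun i hi => by omega⟩
  · exact pairwise_filterR pairwise_downR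
  · intro j _ hj
    unfold cands0
    rw [mem_filterR, mem_downR]
    refine ⟨hc.lt j hj, ?_⟩
    rw [Nat.beq_eq]
    exact kern_iter (k := 4) (hc.lt j hj) (hc.deg j hj)

theorem no_eight_small_rows (r : Fin 8 → Finset (Fin 14)) (hdeg : ∀ i, (r i).card ≤ 4)
    (hp : ∀ i j, i ≠ j → (r i ∩ r j).card ≤ 1)
    (hq : ∀ a b c d, a ≠ b → a ≠ c → a ≠ d → b ≠ c → b ≠ d → c ≠ d →
      ((r a ∪ r b ∪ r c ∪ r d)ᶜ).card ≤ 3) : False := by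
  classical
  let g : Equiv.Perm (Fin 14) → Fin 8 → ℕ := fun τ a =>
    Nat.ofBits (fun j : Fin 14 => decide (τ j ∈ r a))
  let code : Equiv.Perm (Fin 8) → Equiv.Perm (Fin 14) → Fin 8 → ℕ := fun σ τ i => g τ (σ i)
  obtain ⟨⟨σ, τ⟩, hmax⟩ := Finite.exists_max
    (fun p : Equiv.Perm (Fin 8) × Equiv.Perm (Fin 14) => toLex (code p.1 p.2))
  have hmax' : ∀ σ' τ', ¬ ∃ i, (∀ j, j < i → code σ τ j = code σ' τ' j) ∧
      code σ τ i < code σ' τ' i := by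
    intro σ' τ' h
    exact absurd (hmax (σ', τ')) (not_le_of_gt h)
  have hbit : ∀ σ τ i (j : ℕ) (hj : j < 14),
      (code σ τ i).testBit j = decide (τ ⟨j, hj⟩ ∈ r (σ i)) := by
    intro σ τ i j hj
    exact Nat.testBit_ofBits_lt _ j hj
  have hbit' : ∀ σ τ i (j : Fin 14),
      (code σ τ i).testBit j = decide (τ j ∈ r (σ i)) := by
    intro σ τ i j
    exact hbit σ τ i j j.2
  have hlt : ∀ σ τ i, code σ τ i < 2 ^ 14 := fun σ τ i => Nat.ofBits_lt_two_pow _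
  have hcard : ∀ (x : ℕ) (s : Finset (Fin 14)),
      (∀ j : Fin 14, x.testBit j = true → τ j ∈ s) → (bitset x).card ≤ s.card := by
    intro x s h
    rw [← Finset.card_map τ.toEmbedding]
    apply Finset.card_le_card
    intro y hy
    obtain ⟨j, hj, rfl⟩ := Finset.mem_map.1 hy
    exact h j (mem_bitset.1 hj)
  let c : ℕ → ℕ := fun i => if h : i < 8 then code σ τ ⟨i, h⟩ else 0
  have hc : ∀ i (h : i < 8), c i = code σ τ ⟨i, h⟩ := fun i h => dif_pos h
  apply no_goodSeq c
  constructor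
  · intro i hi
    rw [hc i hi]
    exact hlt _ _ _
  · intro i hi
    rw [hc i hi]
    refine (hcard _ (r (σ ⟨i, hi⟩)) ?_).trans (hdeg _)
    intro j hj
    rw [hbit'] at hj
    simpa using hj
  · intro i j hij hj
    rw [hc i (by omega), hc j hj]
    by_contra hcon
    push Not at hcon
    have hlt' : (⟨i, by omega⟩ : Fin 8) < ⟨j, hj⟩ := hij
    apply hmax' ((Equiv.swap ⟨i, by omega⟩ ⟨j, hj⟩).trans σ) τ
    refine ⟨⟨i, by omega⟩, fun k hk => ?_, ?_⟩
    · change g τ (σ k) = g τ (σ (Equiv.swap ⟨i, by omega⟩ ⟨j, hj⟩ k))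
      rw [Equiv.swap_apply_of_ne_of_ne hk.ne (hk.trans hlt').ne]
    · refine lt_of_lt_of_eq hcon ?_
      change g τ (σ ⟨j, hj⟩) = g τ (σ (Equiv.swap ⟨i, by omega⟩ ⟨j, hj⟩ ⟨i, by omega⟩))
      rw [Equiv.swap_apply_left]
  · intro i j hij hj
    rw [hc i (by omega), hc j hj]
    have hne : σ ⟨i, by omega⟩ ≠ σ ⟨j, hj⟩ := by
      intro h
      have := congrArg Fin.val (σ.injective h)
      simp at this
      omega
    refine (hcard _ _ ?_).trans (hp _ _ hne)
    intro y hy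
    rw [Nat.testBit_and, hbit', hbit'] at hy
    simpa using hy
  · intro i j k l hij hjk hkl hl B hB
    rw [hc i (by omega), hc j (by omega), hc k (by omega), hc l hl] at hB
    have hne : ∀ a b (ha : a < 8) (hb : b < 8), a < b → σ ⟨a, ha⟩ ≠ σ ⟨b, hb⟩ := by
      intro a b ha hb hab h
      have := congrArg Fin.val (σ.injective h)
      simp at this
      omega
    have := hq (σ ⟨i, by omega⟩) (σ ⟨j, by omega⟩) (σ ⟨k, by omega⟩) (σ ⟨l, hl⟩)
      (hne _ _ _ _ (by omega)) (hne _ _ _ _ (by omega)) (hne _ _ _ _ (by omega))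
      (hne _ _ _ _ (by omega)) (hne _ _ _ _ (by omega)) (hne _ _ _ _ (by omega))
    refine le_trans ?_ this
    rw [← Finset.card_map τ.toEmbedding]
    apply Finset.card_le_card
    intro y hy
    obtain ⟨z, hz, rfl⟩ := Finset.mem_map.1 hy
    have := hB z hz
    rw [hbit', hbit', hbit', hbit'] at this
    simpa [not_or, and_assoc] using this
  · intro i p hi hp13 hprev hb
    by_contra hcon
    rw [hc i hi] at hb hcon
    have hp1 : p < 14 := by omega
    have hp2 : p + 1 < 14 := by omega
    let s : Equiv.Perm (Fin 14) := Equiv.swap ⟨p, hp1⟩ ⟨p + 1, hp2⟩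
    apply hmax' σ (s.trans τ)
    have hother : ∀ (k : Fin 8) (j : ℕ), j ≠ p → j ≠ p + 1 →
        (code σ (s.trans τ) k).testBit j = (code σ τ k).testBit j := by
      intro k j h1 h2
      by_cases hj : j < 14
      · rw [hbit _ _ _ _ hj, hbit _ _ _ _ hj]
        have : s ⟨j, hj⟩ = ⟨j, hj⟩ := by
          apply Equiv.swap_apply_of_ne_of_ne
          · simpa using h1
          · simpa using h2
        rw [Equiv.trans_apply, this]
      · have h2 : (2:ℕ) ^ 14 ≤ 2 ^ j := Nat.pow_le_pow_right (by norm_num) (by omega)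
        rw [Nat.testBit_lt_two_pow (lt_of_lt_of_le (hlt _ _ _) h2),
          Nat.testBit_lt_two_pow (lt_of_lt_of_le (hlt _ _ _) h2)]
    have hat1 : ∀ k : Fin 8,
        (code σ (s.trans τ) k).testBit p = (code σ τ k).testBit (p + 1) := by
      intro k
      rw [hbit _ _ _ _ hp1, hbit _ _ _ _ hp2, Equiv.trans_apply, Equiv.swap_apply_left]
    have hat2 : ∀ k : Fin 8,
        (code σ (s.trans τ) k).testBit (p + 1) = (code σ τ k).testBit p := by
      intro k
      rw [hbit _ _ _ _ hp1, hbit _ _ _ _ hp2, Equiv.trans_apply, Equiv.swap_apply_right]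
    refine ⟨⟨i, hi⟩, fun k hk => ?_, ?_⟩
    · have hk' := hprev k hk
      rw [hc k k.2] at hk'
      apply Nat.eq_of_testBit_eq
      intro j
      by_cases h1 : j = p
      · subst h1
        rw [hat1]
        exact hk'
      · by_cases h2 : j = p + 1
        · subst h2
          rw [hat2]
          exact hk'.symm
        · rw [hother k j h1 h2]
    · apply Nat.lt_of_testBit (p + 1)
      · simpa using hcon
      · rw [hat2]; exact hb
      · intro j hj
        rw [hother _ j (by omega) (by omega)]

/-- Incidence in the projective plane of order 3, from the difference set {0,1,3,9} mod 13
(523 is the bit mask of that set). -/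
def incid (x y : ℕ) : Bool := Nat.testBit 523 ((x + y) % 13)

/-- The lines through both points `a`, `b`. -/
def commonLines (a b : ℕ) : List ℕ := (List.range 13).filter fun y => incid a y && incid b y

/-- The lines through none of the four points. -/
def missedLines (a b c d : ℕ) : List ℕ :=
  (List.range 13).filter fun y => !(incid a y || (incid b y || (incid c y || incid d y)))

theorem commonLines_le : ∀ b < 13, ∀ a < b, (commonLines a b).length ≤ 1 := by
  decide +kernel

theorem missedLines_le : ∀ d < 13, ∀ c < d, ∀ b < c, ∀ a < b,
    (missedLines a b c d).length ≤ 3 := by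
  decide +kernel

/-- The part of the plane spanned by the first `m` points and the first `n` lines. -/
def planeGraph (m n : ℕ) : Finset (Fin m × Fin n) :=
  Finset.univ.filter fun p => incid p.1 p.2 = true

theorem card_le_of_list {n : ℕ} (B : Finset (Fin n)) (l : List ℕ)
    (h : ∀ y ∈ B, (y : ℕ) ∈ l) : B.card ≤ l.length := by
  calc B.card = (B.map Fin.valEmbedding).card := (Finset.card_map _).symm
    _ ≤ l.toFinset.card := by
      apply Finset.card_le_card
      intro z hz
      obtain ⟨y, hy, rfl⟩ := Finset.mem_map.1 hz
      exact List.mem_toFinset.2 (h y hy)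
    _ ≤ l.length := List.toFinset_card_le l

theorem planeGraph_no_K22 (m n : ℕ) (hm : m ≤ 13) (hn : n ≤ 13) :
    ¬ ContainsK m n 2 2 (planeGraph m n) := by
  rintro ⟨A, B, hA, hB, h⟩
  let e := A.orderEmbOfFin hA
  have hmem : ∀ i, e i ∈ A := fun i => A.orderEmbOfFin_mem hA i
  have h01 : e 0 < e 1 := e.strictMono (by decide)
  have hle := commonLines_le (e 1) (by omega) (e 0) h01
  have : B.card ≤ (commonLines (e 0) (e 1)).length := by
    apply card_le_of_list
    intro y hy
    have h0 := h _ (hmem 0) y hy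
    have h1 := h _ (hmem 1) y hy
    simp only [planeGraph, Finset.mem_filter, Finset.mem_univ, true_and] at h0 h1
    simp only [commonLines, List.mem_filter, List.mem_range, h0, h1]
    exact ⟨by omega, rfl⟩
  omega

theorem planeGraph_no_K44 (m n : ℕ) (hm : m ≤ 13) (hn : n ≤ 13) :
    ¬ ContainsK m n 4 4 (bipCompl m n (planeGraph m n)) := by
  rintro ⟨A, B, hA, hB, h⟩
  let e := A.orderEmbOfFin hA
  have hmem : ∀ i, e i ∈ A := fun i => A.orderEmbOfFin_mem hA i
  have h01 : e 0 < e 1 := e.strictMono (by decide)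
  have h12 : e 1 < e 2 := e.strictMono (by decide)
  have h23 : e 2 < e 3 := e.strictMono (by decide)
  have hle := missedLines_le (e 3) (by omega) (e 2) h23 (e 1) h12 (e 0) h01
  have : B.card ≤ (missedLines (e 0) (e 1) (e 2) (e 3)).length := by
    apply card_le_of_list
    intro y hy
    have h0 := h _ (hmem 0) y hy
    have h1 := h _ (hmem 1) y hy
    have h2 := h _ (hmem 2) y hy
    have h3 := h _ (hmem 3) y hy
    simp only [bipCompl, planeGraph, Finset.mem_sdiff, Finset.mem_filter, Finset.mem_univ,
      true_and, Bool.not_eq_true] at h0 h1 h2 h3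
    simp only [missedLines, List.mem_filter, List.mem_range, h0, h1, h2, h3]
    exact ⟨by omega, rfl⟩
  omega

section BigRow

/-- The standing hypotheses on the ten rows. -/
structure Rows (r : Fin 10 → Finset (Fin 14)) : Prop where
  pair : ∀ i j, i ≠ j → (r i ∩ r j).card ≤ 1
  quad : ∀ a b c d, a ≠ b → a ≠ c → a ≠ d → b ≠ c → b ≠ d → c ≠ d →
      ((r a ∪ r b ∪ r c ∪ r d)ᶜ).card ≤ 3

variable {r : Fin 10 → Finset (Fin 14)}

theorem Rows.split (hr : Rows r) (X : Finset (Fin 14)) {a b c d : Fin 10}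
    (hab : a ≠ b) (hac : a ≠ c) (had : a ≠ d) (hbc : b ≠ c) (hbd : b ≠ d) (hcd : c ≠ d) :
    X.card + (Xᶜ \ (r a ∪ r b ∪ r c ∪ r d)).card ≤
      3 + ((r a ∩ X) ∪ (r b ∩ X) ∪ (r c ∩ X) ∪ (r d ∩ X)).card := by
  have h1 := hr.quad a b c d hab hac had hbc hbd hcd
  set W := r a ∪ r b ∪ r c ∪ r d with hW
  have h2 : (r a ∩ X) ∪ (r b ∩ X) ∪ (r c ∩ X) ∪ (r d ∩ X) = X ∩ W := by
    ext y; simp [hW]; tauto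
  have h3 : Wᶜ = (X \ W) ∪ (Xᶜ \ W) := by
    ext y; simp; tauto
  have h4 : Disjoint (X \ W) (Xᶜ \ W) := by
    rw [Finset.disjoint_left]; intro y; simp +contextual
  rw [h3, Finset.card_union_of_disjoint h4] at h1
  rw [h2]
  have := Finset.card_sdiff_add_card_inter X W
  omega

/-- The traces of two pairs of rows with equal traces. -/
theorem card_union_pairs {A B : Finset (Fin 14)} (hA : A.card ≤ 1) (hB : B.card ≤ 1) :
    (A ∪ A ∪ B ∪ B).card ≤ A.card + B.card := by
  have : A ∪ A ∪ B ∪ B = A ∪ B := by ext; simp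
  rw [this]
  exact Finset.card_union_le _ _

theorem maps_traces {X A : Finset (Fin 14)} (h : A ⊆ X) (hA : A.card ≤ 1) :
    A ∈ insert ∅ (X.image fun y => ({y} : Finset (Fin 14))) := by
  rcases Nat.le_one_iff_eq_zero_or_eq_one.1 hA with h0 | h1
  · rw [Finset.card_eq_zero.1 h0]; simp
  · obtain ⟨y, rfl⟩ := Finset.card_eq_one.1 h1
    simp only [Finset.mem_insert, Finset.mem_image]
    exact Or.inr ⟨y, h (by simp), rfl⟩

theorem card_traces (X : Finset (Fin 14)) :
    (insert ∅ (X.image fun y => ({y} : Finset (Fin 14)))).card = X.card + 1 := by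
  rw [Finset.card_insert_of_notMem, Finset.card_image_of_injective _ Finset.singleton_injective]
  simp

theorem Rows.deg_le_five (hr : Rows r) (x : Fin 10) : (r x).card ≤ 5 := by
  by_contra hcon
  obtain ⟨X, hX, hX6⟩ := Finset.exists_subset_card_eq (show 6 ≤ (r x).card by omega)
  set V := insert ∅ (X.image fun y => ({y} : Finset (Fin 14))) with hV
  have hVc : V.card = 7 := by rw [hV, card_traces, hX6]
  have hle : ∀ i, i ≠ x → (r i ∩ X).card ≤ 1 := fun i hi =>
    (Finset.card_le_card (Finset.inter_subset_inter_left hX)).trans (hr.pair i x hi)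
  set R := Finset.univ.erase x with hR
  have hRc : R.card = 9 := by simp [hR]
  have hmap : ∀ i ∈ R, r i ∩ X ∈ V := fun i hi =>
    maps_traces Finset.inter_subset_right (hle i (Finset.ne_of_mem_erase hi))
  obtain ⟨a, ha, b, hb, hab, heq⟩ := Finset.exists_ne_map_eq_of_card_lt_of_maps_to
    (by omega : V.card < R.card) hmap
  have hax := Finset.ne_of_mem_erase ha
  have hbx := Finset.ne_of_mem_erase hb
  set R1 := (R.erase a).erase b with hR1
  have hR1c : R1.card = 7 := by
    rw [hR1, Finset.card_erase_of_mem (by simp [hb, hab.symm]), Finset.card_erase_of_mem ha, hRc]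
  have hmem : ∀ i ∈ R1, i ≠ a ∧ i ≠ b ∧ i ≠ x := by
    intro i hi
    simp only [hR1, hR, Finset.mem_erase, Finset.mem_univ] at hi
    tauto
  -- four rows with at most two traces
  have key : ∀ c ∈ R1, ∀ d ∈ R1, c ≠ d →
      (r a ∩ X ∪ (r b ∩ X) ∪ (r c ∩ X) ∪ (r d ∩ X)).card ≤ 2 → False := by
    intro c hc d hd hcd h
    have := hr.split X hab (hmem c hc).1.symm (hmem d hd).1.symm (hmem c hc).2.1.symm
      (hmem d hd).2.1.symm hcd
    omega
  by_cases hinj : Set.InjOn (fun i => r i ∩ X) R1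
  · have himg : R1.image (fun i => r i ∩ X) = V := by
      apply Finset.eq_of_subset_of_card_le
      · intro A hA
        obtain ⟨i, hi, rfl⟩ := Finset.mem_image.1 hA
        exact hmap i (Finset.mem_of_mem_erase (Finset.mem_of_mem_erase hi))
      · rw [Finset.card_image_of_injOn hinj]; omega
    have h0 : (∅ : Finset (Fin 14)) ∈ R1.image (fun i => r i ∩ X) := by rw [himg, hV]; simp
    obtain ⟨o, ho, ho'⟩ := Finset.mem_image.1 h0
    obtain ⟨c, hc, hco⟩ := Finset.exists_mem_ne (by omega : 1 < R1.card) o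
    refine key c hc o ho hco ?_
    rw [ho', ← heq, Finset.union_self, Finset.union_empty]
    have := Finset.card_union_le (r a ∩ X) (r c ∩ X)
    have := hle a hax
    have := hle c (hmem c hc).2.2
    omega
  · simp only [Set.InjOn, not_forall] at hinj
    obtain ⟨c, hc, d, hd, hcd, hne⟩ := hinj
    refine key c hc d hd hne ?_
    rw [← heq, ← hcd]
    have h1 := hle a hax
    have h2 := hle c (hmem c hc).2.2
    have := card_union_pairs h1 h2
    omega

/-- Four rows with two traces of size at most one (in pairs): the traces are nonempty and the
rows cover the complement of `X`. -/
theorem Rows.cover (hr : Rows r) {X : Finset (Fin 14)} (hX : X.card = 5) {a b c d : Fin 10}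
    (hab : a ≠ b) (hac : a ≠ c) (had : a ≠ d) (hbc : b ≠ c) (hbd : b ≠ d) (hcd : c ≠ d)
    {A B : Finset (Fin 14)} (hA : A.card ≤ 1) (hB : B.card ≤ 1)
    (h : (r a ∩ X) ∪ (r b ∩ X) ∪ (r c ∩ X) ∪ (r d ∩ X) ⊆ A ∪ B) :
    A ≠ ∅ ∧ B ≠ ∅ ∧ A ≠ B ∧ ∀ y, y ∉ X → y ∈ r a ∨ y ∈ r b ∨ y ∈ r c ∨ y ∈ r d := by
  have h1 := hr.split X hab hac had hbc hbd hcd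
  have h2 := Finset.card_le_card h
  have h3 := Finset.card_union_le A B
  refine ⟨?_, ?_, ?_, ?_⟩
  · rintro rfl
    rw [Finset.card_empty] at h3
    omega
  · rintro rfl
    rw [Finset.card_empty] at h3
    omega
  · rintro rfl
    rw [Finset.union_self] at h2
    omega
  · intro y hy
    have h4 : (Xᶜ \ (r a ∪ r b ∪ r c ∪ r d)).card = 0 := by omega
    rw [Finset.card_eq_zero] at h4
    by_contra hcon
    have : y ∈ Xᶜ \ (r a ∪ r b ∪ r c ∪ r d) := by
      simp only [Finset.mem_sdiff, Finset.mem_compl, Finset.mem_union]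
      tauto
    rw [h4] at this
    simp at this

/-- Rows with a common nonempty trace are disjoint outside `X`. -/
theorem Rows.disj (hr : Rows r) {X : Finset (Fin 14)} {a b : Fin 10} (hab : a ≠ b)
    (heq : r a ∩ X = r b ∩ X) (hne : r a ∩ X ≠ ∅) {y : Fin 14} (hy : y ∉ X)
    (ha : y ∈ r a) (hb : y ∈ r b) : False := by
  obtain ⟨z, hz⟩ := Finset.nonempty_iff_ne_empty.2 hne
  have hz' := hz
  rw [heq] at hz'
  rw [Finset.mem_inter] at hz hz'
  have := Finset.card_le_one.1 (hr.pair a b hab) y (by simp [ha, hb]) z (by simp [hz.1, hz'.1])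
  exact hy (this ▸ hz.2)

/-- The part of the complement of `X` not covered by two rows. -/
def gap (r : Fin 10 → Finset (Fin 14)) (X : Finset (Fin 14)) (a b : Fin 10) : Finset (Fin 14) :=
  Xᶜ \ (r a ∪ r b)

/-- Two pairs of rows with equal traces: the gaps are disjoint and large. -/
theorem Rows.two_pairs (hr : Rows r) {X : Finset (Fin 14)} (hX : X.card = 5) {a b c d : Fin 10}
    (hab : a ≠ b) (hac : a ≠ c) (had : a ≠ d) (hbc : b ≠ c) (hbd : b ≠ d) (hcd : c ≠ d)
    (hA : (r a ∩ X).card ≤ 1) (hC : (r c ∩ X).card ≤ 1)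
    (e1 : r a ∩ X = r b ∩ X) (e2 : r c ∩ X = r d ∩ X) :
    r a ∩ X ≠ ∅ ∧ r c ∩ X ≠ ∅ ∧ r a ∩ X ≠ r c ∩ X ∧
    Disjoint (gap r X a b) (gap r X c d) ∧ 5 ≤ (gap r X a b).card + (gap r X c d).card := by
  obtain ⟨h1, h2, h3, h4⟩ := hr.cover hX hab hac had hbc hbd hcd hA hC (by
    rw [← e1, ← e2]; intro y; simp only [Finset.mem_union]; tauto)
  refine ⟨h1, h2, h3, ?_, ?_⟩
  · rw [Finset.disjoint_left]
    intro y hy hy'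
    simp only [gap, Finset.mem_sdiff, Finset.mem_compl, Finset.mem_union] at hy hy'
    have := h4 y hy.1
    tauto
  · have hS : Xᶜ.card = 9 := by rw [Finset.card_compl, hX]; rfl
    have g1 := Finset.card_sdiff_add_card_inter Xᶜ (r a ∪ r b)
    have g2 := Finset.card_sdiff_add_card_inter Xᶜ (r c ∪ r d)
    have g3 := Finset.card_union_add_card_inter (Xᶜ ∩ (r a ∪ r b)) (Xᶜ ∩ (r c ∪ r d))
    have g4 : (Xᶜ ∩ (r a ∪ r b) ∪ Xᶜ ∩ (r c ∪ r d)).card ≤ Xᶜ.card :=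
      Finset.card_le_card (by intro y; simp; tauto)
    have g5 : (Xᶜ ∩ (r a ∪ r b) ∩ (Xᶜ ∩ (r c ∪ r d))).card ≤
        (((r a ∩ r c) ∪ (r a ∩ r d)) ∪ ((r b ∩ r c) ∪ (r b ∩ r d))).card :=
      Finset.card_le_card (by intro y; simp; tauto)
    have g6 := Finset.card_union_le ((r a ∩ r c) ∪ (r a ∩ r d)) ((r b ∩ r c) ∪ (r b ∩ r d))
    have g7 := Finset.card_union_le (r a ∩ r c) (r a ∩ r d)
    have g8 := Finset.card_union_le (r b ∩ r c) (r b ∩ r d)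
    have := hr.pair a c hac
    have := hr.pair a d had
    have := hr.pair b c hbc
    have := hr.pair b d hbd
    simp only [gap]
    omega

/-- A triple and a pair of rows with equal traces cannot coexist. -/
theorem Rows.triple_pair (hr : Rows r) {X : Finset (Fin 14)} (hX : X.card = 5)
    {a b c d e : Fin 10} (hab : a ≠ b) (hac : a ≠ c) (had : a ≠ d) (hae : a ≠ e) (hbc : b ≠ c)
    (hbd : b ≠ d) (hbe : b ≠ e) (hcd : c ≠ d) (hce : c ≠ e) (hde : d ≠ e)
    (hA : (r a ∩ X).card ≤ 1) (hD : (r d ∩ X).card ≤ 1)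
    (e1 : r a ∩ X = r b ∩ X) (e2 : r a ∩ X = r c ∩ X) (e3 : r d ∩ X = r e ∩ X) : False := by
  have sub1 : ∀ i j k l, r i ∩ X = r a ∩ X → r j ∩ X = r a ∩ X → 
      (r k ∩ X = r a ∩ X ∨ r k ∩ X = r d ∩ X) → r l ∩ X = r d ∩ X →
      (r i ∩ X) ∪ (r j ∩ X) ∪ (r k ∩ X) ∪ (r l ∩ X) ⊆ (r a ∩ X) ∪ (r d ∩ X) := by
    intro i j k l h1 h2 h3 h4
    rw [h1, h2, h4]
    rcases h3 with h3 | h3 <;> rw [h3] <;> intro y <;> simp only [Finset.mem_union] <;> tauto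
  obtain ⟨hne, hne', -, c1⟩ := hr.cover hX hab hac had hbc hbd hcd hA hD
    (sub1 a b c d rfl e1.symm (Or.inl e2.symm) rfl)
  obtain ⟨-, -, -, c2⟩ := hr.cover hX hab hac hae hbc hbe hce hA hD
    (sub1 a b c e rfl e1.symm (Or.inl e2.symm) e3.symm)
  obtain ⟨-, -, -, c3⟩ := hr.cover hX hab had hae hbd hbe hde hA hD
    (sub1 a b d e rfl e1.symm (Or.inr rfl) e3.symm)
  obtain ⟨-, -, -, c4⟩ := hr.cover hX hac had hae hcd hce hde hA hD
    (sub1 a c d e rfl e2.symm (Or.inr rfl) e3.symm)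
  obtain ⟨-, -, -, c5⟩ := hr.cover hX hbc hbd hbe hcd hce hde hA hD
    (sub1 b c d e e1.symm e2.symm (Or.inr rfl) e3.symm)
  have dab := fun y => hr.disj hab e1 hne (y := y)
  have dac := fun y => hr.disj hac e2 hne (y := y)
  have dbc := fun y => hr.disj hbc (e1.symm.trans e2) (e1 ▸ hne) (y := y)
  have dde := fun y => hr.disj hde e3 hne' (y := y)
  have hS : Xᶜ.card = 9 := by rw [Finset.card_compl, hX]; rfl
  have hsub : Xᶜ ⊆ (((r a ∩ r d) ∪ (r a ∩ r e)) ∪ ((r b ∩ r d) ∪ (r b ∩ r e))) ∪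
      ((r c ∩ r d) ∪ (r c ∩ r e)) := by
    intro y hy
    rw [Finset.mem_compl] at hy
    have habc : y ∈ r a ∨ y ∈ r b ∨ y ∈ r c := by
      rcases c1 y hy with h | h | h | hd
      · exact Or.inl h
      · exact Or.inr (Or.inl h)
      · exact Or.inr (Or.inr h)
      · rcases c2 y hy with h | h | h | he
        · exact Or.inl h
        · exact Or.inr (Or.inl h)
        · exact Or.inr (Or.inr h)
        · exact (dde y hy hd he).elim
    have hde' : y ∈ r d ∨ y ∈ r e := by
      rcases habc with h | h | h
      · rcases c5 y hy with h' | h' | h'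
        · exact (dab y hy h h').elim
        · exact (dac y hy h h').elim
        · exact h'
      · rcases c4 y hy with h' | h' | h'
        · exact (dab y hy h' h).elim
        · exact (dbc y hy h h').elim
        · exact h'
      · rcases c3 y hy with h' | h' | h'
        · exact (dac y hy h' h).elim
        · exact (dbc y hy h' h).elim
        · exact h'
    simp only [Finset.mem_union, Finset.mem_inter]
    rcases habc with h | h | h <;> rcases hde' with h' | h' <;> simp [h, h']
  have g0 := Finset.card_le_card hsub
  have g1 := Finset.card_union_le (((r a ∩ r d) ∪ (r a ∩ r e)) ∪ ((r b ∩ r d) ∪ (r b ∩ r e)))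
      ((r c ∩ r d) ∪ (r c ∩ r e))
  have g2 := Finset.card_union_le ((r a ∩ r d) ∪ (r a ∩ r e)) ((r b ∩ r d) ∪ (r b ∩ r e))
  have g3 := Finset.card_union_le (r a ∩ r d) (r a ∩ r e)
  have g4 := Finset.card_union_le (r b ∩ r d) (r b ∩ r e)
  have g5 := Finset.card_union_le (r c ∩ r d) (r c ∩ r e)
  have := hr.pair a d had
  have := hr.pair a e hae
  have := hr.pair b d hbd
  have := hr.pair b e hbe
  have := hr.pair c d hcd
  have := hr.pair c e hce
  omega

/-- If a row misses `X`, then it contains the gap of every pair (given a second pair). -/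
theorem Rows.gap_subset (hr : Rows r) {X : Finset (Fin 14)} (hX : X.card = 5)
    {a b c d o : Fin 10} (hab : a ≠ b) (hac : a ≠ c) (had : a ≠ d) (hao : a ≠ o) (hbc : b ≠ c)
    (hbd : b ≠ d) (hbo : b ≠ o) (hcd : c ≠ d) (hco : c ≠ o) (hdo : d ≠ o)
    (hA : (r a ∩ X).card ≤ 1) (hC : (r c ∩ X).card ≤ 1)
    (e1 : r a ∩ X = r b ∩ X) (e2 : r c ∩ X = r d ∩ X) (ho : r o ∩ X = ∅) :
    gap r X a b ⊆ r o := by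
  obtain ⟨-, hne, -, c1⟩ := hr.cover hX hab hac hao hbc hbo hco hA hC (by
    rw [← e1, ho]; intro y; simp only [Finset.mem_union]; simp)
  obtain ⟨-, -, -, c2⟩ := hr.cover hX hab had hao hbd hbo hdo hA hC (by
    rw [← e1, ← e2, ho]; intro y; simp only [Finset.mem_union]; simp)
  intro y hy
  simp only [gap, Finset.mem_sdiff, Finset.mem_compl, Finset.mem_union] at hy
  have := c1 y hy.1
  have := c2 y hy.1
  have := fun h h' => hr.disj hcd e2 hne (y := y) hy.1 h h'
  tauto

theorem Rows.deg_ne_five (hr : Rows r) (x : Fin 10) : (r x).card ≠ 5 := by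
  intro hX
  set X := r x with hXdef
  set V := insert ∅ (X.image fun y => ({y} : Finset (Fin 14))) with hV
  have hVc : V.card = 6 := by rw [hV, card_traces, hX]
  have hS : Xᶜ.card = 9 := by rw [Finset.card_compl, hX]; rfl
  set R := Finset.univ.erase x with hR
  have hRc : R.card = 9 := by simp [hR]
  have hle : ∀ i ∈ R, (r i ∩ X).card ≤ 1 := fun i hi => hr.pair i x (Finset.ne_of_mem_erase hi)
  have hmap : ∀ i ∈ R, r i ∩ X ∈ V := fun i hi =>
    maps_traces Finset.inter_subset_right (hle i hi)
  -- first pair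
  obtain ⟨a, ha, b, hb, hab, e1⟩ := Finset.exists_ne_map_eq_of_card_lt_of_maps_to
    (by omega : V.card < R.card) hmap
  set R1 := (R.erase a).erase b with hR1
  have hR1c : R1.card = 7 := by
    rw [hR1, Finset.card_erase_of_mem (by simp [hb, hab.symm]), Finset.card_erase_of_mem ha, hRc]
  have hR1m : ∀ i ∈ R1, a ≠ i ∧ b ≠ i ∧ i ∈ R := by
    intro i hi
    simp only [hR1, Finset.mem_erase] at hi
    exact ⟨fun h => hi.2.1 h.symm, fun h => hi.1 h.symm, hi.2.2⟩
  -- second pair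
  obtain ⟨c, hc, d, hd, hcd, e2⟩ := Finset.exists_ne_map_eq_of_card_lt_of_maps_to
    (by omega : V.card < R1.card) (fun i hi => hmap i (hR1m i hi).2.2)
  set R2 := (R1.erase c).erase d with hR2
  have hR2c : R2.card = 5 := by
    rw [hR2, Finset.card_erase_of_mem (by simp [hd, hcd.symm]), Finset.card_erase_of_mem hc, hR1c]
  have hR2m : ∀ i ∈ R2, a ≠ i ∧ b ≠ i ∧ c ≠ i ∧ d ≠ i ∧ i ∈ R := by
    intro i hi
    simp only [hR2, Finset.mem_erase] at hi
    have := hR1m i hi.2.2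
    exact ⟨this.1, this.2.1, fun h => hi.2.1 h.symm, fun h => hi.1 h.symm, this.2.2⟩
  obtain ⟨hac, hbc, hcR⟩ := hR1m c hc
  obtain ⟨had, hbd, hdR⟩ := hR1m d hd
  obtain ⟨nea, nec, neac, djac, szac⟩ := hr.two_pairs hX hab hac had hbc hbd hcd (hle a ha)
    (hle c hcR) e1 e2
  -- no further row shares a trace with one of the pairs
  have hfree : ∀ i ∈ R2, r i ∩ X ≠ r a ∩ X ∧ r i ∩ X ≠ r c ∩ X := by
    intro i hi
    obtain ⟨h1, h2, h3, h4, h5⟩ := hR2m i hi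
    constructor
    · intro h
      exact hr.triple_pair hX hab h1 hac had h2 hbc hbd h3.symm h4.symm hcd (hle a ha) (hle c hcR)
        e1 h.symm e2
    · intro h
      exact hr.triple_pair hX hcd h3 hac.symm hbc.symm h4 had.symm hbd.symm h1.symm h2.symm hab
        (hle c hcR) (hle a ha) e2 h.symm e1
  set V2 := (V.erase (r a ∩ X)).erase (r c ∩ X) with hV2
  have hV2c : V2.card = 4 := by
    rw [hV2, Finset.card_erase_of_mem, Finset.card_erase_of_mem (hmap a ha), hVc]
    exact Finset.mem_erase.2 ⟨neac.symm, hmap c hcR⟩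
  have hmap2 : ∀ i ∈ R2, r i ∩ X ∈ V2 := fun i hi =>
    Finset.mem_erase.2 ⟨(hfree i hi).2, Finset.mem_erase.2 ⟨(hfree i hi).1,
      hmap i (hR2m i hi).2.2.2.2⟩⟩
  -- third pair
  obtain ⟨e, he, f, hf, hef, e3⟩ := Finset.exists_ne_map_eq_of_card_lt_of_maps_to
    (by omega : V2.card < R2.card) hmap2
  obtain ⟨hae, hbe, hce, hde, heR⟩ := hR2m e he
  obtain ⟨haf, hbf, hcf, hdf, hfR⟩ := hR2m f hf
  obtain ⟨-, nee, neae, djae, szae⟩ := hr.two_pairs hX hab hae haf hbe hbf hef (hle a ha)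
    (hle e heR) e1 e3
  obtain ⟨-, -, nece, djce, szce⟩ := hr.two_pairs hX hcd hce hcf hde hdf hef (hle c hcR)
    (hle e heR) e2 e3
  set R3 := (R2.erase e).erase f with hR3
  have hR3c : R3.card = 3 := by
    rw [hR3, Finset.card_erase_of_mem (by simp [hf, hef.symm]), Finset.card_erase_of_mem he, hR2c]
  have hR3m : ∀ i ∈ R3, i ∈ R2 ∧ e ≠ i ∧ f ≠ i := by
    intro i hi
    simp only [hR3, Finset.mem_erase] at hi
    exact ⟨hi.2.2, fun h => hi.2.1 h.symm, fun h => hi.1 h.symm⟩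
  by_cases hinj : Set.InjOn (fun i => r i ∩ X) R3
  · -- some row misses `X`
    set V3 := V2.erase (r e ∩ X) with hV3
    have hV3c : V3.card = 3 := by
      rw [hV3, Finset.card_erase_of_mem (hmap2 e he), hV2c]
    have himg : R3.image (fun i => r i ∩ X) = V3 := by
      apply Finset.eq_of_subset_of_card_le
      · intro A hA
        obtain ⟨i, hi, rfl⟩ := Finset.mem_image.1 hA
        obtain ⟨hi2, hei, hfi⟩ := hR3m i hi
        obtain ⟨h1, h2, h3, h4, h5⟩ := hR2m i hi2
        refine Finset.mem_erase.2 ⟨fun h => ?_, hmap2 i hi2⟩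
        exact hr.triple_pair hX hef hei hae.symm hbe.symm hfi haf.symm hbf.symm h1.symm h2.symm hab
          (hle e heR) (hle a ha) e3 h.symm e1
      · rw [Finset.card_image_of_injOn hinj]; omega
    have h0 : (∅ : Finset (Fin 14)) ∈ R3.image (fun i => r i ∩ X) := by
      rw [himg, hV3, hV2]
      simp only [Finset.mem_erase]
      exact ⟨nee.symm, nec.symm, nea.symm, by rw [hV]; simp⟩
    obtain ⟨o, ho, ho'⟩ := Finset.mem_image.1 h0
    obtain ⟨ho2, heo, hfo⟩ := hR3m o ho
    obtain ⟨hao, hbo, hco, hdo, hoR⟩ := hR2m o ho2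
    have s1 := hr.gap_subset hX hab hac had hao hbc hbd hbo hcd hco hdo (hle a ha) (hle c hcR)
      e1 e2 ho'
    have s2 := hr.gap_subset hX hcd hac.symm hbc.symm hco had.symm hbd.symm hdo hab hao hbo
      (hle c hcR) (hle a ha) e2 e1 ho'
    have s3 := hr.gap_subset hX hef hae.symm hbe.symm heo haf.symm hbf.symm hfo hab hao hbo
      (hle e heR) (hle a ha) e3 e1 ho'
    have hsub : gap r X a b ∪ gap r X c d ∪ gap r X e f ⊆ r o :=
      Finset.union_subset (Finset.union_subset s1 s2) s3
    have h1 := Finset.card_le_card hsub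
    rw [Finset.card_union_of_disjoint (Finset.disjoint_union_left.2 ⟨djae, djce⟩),
      Finset.card_union_of_disjoint djac] at h1
    have := hr.deg_le_five o
    omega
  · -- a fourth pair
    simp only [Set.InjOn, not_forall] at hinj
    obtain ⟨g, hg, h, hh, e4, hgh⟩ := hinj
    obtain ⟨hg2, heg, hfg⟩ := hR3m g hg
    obtain ⟨hag, hbg, hcg, hdg, hgR⟩ := hR2m g hg2
    obtain ⟨hh2, heh, hfh⟩ := hR3m h hh
    obtain ⟨hah, hbh, hch, hdh, hhR⟩ := hR2m h hh2
    obtain ⟨-, -, -, djag, -⟩ := hr.two_pairs hX hab hag hah hbg hbh hgh (hle a ha)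
      (hle g hgR) e1 e4
    obtain ⟨-, -, -, djcg, -⟩ := hr.two_pairs hX hcd hcg hch hdg hdh hgh (hle c hcR)
      (hle g hgR) e2 e4
    obtain ⟨-, -, -, djeg, szeg⟩ := hr.two_pairs hX hef heg heh hfg hfh hgh (hle e heR)
      (hle g hgR) e3 e4
    have hsub : gap r X a b ∪ gap r X c d ∪ gap r X e f ∪ gap r X g h ⊆ Xᶜ :=
      Finset.union_subset (Finset.union_subset (Finset.union_subset Finset.sdiff_subset
        Finset.sdiff_subset) Finset.sdiff_subset) Finset.sdiff_subset
    have h1 := Finset.card_le_card hsub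
    rw [Finset.card_union_of_disjoint (Finset.disjoint_union_left.2
        ⟨Finset.disjoint_union_left.2 ⟨djag, djcg⟩, djeg⟩),
      Finset.card_union_of_disjoint (Finset.disjoint_union_left.2 ⟨djae, djce⟩),
      Finset.card_union_of_disjoint djac] at h1
    omega

end BigRow


theorem no_rows (r : Fin 10 → Finset (Fin 14)) (hr : Rows r) : False := by
  have hdeg : ∀ x, (r x).card ≤ 4 := by
    intro x
    have h1 := hr.deg_le_five x
    have h2 := hr.deg_ne_five x
    omega
  have hne : ∀ a b : Fin 8, a ≠ b →
      (Fin.castLE (by norm_num) a : Fin 10) ≠ Fin.castLE (by norm_num) b :=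
    fun a b h h' => h (Fin.castLE_injective _ h')
  exact no_eight_small_rows (fun i => r (Fin.castLE (by norm_num) i)) (fun i => hdeg _)
    (fun i j h => hr.pair _ _ (hne i j h))
    (fun a b c d h1 h2 h3 h4 h5 h6 => hr.quad _ _ _ _ (hne _ _ h1) (hne _ _ h2) (hne _ _ h3)
      (hne _ _ h4) (hne _ _ h5) (hne _ _ h6))

theorem upper_bound (m : ℕ) (hm : 10 ≤ m) (G : Finset (Fin m × Fin 14)) :
    ContainsK m 14 2 2 G ∨ ContainsK m 14 4 4 (bipCompl m 14 G) := by
  by_contra hcon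
  rw [not_or] at hcon
  obtain ⟨h22, h44⟩ := hcon
  have hinj : ∀ a b : Fin 10, a ≠ b → Fin.castLE hm a ≠ Fin.castLE hm b :=
    fun a b h h' => h (Fin.castLE_injective _ h')
  apply no_rows (fun i => Finset.univ.filter fun y => (Fin.castLE hm i, y) ∈ G)
  constructor
  · intro i j hij
    by_contra hlt
    obtain ⟨B, hB, hBc⟩ := Finset.exists_subset_card_eq (Nat.lt_of_not_le hlt)
    apply h22
    refine ⟨{Fin.castLE hm i, Fin.castLE hm j}, B, Finset.card_pair (hinj _ _ hij), hBc, ?_⟩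
    intro x hx y hy
    have := hB hy
    simp only [Finset.mem_inter, Finset.mem_filter, Finset.mem_univ, true_and] at this
    rcases Finset.mem_insert.1 hx with rfl | hx
    · exact this.1
    · rw [Finset.mem_singleton.1 hx]; exact this.2
  · intro a b c d hab hac had hbc hbd hcd
    by_contra hlt
    obtain ⟨B, hB, hBc⟩ := Finset.exists_subset_card_eq (Nat.lt_of_not_le hlt)
    apply h44
    refine ⟨({a, b, c, d} : Finset (Fin 10)).map (Fin.castLEEmb hm), B, ?_, hBc, ?_⟩
    · rw [Finset.card_map, Finset.card_eq_of_equiv_fin]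
      exact Finset.equivFinOfCardEq (by
        rw [Finset.card_insert_of_notMem (by simp [hab, hac, had]),
          Finset.card_insert_of_notMem (by simp [hbc, hbd]), Finset.card_pair hcd])
    · intro x hx y hy
      have := hB hy
      simp only [Finset.mem_compl, Finset.mem_union, Finset.mem_filter, Finset.mem_univ,
        true_and, not_or] at this
      obtain ⟨i, hi, rfl⟩ := Finset.mem_map.1 hx
      simp only [Finset.mem_insert, Finset.mem_singleton] at hi
      simp only [bipCompl, Finset.mem_sdiff, Finset.mem_univ, true_and, Fin.coe_castLEEmb]
      rcases hi with rfl | rfl | rfl | rfl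
      · exact this.1.1.1
      · exact this.1.1.2
      · exact this.1.2
      · exact this.2

/-- BR_m(K_{2,2}, K_{4,4}) = 14 for each m ∈ {10, 11, 12, 13}. -/
theorem br_m_eq_14_of_ten_le :
    ∀ m : ℕ, 10 ≤ m → m ≤ 13 →
      IsLeast {n : ℕ | 0 < n ∧ ∀ G : Finset (Fin m × Fin n),
        ContainsK m n 2 2 G ∨ ContainsK m n 4 4 (bipCompl m n G)} 14 := by
  intro m hm hm'
  refine ⟨⟨by norm_num, upper_bound m hm⟩, ?_⟩
  rintro n ⟨-, h⟩
  by_contra hn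
  rcases h (planeGraph m n) with h | h
  · exact planeGraph_no_K22 m n hm' (by omega) h
  · exact planeGraph_no_K44 m n hm' (by omega) h
end

section
/- The bipartite Ramsey number BR(K_{2,2}, K_{4,4}) equals 14; that is, 14 is the least positive integer b such that every subgraph G of the complete bipartite graph K_{b,b} contains K_{2,2} or the bipartite complement of G contains K_{4,4}. -/
namespace BR

/-! ### Lower bound: the projective plane of order three -/

/-- Incidence of the projective plane of order 3, via the difference set `{0,1,3,9}` mod 13. -/
def pg (i j : ℕ) : Bool :=
  Nat.beq ((i + j) % 13) 0 || Nat.beq ((i + j) % 13) 1 ||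
    Nat.beq ((i + j) % 13) 3 || Nat.beq ((i + j) % 13) 9

lemma pg_pair : ∀ a b : Fin 13, a < b →
    (Finset.univ.filter (fun j : Fin 13 => pg a j = true ∧ pg b j = true)).card ≤ 1 := by
  decide +kernel

lemma pg_quad : ∀ a b : Fin 13, a < b → ∀ c : Fin 13, b < c → ∀ d : Fin 13, c < d →
    (Finset.univ.filter (fun j : Fin 13 =>
      pg a j = false ∧ pg b j = false ∧ pg c j = false ∧ pg d j = false)).card ≤ 3 := by
  decide +kernel

lemma lower (b : ℕ) (hb : b ≤ 13) : ∃ G : Finset (Fin b × Fin b),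
    ¬ ContainsK b b 2 2 G ∧ ¬ ContainsK b b 4 4 (bipCompl b b G) := by
  refine ⟨Finset.univ.filter (fun p => pg p.1 p.2 = true), ?_, ?_⟩
  · rintro ⟨A, B, hA, hB, h⟩
    let f := A.orderEmbOfFin hA
    have h01 : f 0 < f 1 := f.strictMono (by decide)
    have hf : ∀ k, f k ∈ A := fun k => A.orderEmbOfFin_mem hA k
    have key := pg_pair (Fin.castLE hb (f 0)) (Fin.castLE hb (f 1)) (by simpa using h01)
    have hsub : B.map (Fin.castLEEmb hb) ⊆ Finset.univ.filter (fun j : Fin 13 =>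
        pg (Fin.castLE hb (f 0)) j = true ∧ pg (Fin.castLE hb (f 1)) j = true) := by
      intro y hy
      obtain ⟨z, hz, rfl⟩ := Finset.mem_map.1 hy
      have h0 := h _ (hf 0) z hz
      have h1 := h _ (hf 1) z hz
      simp at h0 h1
      simp [h0, h1]
    have := Finset.card_le_card hsub
    rw [Finset.card_map] at this
    omega
  · rintro ⟨A, B, hA, hB, h⟩
    let f := A.orderEmbOfFin hA
    have h01 : f 0 < f 1 := f.strictMono (by decide)
    have h12 : f 1 < f 2 := f.strictMono (by decide)
    have h23 : f 2 < f 3 := f.strictMono (by decide)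
    have hf : ∀ k, f k ∈ A := fun k => A.orderEmbOfFin_mem hA k
    have key := pg_quad (Fin.castLE hb (f 0)) (Fin.castLE hb (f 1)) (by simpa using h01)
      (Fin.castLE hb (f 2)) (by simpa using h12) (Fin.castLE hb (f 3)) (by simpa using h23)
    have hsub : B.map (Fin.castLEEmb hb) ⊆ Finset.univ.filter (fun j : Fin 13 =>
        pg (Fin.castLE hb (f 0)) j = false ∧ pg (Fin.castLE hb (f 1)) j = false ∧
        pg (Fin.castLE hb (f 2)) j = false ∧ pg (Fin.castLE hb (f 3)) j = false) := by
      intro y hy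
      obtain ⟨z, hz, rfl⟩ := Finset.mem_map.1 hy
      have h0 := h _ (hf 0) z hz
      have h1 := h _ (hf 1) z hz
      have h2 := h _ (hf 2) z hz
      have h3 := h _ (hf 3) z hz
      simp [bipCompl] at h0 h1 h2 h3
      simp [h0, h1, h2, h3]
    have := Finset.card_le_card hsub
    rw [Finset.card_map] at this
    omega

/-! ### Upper bound -/

abbrev V := Fin 14

/-- The indicator of the relation. -/
def ind (r : V → V → Bool) (x y : V) : ℤ := if r x y then 1 else 0

/-- The degree. -/
def dg (r : V → V → Bool) (x : V) : ℤ := ∑ y, ind r x y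

/-- The transposed relation. -/
def tr (r : V → V → Bool) : V → V → Bool := fun x y => r y x

def C4 (r : V → V → Bool) : Prop := ∀ x x' y y', x ≠ x' → r x y → r x y' → r x' y → r x' y' → y = y'

def K4 (r : V → V → Bool) : Prop := ∀ A : Finset V, A.card = 4 →
  (Finset.univ.filter (fun y => ∀ x ∈ A, r x y = false)).card ≤ 3

lemma C4.tr {r} (h : C4 r) : C4 (tr r) := by
  intro x x' y y' hx h1 h2 h3 h4
  by_contra hy
  exact hx (h y y' x x' hy h1 h3 h2 h4)

lemma K4.tr {r} (h : K4 r) : K4 (tr r) := by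
  intro A hA
  by_contra hc
  push Not at hc
  obtain ⟨B, hB, hB4⟩ := Finset.exists_subset_card_eq (Nat.succ_le_of_lt hc)
  have := h B hB4
  have hs : A ⊆ Finset.univ.filter (fun y => ∀ x ∈ B, r x y = false) := by
    intro y hy
    simp only [Finset.mem_filter, Finset.mem_univ, true_and]
    intro x hx
    have := hB hx
    simp only [Finset.mem_filter, Finset.mem_univ, true_and] at this
    exact this y hy
  have := Finset.card_le_card hs
  omega

lemma ind_nonneg (r x y) : 0 ≤ ind r x y := by unfold ind; split <;> simp
lemma ind_sq (r x y) : ind r x y * ind r x y = ind r x y := by unfold ind; split <;> simp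
lemma ind_tr (r x y) : ind (tr r) x y = ind r y x := rfl

lemma dg_eq (r x) : dg r x = ((Finset.univ.filter (fun y => r x y = true)).card : ℤ) := by
  unfold dg ind
  simp

lemma codeg {r} (h : C4 r) {x x'} (hx : x ≠ x') : ∑ y, ind r x y * ind r x' y ≤ 1 := by
  have : ∑ y, ind r x y * ind r x' y
      = ((Finset.univ.filter (fun y => r x y = true ∧ r x' y = true)).card : ℤ) := by
    rw [Finset.card_filter]
    push_cast
    apply Finset.sum_congr rfl
    intro y _
    unfold ind
    split_ifs <;> simp_all
  rw [this]
  have : (Finset.univ.filter (fun y => r x y = true ∧ r x' y = true)).card ≤ 1 := by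
    rw [Finset.card_le_one]
    intro y hy y' hy'
    simp only [Finset.mem_filter, Finset.mem_univ, true_and] at hy hy'
    exact h x x' y y' hx hy.1 hy'.1 hy.2 hy'.2
  exact_mod_cast this

lemma rowsum_eq (r x) : ∑ y, ind r x y * (dg (tr r) y - 1)
    = ∑ x' ∈ Finset.univ.erase x, ∑ y, ind r x y * ind r x' y := by
  have h1 : ∑ x', ∑ y, ind r x y * ind r x' y = ∑ y, ind r x y * dg (tr r) y := by
    rw [Finset.sum_comm]
    apply Finset.sum_congr rfl
    intro y _
    rw [dg, Finset.mul_sum]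
    rfl
  rw [← Finset.add_sum_erase _ _ (Finset.mem_univ x)] at h1
  simp only [ind_sq] at h1
  simp only [mul_sub, mul_one, Finset.sum_sub_distrib]
  linarith

lemma rowsum {r} (h : C4 r) (x) : ∑ y, ind r x y * (dg (tr r) y - 1) ≤ 13 := by
  rw [rowsum_eq]
  calc _ ≤ ∑ x' ∈ Finset.univ.erase x, (1 : ℤ) := by
        apply Finset.sum_le_sum
        intro x' hx'
        exact codeg h (Finset.ne_of_mem_erase hx').symm
    _ = 13 := by simp

lemma total (r) : ∑ x, dg r x = ∑ y, dg (tr r) y := by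
  unfold dg
  rw [Finset.sum_comm]
  rfl

/-- Excess of the degree over 4. -/
def ex (r : V → V → Bool) (x : V) : ℤ := dg r x - 4

lemma total_ex (r) : ∑ x, ex r x = ∑ y, ex (tr r) y := by
  unfold ex
  rw [Finset.sum_sub_distrib, Finset.sum_sub_distrib, total]

lemma row_ex {r} (h : C4 r) (x) : ∑ y, ind r x y * ex (tr r) y ≤ 1 - 3 * ex r x := by
  have h1 := rowsum h x
  have h2 : ∑ y, ind r x y * (dg (tr r) y - 1) = ∑ y, ind r x y * ex (tr r) y + 3 * dg r x := by
    rw [dg, Finset.mul_sum, ← Finset.sum_add_distrib]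
    apply Finset.sum_congr rfl
    intro y _
    unfold ex
    ring
  have : ex r x = dg r x - 4 := rfl
  linarith

lemma sq_bound {r} (h : C4 r) : ∑ y, ex (tr r) y ^ 2 ≤ 14 - 7 * ∑ y, ex (tr r) y := by
  have h1 : ∑ x, ∑ y, ind r x y * ex (tr r) y ≤ ∑ x, (1 - 3 * ex r x) :=
    Finset.sum_le_sum fun x _ => row_ex h x
  rw [Finset.sum_comm, Finset.sum_sub_distrib, ← Finset.mul_sum, total_ex] at h1
  have h2 : ∑ y, ∑ x, ind r x y * ex (tr r) y = ∑ y, ex (tr r) y ^ 2 + 4 * ∑ y, ex (tr r) y := by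
    rw [Finset.mul_sum, ← Finset.sum_add_distrib]
    apply Finset.sum_congr rfl
    intro y _
    rw [← Finset.sum_mul]
    change dg (tr r) y * _ = _
    unfold ex
    ring
  simp at h1
  linarith

lemma miss {r} (h : K4 r) :
    ∑ y, ((14 - (Finset.univ.filter (fun x => r x y = true)).card).choose 4) ≤ 3003 := by
  have key := Finset.sum_card_bipartiteAbove_eq_sum_card_bipartiteBelow
    (s := Finset.powersetCard 4 (Finset.univ : Finset V)) (t := (Finset.univ : Finset V))
    (fun A y => ∀ x ∈ A, r x y = false)
  have h1 : ∑ A ∈ Finset.powersetCard 4 (Finset.univ : Finset V),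
      (Finset.bipartiteAbove (fun A y => ∀ x ∈ A, r x y = false) Finset.univ A).card
      ≤ ∑ A ∈ Finset.powersetCard 4 (Finset.univ : Finset V), 3 := by
    apply Finset.sum_le_sum
    intro A hA
    exact h A (Finset.mem_powersetCard.1 hA).2
  rw [key] at h1
  have h2 : ∀ y : V, (Finset.bipartiteBelow (fun A y => ∀ x ∈ A, r x y = false)
      (Finset.powersetCard 4 (Finset.univ : Finset V)) y).card
      = (14 - (Finset.univ.filter (fun x => r x y = true)).card).choose 4 := by
    intro y
    have : Finset.bipartiteBelow (fun A y => ∀ x ∈ A, r x y = false)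
      (Finset.powersetCard 4 (Finset.univ : Finset V)) y
        = Finset.powersetCard 4 (Finset.univ.filter (fun x => r x y = true))ᶜ := by
      ext A
      simp only [Finset.bipartiteBelow, Finset.mem_filter, Finset.mem_powersetCard,
        Finset.subset_univ, true_and]
      rw [and_comm]
      apply and_congr_left
      intro _
      simp [Finset.subset_iff]
    rw [this, Finset.card_powersetCard, Finset.card_compl, Fintype.card_fin]
  simp only [h2, Finset.sum_const, Finset.card_powersetCard, Finset.card_univ,
    Fintype.card_fin] at h1
  exact h1

lemma miss_ex {r} (h : K4 r) : ∃ g : V → ℤ, ∑ y, g y ≤ 3003 ∧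
    (∀ y, 210 - 102 * ex (tr r) y + 8 * ex (tr r) y ^ 2 ≤ g y) ∧
    (∀ y, ex (tr r) y ≤ 2 → 210 - 102 * ex (tr r) y + 16 * ex (tr r) y ^ 2 ≤ g y) := by
  refine ⟨fun y => (((14 - (Finset.univ.filter (fun x => r x y = true)).card).choose 4 : ℕ) : ℤ),
    by have := miss h; beta_reduce; exact_mod_cast this, ?_, ?_⟩ <;>
  · intro y
    have h1 : dg (tr r) y = ((Finset.univ.filter (fun x => r x y = true)).card : ℤ) := dg_eq (tr r) y
    have h2 : (Finset.univ.filter (fun x => r x y = true)).card ≤ 14 := by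
      simpa using Finset.card_le_univ (Finset.univ.filter (fun x => r x y = true))
    simp only [ex, h1]
    generalize (Finset.univ.filter (fun x => r x y = true)).card = c at h2
    interval_cases c <;> decide

/-- The basic numerical dichotomy for the column excesses. -/
lemma dicho {r} (h : C4 r) (hk : K4 r) :
    (∑ y, ex (tr r) y = 0 ∧ ∑ y, ex (tr r) y ^ 2 ≤ 3) ∨
    (∑ y, ex (tr r) y = 1 ∧ ∑ y, ex (tr r) y ^ 2 ≤ 7) := by
  obtain ⟨g, hg, h8, h16⟩ := miss_ex hk
  have s8 := Finset.sum_le_sum (fun y (_ : y ∈ Finset.univ) => h8 y)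
  simp only [Finset.sum_add_distrib, Finset.sum_sub_distrib, ← Finset.mul_sum] at s8
  simp only [Finset.sum_const, Finset.card_univ, Fintype.card_fin] at s8
  norm_num at s8
  have hb := sq_bound h
  have hn : (0:ℤ) ≤ ∑ y, ex (tr r) y ^ 2 := Finset.sum_nonneg fun y _ => sq_nonneg _
  have hle : ∑ y, ex (tr r) y ≤ ∑ y, ex (tr r) y ^ 2 :=
    Finset.sum_le_sum fun y _ => by nlinarith [Int.le_self_sq (ex (tr r) y)]
  have ht : ∑ y, ex (tr r) y = 0 ∨ ∑ y, ex (tr r) y = 1 := by omega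
  rcases ht with ht | ht
  · left
    refine ⟨ht, ?_⟩
    have h7 : ∑ y, ex (tr r) y ^ 2 ≤ 7 := by omega
    have h2 : ∀ y, ex (tr r) y ≤ 2 := by
      intro y
      have := Finset.single_le_sum (fun y _ => sq_nonneg (ex (tr r) y)) (Finset.mem_univ y)
      nlinarith
    have s16 := Finset.sum_le_sum (fun y (_ : y ∈ Finset.univ) => h16 y (h2 y))
    simp only [Finset.sum_add_distrib, Finset.sum_sub_distrib, ← Finset.mul_sum] at s16
    simp only [Finset.sum_const, Finset.card_univ, Fintype.card_fin] at s16
    norm_num at s16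
    omega
  · right
    exact ⟨ht, by omega⟩

/-- Quadratic form bound. -/
lemma quad {r} (h : C4 r) (u : V → ℤ) (hu : ∀ y, 0 ≤ u y) :
    ∑ x, (∑ y, ind r x y * u y) ^ 2 ≤ ∑ y, u y ^ 2 * (dg (tr r) y - 1) + (∑ y, u y) ^ 2 := by
  have e1 : ∑ x, (∑ y, ind r x y * u y) ^ 2
      = ∑ y, ∑ z, (∑ x, ind (tr r) y x * ind (tr r) z x) * (u y * u z) := by
    simp only [sq, Finset.sum_mul_sum]
    simp only [Finset.sum_mul]
    rw [Finset.sum_comm]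
    apply Finset.sum_congr rfl
    intro y _
    rw [Finset.sum_comm]
    apply Finset.sum_congr rfl
    intro z _
    apply Finset.sum_congr rfl
    intro x _
    simp only [ind_tr]
    ring
  have e2 : ∑ y, u y ^ 2 * (dg (tr r) y - 1) + (∑ y, u y) ^ 2
      = ∑ y, ∑ z, ((if y = z then dg (tr r) y - 1 else 0) + 1) * (u y * u z) := by
    rw [sq, Finset.sum_mul_sum, ← Finset.sum_add_distrib]
    apply Finset.sum_congr rfl
    intro y _
    simp only [add_mul, one_mul, Finset.sum_add_distrib, ite_mul, zero_mul]
    simp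
    ring
  rw [e1, e2]
  apply Finset.sum_le_sum
  intro y _
  apply Finset.sum_le_sum
  intro z _
  apply mul_le_mul_of_nonneg_right _ (mul_nonneg (hu y) (hu z))
  split_ifs with hyz
  · subst hyz
    simp only [ind_sq]
    simp [dg]
  · simpa using codeg h.tr hyz

/-- positive part sum of the row excesses against negative part of column excesses -/
lemma posneg {r} (h : C4 r) (n : ℤ) (hn : n = ∑ y, max 0 (- ex (tr r) y)) :
    4 * ∑ x, max 0 (ex r x) ≤ 2 * n + n ^ 2 := by
  have hq := quad h (fun y => max 0 (- ex (tr r) y)) (fun y => le_max_left _ _)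
  have h1 : 4 * ∑ x, max 0 (ex r x) ≤ ∑ x, (∑ y, ind r x y * max 0 (- ex (tr r) y)) ^ 2 := by
    rw [Finset.mul_sum]
    apply Finset.sum_le_sum
    intro x _
    have hr := row_ex h x
    have h2 : -∑ y, ind r x y * ex (tr r) y ≤ ∑ y, ind r x y * max 0 (- ex (tr r) y) := by
      rw [← Finset.sum_neg_distrib]
      apply Finset.sum_le_sum
      intro y _
      rw [← mul_neg]
      exact mul_le_mul_of_nonneg_left (le_max_right _ _) (ind_nonneg _ _ _)
    generalize ∑ y, ind r x y * max 0 (- ex (tr r) y) = S at *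
    rcases le_or_gt (ex r x) 0 with h0 | h0
    · rw [max_eq_left h0]
      positivity
    · rw [max_eq_right h0.le]
      have : 3 * ex r x - 1 ≤ S := by linarith
      nlinarith
  have h3 : ∑ y, (max 0 (- ex (tr r) y)) ^ 2 * (dg (tr r) y - 1) ≤ 2 * n := by
    rw [hn, Finset.mul_sum]
    apply Finset.sum_le_sum
    intro y _
    have : dg (tr r) y = ex (tr r) y + 4 := by unfold ex; ring
    rw [this]
    rcases le_or_gt 0 (ex (tr r) y) with h0 | h0
    · rw [max_eq_left (by linarith)]
      simp
    · rw [max_eq_right (by linarith)]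
      obtain ⟨k, hk⟩ : ∃ k, k = - ex (tr r) y := ⟨_, rfl⟩
      rw [← hk, show ex (tr r) y = -k by linarith]
      have hk1 : 1 ≤ k := by omega
      rcases le_or_gt k 3 with h3 | h3
      · interval_cases k <;> norm_num
      · nlinarith [sq_nonneg k]
  rw [← hn] at hq
  linarith

lemma pos_sub_neg (r) : ∑ x, max 0 (ex r x) = ∑ x, ex r x + ∑ x, max 0 (-ex r x) := by
  rw [← Finset.sum_add_distrib]
  apply Finset.sum_congr rfl
  intro x _
  omega

lemma pos_add_neg (r) : ∑ x, max 0 (ex r x) + ∑ x, max 0 (-ex r x) ≤ ∑ x, ex r x ^ 2 := by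
  rw [← Finset.sum_add_distrib]
  apply Finset.sum_le_sum
  intro x _
  have h1 := Int.le_self_sq (ex r x)
  have h2 := Int.le_self_sq (-ex r x)
  rw [neg_sq] at h2
  have : max 0 (ex r x) + max 0 (-ex r x) = ex r x ∨ max 0 (ex r x) + max 0 (-ex r x) = - ex r x := by
    omega
  omega

lemma regular {r} (h : C4 r) (hk : K4 r) : (∀ x, ex r x = 0) ∧ ∀ y, ex (tr r) y = 0 := by
  have d1 := dicho h hk
  have d2 := dicho h.tr hk.tr
  have ett : tr (tr r) = r := rfl
  rw [ett] at d2
  have t := total_ex r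
  have p1 := posneg h _ rfl
  have p2 := posneg h.tr _ rfl
  rw [ett] at p2
  have q1 := pos_sub_neg r
  have q2 := pos_sub_neg (tr r)
  have s1 := pos_add_neg r
  have s2 := pos_add_neg (tr r)
  have n1 : 0 ≤ ∑ x, max 0 (-ex r x) := Finset.sum_nonneg fun x _ => le_max_left _ _
  have n2 : 0 ≤ ∑ x, max 0 (-ex (tr r) x) := Finset.sum_nonneg fun x _ => le_max_left _ _
  have hz : ∑ x, ex r x ^ 2 = ∑ x, ex r x ^ 2 := rfl
  generalize hN1 : ∑ x, max 0 (-ex r x) = N1 at *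
  generalize hN2 : ∑ x, max 0 (-ex (tr r) x) = N2 at *
  generalize hP1 : ∑ x, max 0 (ex r x) = P1 at *
  generalize hP2 : ∑ x, max 0 (ex (tr r) x) = P2 at *
  have b1 : N1 ≤ 3 := by omega
  have b2 : N2 ≤ 3 := by omega
  have fin : N1 = 0 ∧ N2 = 0 ∧ P1 = 0 ∧ P2 = 0 := by
    interval_cases N1 <;> interval_cases N2 <;> omega
  have zero : ∀ s : V → V → Bool, ∑ x, max 0 (-ex s x) = 0 → ∑ x, max 0 (ex s x) = 0 →
      ∀ x, ex s x = 0 := by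
    intro s ha hb x
    rw [Finset.sum_eq_zero_iff_of_nonneg (fun x _ => le_max_left _ _)] at ha hb
    have := ha x (Finset.mem_univ x)
    have := hb x (Finset.mem_univ x)
    omega
  exact ⟨zero r (by omega) (by omega), zero (tr r) (by omega) (by omega)⟩

/-- neighbourhood -/
def Nb (r : V → V → Bool) (x : V) : Finset V := Finset.univ.filter (fun y => r x y = true)

lemma mem_Nb {r x y} : y ∈ Nb r x ↔ r x y = true := by simp [Nb]

/-- points not joined to `x` -/
def nc (r : V → V → Bool) (x : V) : Finset V :=
  (Finset.univ.erase x).filter (fun x' => ∀ y, ¬ (r x y = true ∧ r x' y = true))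

lemma nc_card {r} (h : C4 r) (hx : ∀ x, dg r x = 4) (hy : ∀ y, dg (tr r) y = 4) (x : V) :
    (nc r x).card ≤ 1 := by
  have e := rowsum_eq r x
  simp only [hy] at e
  rw [← Finset.sum_mul] at e
  change dg r x * _ = _ at e
  rw [hx] at e
  have h1 : ∑ x' ∈ Finset.univ.erase x, ∑ y, ind r x y * ind r x' y
      ≤ ∑ x' ∈ Finset.univ.erase x,
        (1 - if (∀ y, ¬ (r x y = true ∧ r x' y = true)) then (1:ℤ) else 0) := by
    apply Finset.sum_le_sum
    intro x' hx'
    split_ifs with hc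
    · apply le_of_eq
      rw [sub_self]
      apply Finset.sum_eq_zero
      intro y _
      have := hc y
      unfold ind
      split_ifs <;> simp_all
    · simpa using codeg h (Finset.ne_of_mem_erase hx').symm
  rw [← e, Finset.sum_sub_distrib, ← Finset.sum_filter] at h1
  change _ ≤ _ - ∑ a ∈ nc r x, (1:ℤ) at h1
  simp at h1
  omega

lemma joined {r x x'} (hne : x' ≠ x) (hn : x' ∉ nc r x) : ∃ y, r x y = true ∧ r x' y = true := by
  by_contra hc
  push Not at hc
  apply hn
  simp only [nc, Finset.mem_filter, Finset.mem_erase, Finset.mem_univ, and_true]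
  exact ⟨hne, fun y hy => hc y hy.1 hy.2⟩

lemma sdiff_le {S T W : Finset V} (hW : W ⊆ S ∩ T) : (S \ T).card + W.card ≤ S.card := by
  have h1 := Finset.card_le_card hW
  have h2 := Finset.card_sdiff_add_card_inter S T
  omega

lemma upper {r} (h : C4 r) (hk : K4 r) : False := by
  obtain ⟨ha, hb⟩ := regular h hk
  have hx : ∀ x, dg r x = 4 := fun x => by have := ha x; unfold ex at this; omega
  have hy : ∀ y, dg (tr r) y = 4 := fun y => by have := hb y; unfold ex at this; omega
  have cN : ∀ x, (Nb r x).card = 4 := fun x => by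
    have := hx x
    rw [dg_eq] at this
    exact_mod_cast this
  have cL : ∀ y, (Nb (tr r) y).card = 4 := fun y => by
    have := hy y
    rw [dg_eq] at this
    exact_mod_cast this
  have cn := nc_card h hx hy
  have pick : ∀ S : Finset V, S.card ≤ 13 → ∃ x, x ∉ S := by
    intro S hS
    by_contra hc
    push Not at hc
    have : S = Finset.univ := Finset.eq_univ_iff_forall.2 hc
    rw [this] at hS
    simp at hS
  -- first point and line
  obtain ⟨x1, -⟩ := pick ∅ (by simp)
  obtain ⟨y12, h1⟩ : (Nb r x1).Nonempty := Finset.card_pos.1 (by rw [cN]; norm_num)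
  rw [mem_Nb] at h1
  obtain ⟨x2, h2⟩ : ((Nb (tr r) y12).erase x1).Nonempty := by
    apply Finset.card_pos.1
    have := Finset.pred_card_le_card_erase (s := Nb (tr r) y12) (a := x1)
    have := cL y12
    omega
  obtain ⟨h21, h2⟩ := Finset.mem_erase.1 h2
  rw [mem_Nb] at h2
  change r x2 y12 = true at h2
  -- third point
  obtain ⟨x3, h3⟩ := pick (Nb (tr r) y12 ∪ nc r x1 ∪ nc r x2) (by
    have := Finset.card_union_le (Nb (tr r) y12 ∪ nc r x1) (nc r x2)
    have := Finset.card_union_le (Nb (tr r) y12) (nc r x1)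
    have := cL y12
    have := cn x1
    have := cn x2
    omega)
  simp only [Finset.mem_union, not_or, mem_Nb] at h3
  obtain ⟨⟨h3l, h31⟩, h32⟩ := h3
  change ¬ r x3 y12 = true at h3l
  have n31 : x3 ≠ x1 := by rintro rfl; exact h3l h1
  have n32 : x3 ≠ x2 := by rintro rfl; exact h3l h2
  obtain ⟨y13, h113, h313⟩ := joined n31 h31
  obtain ⟨y23, h223, h323⟩ := joined n32 h32
  -- fourth point
  obtain ⟨x4, h4⟩ := pick (Nb (tr r) y12 ∪ (Nb (tr r) y13).erase x1 ∪
      ((Nb (tr r) y23).erase x2).erase x3 ∪ nc r x1 ∪ nc r x2 ∪ nc r x3) (by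
    have := Finset.card_union_le (Nb (tr r) y12 ∪ (Nb (tr r) y13).erase x1 ∪
      ((Nb (tr r) y23).erase x2).erase x3 ∪ nc r x1 ∪ nc r x2) (nc r x3)
    have := Finset.card_union_le (Nb (tr r) y12 ∪ (Nb (tr r) y13).erase x1 ∪
      ((Nb (tr r) y23).erase x2).erase x3 ∪ nc r x1) (nc r x2)
    have := Finset.card_union_le (Nb (tr r) y12 ∪ (Nb (tr r) y13).erase x1 ∪
      ((Nb (tr r) y23).erase x2).erase x3) (nc r x1)
    have := Finset.card_union_le (Nb (tr r) y12 ∪ (Nb (tr r) y13).erase x1)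
      (((Nb (tr r) y23).erase x2).erase x3)
    have := Finset.card_union_le (Nb (tr r) y12) ((Nb (tr r) y13).erase x1)
    have := cL y12
    have := cL y13
    have := cL y23
    have := cn x1
    have := cn x2
    have := cn x3
    have := Finset.card_erase_of_mem (s := Nb (tr r) y13) (a := x1) (mem_Nb.2 h113)
    have := Finset.card_erase_of_mem (s := Nb (tr r) y23) (a := x2) (mem_Nb.2 h223)
    have := Finset.card_erase_of_mem (s := (Nb (tr r) y23).erase x2) (a := x3)
      (Finset.mem_erase.2 ⟨n32, mem_Nb.2 h323⟩)
    omega)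
  simp only [Finset.mem_union, not_or, mem_Nb, Finset.mem_erase, not_and] at h4
  obtain ⟨⟨⟨⟨⟨h4a, h4b⟩, h4c⟩, h41⟩, h42⟩, h43⟩ := h4
  change ¬ r x4 y12 = true at h4a
  have n41 : x4 ≠ x1 := by rintro rfl; exact h4a h1
  have n42 : x4 ≠ x2 := by rintro rfl; exact h4a h2
  have h4b' : ¬ r x4 y13 = true := h4b n41
  have n43 : x4 ≠ x3 := by rintro rfl; exact h4b' h313
  have h4c' : ¬ r x4 y23 = true := h4c n43 n42
  obtain ⟨y14, h114, h414⟩ := joined n41 h41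
  obtain ⟨y24, h224, h424⟩ := joined n42 h42
  obtain ⟨y34, h334, h434⟩ := joined n43 h43
  -- the lines are distinct
  have d1323 : y13 ≠ y23 := by
    rintro rfl
    exact h3l (h x1 x2 y12 y13 h21.symm h1 h113 h2 h223 ▸ h313)
  have d1424 : y14 ≠ y24 := by
    rintro rfl
    exact h4a (h x1 x2 y12 y14 h21.symm h1 h114 h2 h224 ▸ h414)
  have d1434 : y14 ≠ y34 := by
    rintro rfl
    exact h4b' (h x1 x3 y13 y14 n31.symm h113 h114 h313 h334 ▸ h414)
  have d2434 : y24 ≠ y34 := by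
    rintro rfl
    exact h4c' (h x2 x3 y23 y24 n32.symm h223 h224 h323 h334 ▸ h424)
  -- counting the union of neighbourhoods
  have u1 : (Nb r x2 \ Nb r x1).card ≤ 3 := by
    have := sdiff_le (S := Nb r x2) (T := Nb r x1) (W := {y12}) (by
      intro z hz
      simp only [Finset.mem_singleton] at hz
      subst hz
      simp [mem_Nb, *])
    rw [cN, Finset.card_singleton] at this
    omega
  have u2 : (Nb r x3 \ (Nb r x1 ∪ Nb r x2)).card ≤ 2 := by
    have := sdiff_le (S := Nb r x3) (T := Nb r x1 ∪ Nb r x2) (W := {y13, y23}) (by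
      intro z hz
      simp only [Finset.mem_insert, Finset.mem_singleton] at hz
      rcases hz with rfl | rfl <;> simp [mem_Nb, *])
    rw [cN, Finset.card_pair d1323] at this
    omega
  have u3 : (Nb r x4 \ (Nb r x1 ∪ Nb r x2 ∪ Nb r x3)).card ≤ 1 := by
    have := sdiff_le (S := Nb r x4) (T := Nb r x1 ∪ Nb r x2 ∪ Nb r x3) (W := {y14, y24, y34}) (by
      intro z hz
      simp only [Finset.mem_insert, Finset.mem_singleton] at hz
      rcases hz with rfl | rfl | rfl <;> simp [mem_Nb, *])
    rw [cN, Finset.card_eq_three.2 ⟨y14, y24, y34, d1424, d1434, d2434, rfl⟩] at this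
    omega
  have hU : (Nb r x1 ∪ Nb r x2 ∪ Nb r x3 ∪ Nb r x4).card ≤ 10 := by
    have e1 := Finset.card_union_le (Nb r x1) (Nb r x2 \ Nb r x1)
    have e2 := Finset.card_union_le (Nb r x1 ∪ Nb r x2) (Nb r x3 \ (Nb r x1 ∪ Nb r x2))
    have e3 := Finset.card_union_le (Nb r x1 ∪ Nb r x2 ∪ Nb r x3)
      (Nb r x4 \ (Nb r x1 ∪ Nb r x2 ∪ Nb r x3))
    rw [Finset.union_sdiff_self_eq_union] at e1 e2 e3
    have := cN x1
    omega
  have hA : ({x1, x2, x3, x4} : Finset V).card = 4 := by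
    rw [Finset.card_insert_of_notMem, Finset.card_insert_of_notMem, Finset.card_pair n43.symm]
    · simp [n32.symm, n42.symm]
    · simp [h21.symm, n31.symm, n41.symm]
  have hm := hk _ hA
  have hsub : (Nb r x1 ∪ Nb r x2 ∪ Nb r x3 ∪ Nb r x4)ᶜ ⊆
      Finset.univ.filter (fun y => ∀ x ∈ ({x1, x2, x3, x4} : Finset V), r x y = false) := by
    intro y hy
    simpa [mem_Nb, and_assoc] using hy
  have := Finset.card_le_card hsub
  rw [Finset.card_compl, Fintype.card_fin] at this
  omega

end BR

/-- The bipartite Ramsey number BR(K_{2,2}, K_{4,4}) equals 14. -/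
theorem br_K22_K44_eq_14 :
    IsLeast {b : ℕ | 0 < b ∧ ∀ G : Finset (Fin b × Fin b),
      ContainsK b b 2 2 G ∨ ContainsK b b 4 4 (bipCompl b b G)} 14 := by
  constructor
  · refine ⟨by norm_num, fun G => ?_⟩
    by_contra hc
    push Not at hc
    obtain ⟨h2, h4⟩ := hc
    apply BR.upper (r := fun x y => decide ((x, y) ∈ G))
    · intro x x' y y' hx a b c d
      by_contra hy
      simp only [decide_eq_true_eq] at a b c d
      refine h2 ⟨{x, x'}, {y, y'}, Finset.card_pair hx, Finset.card_pair hy, ?_⟩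
      intro z hz w hw
      simp only [Finset.mem_insert, Finset.mem_singleton] at hz hw
      rcases hz with rfl | rfl <;> rcases hw with rfl | rfl <;> assumption
    · intro A hA
      by_contra hc
      push Not at hc
      obtain ⟨B, hB, hB4⟩ := Finset.exists_subset_card_eq (Nat.succ_le_of_lt hc)
      refine h4 ⟨A, B, hA, hB4, ?_⟩
      intro x hx y hy
      have := hB hy
      simp only [Finset.mem_filter, Finset.mem_univ, true_and, decide_eq_false_iff_not] at this
      simpa [bipCompl] using this x hx
  · rintro b ⟨-, hb⟩
    by_contra hlt
    obtain ⟨G, h1, h2⟩ := BR.lower b (by omega)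
    exact (hb G).elim h1 h2
end
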